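/- For b̄ sufficiently large, let f ∈ K(b̄) be a C³ Lorenz map with negative Schwarzian derivative that is infinitely renormalizable with combinatorial type ω̄ ∈ Ω(b̄)^ℕ, and let Λ ⊂ [0,1] be the closure of the union of the forward orbits of the two critical values ĉ₀ and ĉ₁. Then: (1) Λ is a Cantor set (nonempty, compact, perfect, and totally disconnected); (2) Λ has zero Lebesgue measure; (3) the Hausdorff dimension of Λ lies strictly between 0 and 1; and (4) Lebesgue-almost every x ∈ [0,1] is attracted to Λ, i.e. dist(f^n(x), Λ) → 0 as n → ∞. -/

import Mathlib

open Set Filter MeasureTheory Topology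
open scoped Classical

noncomputable section

/-- The standard Lorenz family `Q(x)` with critical exponent `α`,
critical point `c`, and critical values `u`, `1 - v`. -/
def lorenzQ (α u v c : ℝ) (x : ℝ) : ℝ :=
  if x < c then u * (1 - ((c - x) / c) ^ α)
  else 1 + v * (-1 + ((x - c) / (1 - c)) ^ α)

/-- A Lorenz map on `[0,1] ∖ {c}` with critical exponent `α`, given by the data
`(u, v, c, φ, ψ)` where `φ, ψ` are orientation-preserving homeomorphisms of `[0,1]`
(smoothness is imposed separately by `LorenzMap.IsCk`). -/
structure LorenzMap (α : ℝ) where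
  u : ℝ
  v : ℝ
  c : ℝ
  φ : ℝ → ℝ
  ψ : ℝ → ℝ
  hu : u ∈ Icc (0 : ℝ) 1
  hv : v ∈ Icc (0 : ℝ) 1
  hc : c ∈ Ioo (0 : ℝ) 1
  hφ0 : φ 0 = 0
  hφ1 : φ 1 = 1
  hψ0 : ψ 0 = 0
  hψ1 : ψ 1 = 1
  hφmono : StrictMonoOn φ (Icc 0 1)
  hψmono : StrictMonoOn ψ (Icc 0 1)
  hφcont : ContinuousOn φ (Icc 0 1)
  hψcont : ContinuousOn ψ (Icc 0 1)

namespace LorenzMap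

variable {α : ℝ}

/-- The underlying interval map `f(x) = φ(Q(x))` for `x < c`, `ψ(Q(x))` for `x > c`
(the value at `x = c` itself is a junk convention; `c` is not in the domain). -/
def toFun (f : LorenzMap α) : ℝ → ℝ := fun x =>
  if x < f.c then f.φ (lorenzQ α f.u f.v f.c x) else f.ψ (lorenzQ α f.u f.v f.c x)

/-- Left critical value `ĉ₁ = lim_{x ↑ c} f(x) = φ(u)`. -/
def cv1 (f : LorenzMap α) : ℝ := f.φ f.u

/-- Right critical value `ĉ₀ = lim_{x ↓ c} f(x) = ψ(1 - v)`. -/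
def cv0 (f : LorenzMap α) : ℝ := f.ψ (1 - f.v)

/-- A Lorenz map is nontrivial if `ĉ₀ < c < ĉ₁`. -/
def IsNontrivial (f : LorenzMap α) : Prop := f.cv0 < f.c ∧ f.c < f.cv1

end LorenzMap

/-- `φ` is an orientation-preserving `C^k` diffeomorphism of `[0,1]` onto itself. -/
def IsOPDiffeo (k : ℕ) (φ : ℝ → ℝ) : Prop :=
  ContDiffOn ℝ k φ (Icc 0 1) ∧ φ 0 = 0 ∧ φ 1 = 1 ∧ StrictMonoOn φ (Icc 0 1) ∧
    ∀ x ∈ Icc (0 : ℝ) 1, 0 < derivWithin φ (Icc 0 1) x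

/-- A `C^k` Lorenz map: both diffeomorphic parts are orientation-preserving `C^k`
diffeomorphisms of `[0,1]`. -/
def LorenzMap.IsCk {α : ℝ} (k : ℕ) (f : LorenzMap α) : Prop :=
  IsOPDiffeo k f.φ ∧ IsOPDiffeo k f.ψ

/-- The Schwarzian derivative `Sf = f'''/f' - (3/2) (f''/f')²`. -/
def schwarzian (f : ℝ → ℝ) (x : ℝ) : ℝ :=
  deriv (deriv (deriv f)) x / deriv f x - (3 / 2) * (deriv (deriv f) x / deriv f x) ^ 2

/-- `f` has negative Schwarzian derivative on `[0,1] ∖ {c}`. -/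
def LorenzMap.NegSchwarzian {α : ℝ} (f : LorenzMap α) : Prop :=
  ∀ x ∈ Icc (0 : ℝ) 1 \ {f.c}, schwarzian f.toFun x < 0

/-- Distortion of a diffeomorphism of `[0,1]`:
`Dist φ = sup_{x,y ∈ [0,1]} log (φ'(x) / φ'(y))`. -/
def distortion (φ : ℝ → ℝ) : ℝ :=
  ⨆ x : Icc (0 : ℝ) 1, ⨆ y : Icc (0 : ℝ) 1,
    Real.log (derivWithin φ (Icc 0 1) x.1 / derivWithin φ (Icc 0 1) y.1)

/-- Membership in the set `K(b̄)`: `f` is a `C¹` Lorenz map with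
`α^{-b̄/α} ≤ 1 - c ≤ θ α^{-b̄σ/α²}` and `Dist φ, Dist ψ ≤ δ = (1/b̄)²`. -/
def memK (α σ θ : ℝ) (bbar : ℕ) (f : LorenzMap α) : Prop :=
  f.IsCk 1 ∧
  α ^ (-(bbar : ℝ) / α) ≤ 1 - f.c ∧
  1 - f.c ≤ θ * α ^ (-(bbar : ℝ) * σ / α ^ 2) ∧
  distortion f.φ ≤ (1 / (bbar : ℝ)) ^ 2 ∧ distortion f.ψ ≤ (1 / (bbar : ℝ)) ^ 2

/-- The monotone type with `a` ones and `b` zeros (encoded as the pair `(a, b)`)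
belongs to `Ω(b̄)`: `α + σ ≤ a + 1 ≤ 2α - σ` and `b̄ ≤ b ≤ (1 + (σ/α)² - β) b̄`. -/
def memOmega (α σ β : ℝ) (bbar : ℕ) (ab : ℕ × ℕ) : Prop :=
  1 ≤ ab.1 ∧ 1 ≤ ab.2 ∧
  α + σ ≤ (ab.1 : ℝ) + 1 ∧ (ab.1 : ℝ) + 1 ≤ 2 * α - σ ∧
  (bbar : ℝ) ≤ (ab.2 : ℝ) ∧ (ab.2 : ℝ) ≤ (1 + (σ / α) ^ 2 - β) * (bbar : ℝ)

/-- `(p,q)` is a return interval around `c` on which the first-return map of `f`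
is `f^{a+1}` on `L = (p,c)` and `f^{b+1}` on `R = (c,q)`, with monotone combinatorics:
`f^i(L) ⊂ (c,1)` for `1 ≤ i ≤ a` and `f^j(R) ⊂ (0,c)` for `1 ≤ j ≤ b`,
all intermediate iterates staying outside `(p,q)`. -/
def ReturnCond {α : ℝ} (f : LorenzMap α) (a b : ℕ) (p q : ℝ) : Prop :=
  1 ≤ a ∧ 1 ≤ b ∧ 0 ≤ p ∧ p < f.c ∧ f.c < q ∧ q ≤ 1 ∧ (0 < p ∨ q < 1) ∧
  (∀ x ∈ Ioo p f.c,
    (∀ i : ℕ, 1 ≤ i → i ≤ a → f.toFun^[i] x ∈ Ioo f.c 1 ∧ f.toFun^[i] x ∉ Ioo p q) ∧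
    f.toFun^[a + 1] x ∈ Ioo p q) ∧
  (∀ x ∈ Ioo f.c q,
    (∀ j : ℕ, 1 ≤ j → j ≤ b → f.toFun^[j] x ∈ Ioo 0 f.c ∧ f.toFun^[j] x ∉ Ioo p q) ∧
    f.toFun^[b + 1] x ∈ Ioo p q)

/-- A return interval which is maximal among all return intervals containing it. -/
def IsMaxReturnInterval {α : ℝ} (f : LorenzMap α) (a b : ℕ) (p q : ℝ) : Prop :=
  ReturnCond f a b p q ∧
  ∀ a' b' : ℕ, ∀ p' q' : ℝ, ReturnCond f a' b' p' q' → Ioo p q ⊆ Ioo p' q' →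
    p = p' ∧ q = q'

/-- `g` is the renormalization of `f`, of monotone type with `a` ones and `b` zeros:
`g` is the nontrivial Lorenz map obtained by affinely rescaling the first-return map
of `f` to the maximal return interval `(p,q)`. -/
def RenormOf {α : ℝ} (f : LorenzMap α) (a b : ℕ) (g : LorenzMap α) : Prop :=
  ∃ p q : ℝ, IsMaxReturnInterval f a b p q ∧
    g.c = (f.c - p) / (q - p) ∧ g.IsNontrivial ∧
    (∀ x ∈ Ioo p f.c, g.toFun ((x - p) / (q - p)) = (f.toFun^[a + 1] x - p) / (q - p)) ∧
    (∀ x ∈ Ioo f.c q, g.toFun ((x - p) / (q - p)) = (f.toFun^[b + 1] x - p) / (q - p))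

/-- `f` is renormalizable of monotone type `(01⋯1, 10⋯0)` with `a` ones and `b` zeros. -/
def MonRenormalizable {α : ℝ} (f : LorenzMap α) (a b : ℕ) : Prop :=
  ∃ g : LorenzMap α, RenormOf f a b g

/-- The renormalization operator (defined via choice on renormalizable maps
of monotone type; the identity on non-renormalizable maps). -/
def renormOp (α : ℝ) (f : LorenzMap α) : LorenzMap α :=
  if h : ∃ g : LorenzMap α, ∃ a b : ℕ, RenormOf f a b g then h.choose else f

/-- `f` is infinitely renormalizable with (monotone) combinatorial type
`ω = (ω₀, ω₁, …)`, each `ω n` encoded as the pair (number of ones, number of zeros). -/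
def InfRenormType (α : ℝ) (f : LorenzMap α) (ω : ℕ → ℕ × ℕ) : Prop :=
  ∀ n : ℕ, MonRenormalizable ((renormOp α)^[n] f) (ω n).1 (ω n).2

/-- `(p,q)` is a nice interval for `f`: an open subinterval of `[0,1]` containing the
critical point whose boundary orbits are disjoint from it. -/
def IsNiceInterval {α : ℝ} (f : LorenzMap α) (p q : ℝ) : Prop :=
  0 ≤ p ∧ p < f.c ∧ f.c < q ∧ q ≤ 1 ∧
  (∀ n : ℕ, f.toFun^[n] p ∉ Ioo p q) ∧ (∀ n : ℕ, f.toFun^[n] q ∉ Ioo p q)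

/-- The domain `⋃_{n ≥ 0} f^{-n}(C)` of the transfer map to `C`:
points of `[0,1]` some iterate of which lies in `C`, the critical point not being hit
before entering `C`. -/
def transferDomain {α : ℝ} (f : LorenzMap α) (C : Set ℝ) : Set ℝ :=
  {x ∈ Icc (0 : ℝ) 1 | ∃ n : ℕ, f.toFun^[n] x ∈ C ∧ ∀ j < n, f.toFun^[j] x ≠ f.c}

/-- The transfer time to `C`: the least `n ≥ 0` with `f^n(x) ∈ C`. -/
def transferTime {α : ℝ} (f : LorenzMap α) (C : Set ℝ) (x : ℝ) : ℕ :=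
  sInf {n : ℕ | f.toFun^[n] x ∈ C ∧ ∀ j < n, f.toFun^[j] x ≠ f.c}

/-- `(p,q)` contains a `δ`-scaled neighborhood of `(p',q')`: both components of the
difference have length greater than `δ (q' - p')`. -/
def ScaledInside (δ p q p' q' : ℝ) : Prop :=
  p < p' ∧ q' < q ∧ δ * (q' - p') < p' - p ∧ δ * (q' - p') < q - q'

/-- The weak Markov property: a nested sequence of nice intervals, each containing a
`δ`-scaled neighborhood of the next, with almost everywhere defined transfer maps. -/
def LorenzMap.WeakMarkov {α : ℝ} (f : LorenzMap α) : Prop :=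
  ∃ δ : ℝ, 0 < δ ∧ ∃ p q : ℕ → ℝ,
    (∀ n, IsNiceInterval f (p n) (q n)) ∧
    (∀ n, ScaledInside δ (p n) (q n) (p (n + 1)) (q (n + 1))) ∧
    (∀ n, volume (Icc (0 : ℝ) 1 \ transferDomain f (Ioo (p n) (q n))) = 0)

/-- `f` has a periodic attractor: a periodic orbit attracting an open set of points. -/
def LorenzMap.HasPeriodicAttractor {α : ℝ} (f : LorenzMap α) : Prop :=
  ∃ p ∈ Icc (0 : ℝ) 1, ∃ m : ℕ, 1 ≤ m ∧ f.toFun^[m] p = p ∧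
    ∃ U : Set ℝ, IsOpen U ∧ (U ∩ Icc (0 : ℝ) 1).Nonempty ∧
      ∀ x ∈ U ∩ Icc (0 : ℝ) 1, Tendsto (fun n => f.toFun^[n * m] x) atTop (𝓝 p)

/-- `W` is a wandering interval of `f`: a nondegenerate interval in `[0,1]` on which all
iterates are defined (no iterate meets the critical point), whose iterates are pairwise
disjoint, and whose forward orbit does not converge to a periodic orbit. -/
def LorenzMap.IsWanderingInterval {α : ℝ} (f : LorenzMap α) (W : Set ℝ) : Prop :=
  W ⊆ Icc 0 1 ∧ W.OrdConnected ∧ (∃ x ∈ W, ∃ y ∈ W, x < y) ∧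
  (∀ n : ℕ, f.c ∉ f.toFun^[n] '' W) ∧
  (∀ m n : ℕ, m ≠ n → Disjoint (f.toFun^[m] '' W) (f.toFun^[n] '' W)) ∧
  ¬ ∃ p ∈ Icc (0 : ℝ) 1, ∃ m : ℕ, 1 ≤ m ∧ f.toFun^[m] p = p ∧
      ∀ x ∈ W, Tendsto
        (fun n => Metric.infDist (f.toFun^[n] x) {y : ℝ | ∃ i < m, f.toFun^[i] p = y})
        atTop (𝓝 0)


theorem mlL {a b c : ℝ} (h : b ≤ c) (ha : 0 ≤ a) : a * b ≤ a * c := mul_le_mul_of_nonneg_left h ha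

theorem mlR {a b c : ℝ} (h : b ≤ c) (ha : 0 ≤ a) : b * a ≤ c * a := mul_le_mul_of_nonneg_right h ha

theorem lML {a b c : ℝ} (h : c * a ≤ c * b) (hc : 0 < c) : a ≤ b := le_of_mul_le_mul_left h hc

theorem rpp {x : ℝ} (hx : 0 < x) (y : ℝ) : 0 < x ^ y := Real.rpow_pos_of_pos hx y

theorem rlr {x y z : ℝ} (h : 0 ≤ x) (h1 : x ≤ y) (h2 : 0 ≤ z) : x ^ z ≤ y ^ z := Real.rpow_le_rpow h h1 h2

def PS (k : ℝ → ℝ) (I : Set ℝ) : Prop :=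
  ∃ W W1 W2 : ℝ → ℝ, ∀ x ∈ I, 0 < W x ∧ HasDerivAt k (1 / (W x) ^ 2) x ∧
    HasDerivAt W (W1 x) x ∧ HasDerivAt W1 (W2 x) x ∧ W2 x ≤ 0

theorem PS.mono {k : ℝ → ℝ} {I J : Set ℝ} (h : PS k I) (hJ : J ⊆ I) : PS k J := by
  obtain ⟨W, W1, W2, H⟩ := h
  exact ⟨W, W1, W2, fun x hx => H x (hJ hx)⟩

theorem PS.comp {k1 k2 : ℝ → ℝ} {I1 I2 : Set ℝ} (h1 : PS k1 I1) (h2 : PS k2 I2)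
    (hm : ∀ x ∈ I2, k2 x ∈ I1) : PS (k1 ∘ k2) I2 := by
  obtain ⟨A, A1, A2, HA⟩ := h1
  obtain ⟨B, B1, B2, HB⟩ := h2
  refine ⟨fun x => A (k2 x) * B x, fun x => A1 (k2 x) / B x + A (k2 x) * B1 x,
    fun x => A2 (k2 x) / (B x) ^ 3 + A (k2 x) * B2 x, fun x hx => ?_⟩
  obtain ⟨a0, a1, a2, a3, a4⟩ := HA (k2 x) (hm x hx)
  obtain ⟨b0, b1, b2, b3, b4⟩ := HB x hx
  have hne : B x ≠ 0 := b0.ne'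
  have hA : HasDerivAt (fun x => A (k2 x)) (A1 (k2 x) * (1 / (B x) ^ 2)) x := a2.comp x b1
  have hA1 : HasDerivAt (fun x => A1 (k2 x)) (A2 (k2 x) * (1 / (B x) ^ 2)) x := a3.comp x b1
  refine ⟨mul_pos a0 b0, ?_, ?_, ?_, ?_⟩
  · have := a1.comp x b1
    have h0 := a0.ne'
    refine this.congr_deriv ?_
    field_simp
  · have := hA.mul b2
    refine this.congr_deriv ?_
    field_simp
  · have := (hA1.div b2 hne).add (hA.mul b3)
    refine this.congr_deriv ?_
    field_simp
    ring
  · have : A2 (k2 x) / (B x) ^ 3 ≤ 0 := div_nonpos_of_nonpos_of_nonneg a4 (by positivity)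
    have : A (k2 x) * B2 x ≤ 0 := mul_nonpos_of_nonneg_of_nonpos a0.le b4
    linarith

theorem PS.affine {A : ℝ} (hA : 0 < A) (B : ℝ) (I : Set ℝ) : PS (fun x => A * x + B) I := by
  refine ⟨fun _ => 1 / Real.sqrt A, fun _ => 0, fun _ => 0, fun x _ =>
    ⟨by positivity, ?_, hasDerivAt_const _ _, hasDerivAt_const _ _, le_refl _⟩⟩
  have h1 : HasDerivAt (fun x => A * x + B) (A * 1) x := ((hasDerivAt_id x).const_mul A).add_const B
  convert h1 using 1
  rw [div_pow, Real.sq_sqrt hA.le]; field_simp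

theorem PS.congr {k k' : ℝ → ℝ} {I : Set ℝ} (hI : IsOpen I) (h : PS k I)
    (he : ∀ x ∈ I, k' x = k x) : PS k' I := by
  obtain ⟨A, A1, A2, HA⟩ := h
  refine ⟨A, A1, A2, fun x hx => ?_⟩
  obtain ⟨a0, a1, a2, a3, a4⟩ := HA x hx
  refine ⟨a0, ?_, a2, a3, a4⟩
  apply a1.congr_of_eventuallyEq
  filter_upwards [hI.mem_nhds hx] with y hy using he y hy

theorem PS.id (I : Set ℝ) : PS (fun x => x) I := by
  have := PS.affine (A := 1) one_pos 0 I
  simpa using this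

theorem PS.iter {k : ℝ → ℝ} {I : Set ℝ} (h : PS k I) (hm : ∀ x ∈ I, k x ∈ I) (n : ℕ) :
    PS (k^[n]) I := by
  induction n with
  | zero => exact PS.id I
  | succ n ih => rw [Function.iterate_succ]; exact ih.comp h hm

theorem PS.hasDeriv {k : ℝ → ℝ} {I : Set ℝ} (h : PS k I) {x : ℝ} (hx : x ∈ I) :
    HasDerivAt k (deriv k x) x := by
  obtain ⟨A, A1, A2, HA⟩ := h
  exact (HA x hx).2.1.differentiableAt.hasDerivAt

theorem PS.deriv_pos {k : ℝ → ℝ} {I : Set ℝ} (h : PS k I) {x : ℝ} (hx : x ∈ I) :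
    0 < deriv k x := by
  obtain ⟨A, A1, A2, HA⟩ := h
  obtain ⟨a0, a1, -⟩ := HA x hx
  rw [a1.deriv]; positivity

theorem concave_ratio {W : ℝ → ℝ} {A B : ℝ} (hc : ConcaveOn ℝ (Ioo A B) W)
    (hp : ∀ x ∈ Ioo A B, 0 < W x) {x y : ℝ} (hx : A < x) (hxy : x < y) (hy : y < B) :
    (x - A) * W y ≤ (y - A) * W x ∧ (B - y) * W x ≤ (B - x) * W y := by
  constructor
  · have key : ∀ᶠ A' in 𝓝[>] A, (x - A') * W y ≤ (y - A') * W x := by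
      have : Ioo A x ∈ 𝓝[>] A := Ioo_mem_nhdsGT hx
      filter_upwards [this] with A' hA'
      have hne : 0 < y - A' := by linarith [hA'.2]
      have m1 : A' ∈ Ioo A B := ⟨hA'.1, by linarith [hA'.2]⟩
      have m2 : y ∈ Ioo A B := ⟨by linarith, hy⟩
      have a1 : 0 ≤ (y - x) / (y - A') := div_nonneg (by linarith) hne.le
      have a2 : 0 ≤ (x - A') / (y - A') := div_nonneg (by linarith [hA'.2]) hne.le
      have h1 := hc.2 m1 m2 a1 a2 (by field_simp; ring)
      have e : ((y - x) / (y - A')) • A' + ((x - A') / (y - A')) • y = x := by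
        simp only [smul_eq_mul]; field_simp; ring
      rw [e] at h1
      simp only [smul_eq_mul] at h1
      have hWA := hp A' ⟨hA'.1, by linarith [hA'.2]⟩
      have h2 : (x - A') / (y - A') * W y ≤ W x := by
        have : 0 ≤ (y - x) / (y - A') * W A' := by
          apply mul_nonneg (div_nonneg (by linarith) hne.le) hWA.le
        linarith
      rw [div_mul_eq_mul_div, div_le_iff₀ hne] at h2
      linarith
    have t1 : Tendsto (fun A' => (x - A') * W y) (𝓝[>] A) (𝓝 ((x - A) * W y)) :=
      ((continuous_const.sub continuous_id).mul continuous_const).continuousWithinAt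
    have t2 : Tendsto (fun A' => (y - A') * W x) (𝓝[>] A) (𝓝 ((y - A) * W x)) :=
      ((continuous_const.sub continuous_id).mul continuous_const).continuousWithinAt
    exact le_of_tendsto_of_tendsto t1 t2 key
  · have key : ∀ᶠ B' in 𝓝[<] B, (B' - y) * W x ≤ (B' - x) * W y := by
      have : Ioo y B ∈ 𝓝[<] B := Ioo_mem_nhdsLT hy
      filter_upwards [this] with B' hB'
      have hne : 0 < B' - x := by linarith [hB'.1]
      have m1 : x ∈ Ioo A B := ⟨hx, by linarith⟩
      have m2 : B' ∈ Ioo A B := ⟨by linarith [hB'.1], hB'.2⟩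
      have a1 : 0 ≤ (B' - y) / (B' - x) := div_nonneg (by linarith [hB'.1]) hne.le
      have a2 : 0 ≤ (y - x) / (B' - x) := div_nonneg (by linarith) hne.le
      have h1 := hc.2 m1 m2 a1 a2 (by field_simp; ring)
      have e : ((B' - y) / (B' - x)) • x + ((y - x) / (B' - x)) • B' = y := by
        simp only [smul_eq_mul]; field_simp; ring
      rw [e] at h1
      simp only [smul_eq_mul] at h1
      have hWB := hp B' ⟨by linarith [hB'.1], hB'.2⟩
      have h2 : (B' - y) / (B' - x) * W x ≤ W y := by
        have : 0 ≤ (y - x) / (B' - x) * W B' := by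
          apply mul_nonneg (div_nonneg (by linarith) hne.le) hWB.le
        linarith
      rw [div_mul_eq_mul_div, div_le_iff₀ hne] at h2
      linarith
    have t1 : Tendsto (fun B' => (B' - y) * W x) (𝓝[<] B) (𝓝 ((B - y) * W x)) :=
      ((continuous_id.sub continuous_const).mul continuous_const).continuousWithinAt
    have t2 : Tendsto (fun B' => (B' - x) * W y) (𝓝[<] B) (𝓝 ((B - x) * W y)) :=
      ((continuous_id.sub continuous_const).mul continuous_const).continuousWithinAt
    exact le_of_tendsto_of_tendsto t1 t2 key

theorem PS.koebe {k : ℝ → ℝ} {A B : ℝ} (h : PS k (Ioo A B)) {x y : ℝ}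
    (hx : A < x) (hxy : x < y) (hy : y < B) :
    deriv k x ≤ ((y - A) / (x - A)) ^ 2 * deriv k y ∧
    deriv k y ≤ ((B - x) / (B - y)) ^ 2 * deriv k x := by
  obtain ⟨W, W1, W2, H⟩ := h
  have hc : ConcaveOn ℝ (Ioo A B) W := by
    apply concaveOn_of_hasDerivWithinAt2_nonpos (convex_Ioo A B) (f' := W1) (f'' := W2)
    · intro z hz; exact (H z hz).2.2.1.continuousAt.continuousWithinAt
    · intro z hz; rw [interior_Ioo] at hz; exact (H z hz).2.2.1.hasDerivWithinAt
    · intro z hz; rw [interior_Ioo] at hz; exact (H z hz).2.2.2.1.hasDerivWithinAt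
    · intro z hz; rw [interior_Ioo] at hz; exact (H z hz).2.2.2.2
  have hx' : x ∈ Ioo A B := ⟨hx, by linarith⟩
  have hy' : y ∈ Ioo A B := ⟨by linarith, hy⟩
  obtain ⟨r1, r2⟩ := concave_ratio hc (fun z hz => (H z hz).1) hx hxy hy
  have px := (H x hx').1
  have py := (H y hy').1
  rw [(H x hx').2.1.deriv, (H y hy').2.1.deriv]
  have g1 : 0 < x - A := by linarith
  have g2 : 0 < B - y := by linarith
  have g3 : 0 < y - A := by linarith
  have g4 : 0 < B - x := by linarith
  constructor
  · rw [div_pow, div_mul_div_comm, mul_one, div_le_div_iff₀ (by positivity) (by positivity), one_mul,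
      ← mul_pow, ← mul_pow]
    exact pow_le_pow_left₀ (by positivity) r1 2
  · rw [div_pow, div_mul_div_comm, mul_one, div_le_div_iff₀ (by positivity) (by positivity), one_mul,
      ← mul_pow, ← mul_pow]
    exact pow_le_pow_left₀ (by positivity) r2 2

theorem PS.strictMonoOn {k : ℝ → ℝ} {A B : ℝ} (h : PS k (Ioo A B)) : StrictMonoOn k (Ioo A B) := by
  apply strictMonoOn_of_deriv_pos (convex_Ioo A B)
  · intro z hz; exact (h.hasDeriv hz).continuousAt.continuousWithinAt
  · intro z hz; rw [interior_Ioo] at hz; exact h.deriv_pos hz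

structure Br (k : ℝ → ℝ) (A B A' B' : ℝ) : Prop where
  hAB : A < B
  mono : StrictMonoOn k (Icc A B)
  cont : ContinuousOn k (Icc A B)
  hA : k A = A'
  hB : k B = B'

def binv (k : ℝ → ℝ) (A B : ℝ) : ℝ → ℝ := Function.invFunOn k (Icc A B)

namespace Br
variable {k : ℝ → ℝ} {A B A' B' : ℝ}

theorem lt (h : Br k A B A' B') : A' < B' := by
  rw [← h.hA, ← h.hB]
  exact h.mono (left_mem_Icc.2 h.hAB.le) (right_mem_Icc.2 h.hAB.le) h.hAB

theorem maps (h : Br k A B A' B') {x : ℝ} (hx : x ∈ Icc A B) : k x ∈ Icc A' B' := by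
  rw [← h.hA, ← h.hB]
  exact ⟨h.mono.monotoneOn (left_mem_Icc.2 h.hAB.le) hx hx.1,
    h.mono.monotoneOn hx (right_mem_Icc.2 h.hAB.le) hx.2⟩

theorem maps_Ioo (h : Br k A B A' B') {x : ℝ} (hx : x ∈ Ioo A B) : k x ∈ Ioo A' B' := by
  rw [← h.hA, ← h.hB]
  exact ⟨h.mono (left_mem_Icc.2 h.hAB.le) (Ioo_subset_Icc_self hx) hx.1,
    h.mono (Ioo_subset_Icc_self hx) (right_mem_Icc.2 h.hAB.le) hx.2⟩

theorem inv_spec (h : Br k A B A' B') {y : ℝ} (hy : y ∈ Icc A' B') :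
    binv k A B y ∈ Icc A B ∧ k (binv k A B y) = y := by
  have : y ∈ k '' Icc A B := by
    have := intermediate_value_Icc h.hAB.le h.cont
    rw [h.hA, h.hB] at this
    exact this hy
  exact ⟨Function.invFunOn_mem this, Function.invFunOn_eq this⟩

theorem inv_mem (h : Br k A B A' B') {y : ℝ} (hy : y ∈ Icc A' B') : binv k A B y ∈ Icc A B :=
  (h.inv_spec hy).1

theorem k_inv (h : Br k A B A' B') {y : ℝ} (hy : y ∈ Icc A' B') : k (binv k A B y) = y :=
  (h.inv_spec hy).2

theorem inv_k (h : Br k A B A' B') {x : ℝ} (hx : x ∈ Icc A B) : binv k A B (k x) = x :=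
  h.mono.injOn (h.inv_mem (h.maps hx)) hx (h.k_inv (h.maps hx))

theorem inv_A (h : Br k A B A' B') : binv k A B A' = A := by
  rw [← h.hA]; exact h.inv_k (left_mem_Icc.2 h.hAB.le)

theorem inv_B (h : Br k A B A' B') : binv k A B B' = B := by
  rw [← h.hB]; exact h.inv_k (right_mem_Icc.2 h.hAB.le)

theorem inv_mono (h : Br k A B A' B') : StrictMonoOn (binv k A B) (Icc A' B') := by
  intro x hx y hy hxy
  by_contra hc
  push Not at hc
  have := h.mono.monotoneOn (h.inv_mem hy) (h.inv_mem hx) hc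
  rw [h.k_inv hx, h.k_inv hy] at this
  linarith

theorem inv_cont (h : Br k A B A' B') : ContinuousOn (binv k A B) (Icc A' B') := by
  have hs : binv k A B '' Icc A' B' = Icc A B := by
    apply Subset.antisymm
    · rintro _ ⟨y, hy, rfl⟩; exact h.inv_mem hy
    · intro x hx; exact ⟨k x, h.maps hx, h.inv_k hx⟩
  have hc : IsClosed (Icc A B) := isClosed_Icc
  have hh : IsCompact (Icc A B) := isCompact_Icc
  intro y hy
  rw [Metric.continuousWithinAt_iff]
  by_contra hcon
  push Not at hcon
  obtain ⟨e, he, hcon⟩ := hcon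
  have hseq : ∀ n : ℕ, ∃ z ∈ Icc A' B', dist z y < 1 / ((n : ℝ) + 1) ∧
      e ≤ dist (binv k A B z) (binv k A B y) := fun n => by
    obtain ⟨z, hz⟩ := hcon (1 / ((n : ℝ) + 1)) (by positivity)
    exact ⟨z, hz.1, hz.2.1, hz.2.2⟩
  choose z hz1 hz2 hz3 using hseq
  obtain ⟨w, hw, φ, hφ, hlim⟩ := hh.tendsto_subseq (fun n => h.inv_mem (hz1 n))
  have hk : Tendsto (fun n => k (binv k A B (z (φ n)))) atTop (𝓝 (k w)) := by
    have := (h.cont w hw)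
    refine this.tendsto.comp ?_
    exact tendsto_nhdsWithin_iff.2 ⟨hlim, Eventually.of_forall fun n => h.inv_mem (hz1 _)⟩
  have hz0 : Tendsto z atTop (𝓝 y) := by
    rw [tendsto_iff_dist_tendsto_zero]
    exact squeeze_zero (fun _ => dist_nonneg) (fun n => (hz2 n).le)
      tendsto_one_div_add_atTop_nhds_zero_nat
  have hk2 : Tendsto (fun n => k (binv k A B (z (φ n)))) atTop (𝓝 y) := by
    have : (fun n => k (binv k A B (z (φ n)))) = z ∘ φ := by
      funext n; exact h.k_inv (hz1 _)
    rw [this]; exact hz0.comp hφ.tendsto_atTop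
  have hwy := tendsto_nhds_unique hk hk2
  have hw2 : w = binv k A B y := by rw [← hwy, h.inv_k hw]
  have hd : Tendsto (fun n => dist (binv k A B (z (φ n))) (binv k A B y)) atTop (𝓝 0) := by
    rw [← hw2]; exact tendsto_iff_dist_tendsto_zero.1 hlim
  have := ge_of_tendsto hd (Eventually.of_forall fun n => hz3 (φ n))
  linarith

theorem symm (h : Br k A B A' B') : Br (binv k A B) A' B' A B :=
  ⟨h.lt, h.inv_mono, h.inv_cont, h.inv_A, h.inv_B⟩

theorem inv_Ioo (h : Br k A B A' B') {y : ℝ} (hy : y ∈ Ioo A' B') : binv k A B y ∈ Ioo A B :=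
  h.symm.maps_Ioo hy
end Br

namespace LorenzMap
variable {α : ℝ} (g : LorenzMap α)

def gl (x : ℝ) : ℝ := g.φ (g.u * (1 - ((g.c - x) / g.c) ^ α))
def gr (x : ℝ) : ℝ := g.ψ (1 + g.v * (-1 + ((x - g.c) / (1 - g.c)) ^ α))
def ell : ℝ → ℝ := binv g.gl 0 g.c
def rr : ℝ → ℝ := binv g.gr g.c 1

variable {g}

theorem toFun_left {x : ℝ} (hx : x < g.c) : g.toFun x = g.gl x := by
  simp [toFun, gl, lorenzQ, hx]

theorem toFun_right {x : ℝ} (hx : g.c ≤ x) : g.toFun x = g.gr x := by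
  simp [toFun, gr, lorenzQ, not_lt.2 hx]

theorem IsNontrivial.u_pos (h : g.IsNontrivial) : 0 < g.u := by
  rcases g.hu.1.eq_or_lt with h0 | h0
  · have h2 := h.2
    have := g.hc.1
    rw [cv1, ← h0, g.hφ0] at h2
    linarith
  · exact h0

theorem IsNontrivial.v_pos (h : g.IsNontrivial) : 0 < g.v := by
  rcases g.hv.1.eq_or_lt with h0 | h0
  · have h2 := h.1
    have := g.hc.2
    rw [cv0, ← h0, sub_zero, g.hψ1] at h2
    linarith
  · exact h0

theorem QL_br (hα : 1 < α) (hu : 0 < g.u) :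
    Br (fun x => g.u * (1 - ((g.c - x) / g.c) ^ α)) 0 g.c 0 g.u := by
  have hc := g.hc.1
  refine ⟨hc, ?_, ?_, ?_, ?_⟩
  · intro x hx y hy hxy
    have : ((g.c - y) / g.c) ^ α < ((g.c - x) / g.c) ^ α := by
      apply Real.rpow_lt_rpow (div_nonneg (by linarith [hy.2]) hc.le) _ (by linarith)
      gcongr
    show g.u * (1 - ((g.c - x) / g.c) ^ α) < g.u * (1 - ((g.c - y) / g.c) ^ α)
    gcongr
  · have : Continuous fun x : ℝ => ((g.c - x) / g.c) ^ α :=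
      ((continuous_const.sub continuous_id).div_const _).rpow_const (fun _ => Or.inr (by linarith))
    exact (continuous_const.mul (continuous_const.sub this)).continuousOn
  · simp [hc.ne']
  · simp [Real.zero_rpow (by linarith : α ≠ 0)]

theorem QR_br (hα : 1 < α) (hv : 0 < g.v) :
    Br (fun x => 1 + g.v * (-1 + ((x - g.c) / (1 - g.c)) ^ α)) g.c 1 (1 - g.v) 1 := by
  have hc : 0 < 1 - g.c := by linarith [g.hc.2]
  refine ⟨g.hc.2, ?_, ?_, ?_, ?_⟩
  · intro x hx y hy hxy
    have : ((x - g.c) / (1 - g.c)) ^ α < ((y - g.c) / (1 - g.c)) ^ α := by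
      apply Real.rpow_lt_rpow (div_nonneg (by linarith [hx.1]) hc.le) _ (by linarith)
      gcongr
    show 1 + g.v * (-1 + ((x - g.c) / (1 - g.c)) ^ α) < 1 + g.v * (-1 + ((y - g.c) / (1 - g.c)) ^ α)
    gcongr
  · have : Continuous fun x : ℝ => ((x - g.c) / (1 - g.c)) ^ α :=
      ((continuous_id.sub continuous_const).div_const _).rpow_const (fun _ => Or.inr (by linarith))
    exact (continuous_const.add (continuous_const.mul (continuous_const.add this))).continuousOn
  · simp [Real.zero_rpow (by linarith : α ≠ 0)]; ring
  · simp [hc.ne']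

theorem gl_br (hα : 1 < α) (h : g.IsNontrivial) : Br g.gl 0 g.c 0 g.cv1 := by
  have H := g.QL_br hα h.u_pos
  have hm : ∀ x ∈ Icc 0 g.c, g.u * (1 - ((g.c - x) / g.c) ^ α) ∈ Icc (0:ℝ) 1 := fun x hx =>
    ⟨(H.maps hx).1, (H.maps hx).2.trans g.hu.2⟩
  refine ⟨H.hAB, fun x hx y hy hxy => g.hφmono (hm x hx) (hm y hy) (H.mono hx hy hxy),
    g.hφcont.comp H.cont hm, ?_, ?_⟩
  · have := H.hA
    simp only [gl]
    rw [this, g.hφ0]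
  · have := H.hB
    simp only [gl]
    rw [this]; rfl

theorem gr_br (hα : 1 < α) (h : g.IsNontrivial) : Br g.gr g.c 1 g.cv0 1 := by
  have H := g.QR_br hα h.v_pos
  have hm : ∀ x ∈ Icc g.c 1, 1 + g.v * (-1 + ((x - g.c) / (1 - g.c)) ^ α) ∈ Icc (0:ℝ) 1 :=
    fun x hx => ⟨by linarith [(H.maps hx).1, g.hv.2], (H.maps hx).2⟩
  refine ⟨H.hAB, fun x hx y hy hxy => g.hψmono (hm x hx) (hm y hy) (H.mono hx hy hxy),
    g.hψcont.comp H.cont hm, ?_, ?_⟩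
  · have := H.hA
    simp only [gr]
    rw [this]; rfl
  · have := H.hB
    simp only [gr]
    rw [this, g.hψ1]

theorem cv1_le_one (g : LorenzMap α) : g.cv1 ≤ 1 := by
  rw [cv1, ← g.hφ1]
  exact g.hφmono.monotoneOn g.hu ⟨by norm_num, le_refl _⟩ g.hu.2

theorem cv0_nonneg (g : LorenzMap α) : 0 ≤ g.cv0 := by
  rw [cv0, ← g.hψ0]
  exact g.hψmono.monotoneOn ⟨le_refl _, by norm_num⟩ ⟨by linarith [g.hv.2], by linarith [g.hv.1]⟩
    (by linarith [g.hv.2])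

end LorenzMap

theorem iterate_cont {k : ℝ → ℝ} {S : Set ℝ} (hk : ContinuousOn k S) (hm : ∀ x ∈ S, k x ∈ S)
    (n : ℕ) : ContinuousOn k^[n] S := by
  induction n with
  | zero => exact continuousOn_id
  | succ n ih => rw [Function.iterate_succ]; exact ih.comp hk hm

theorem iterate_maps {k : ℝ → ℝ} {S : Set ℝ} (hm : ∀ x ∈ S, k x ∈ S)
    (n : ℕ) {x : ℝ} (hx : x ∈ S) : k^[n] x ∈ S := by
  induction n with
  | zero => exact hx
  | succ n ih => rw [Function.iterate_succ', Function.comp_apply]; exact hm _ ih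

theorem iterate_mono {k : ℝ → ℝ} {S : Set ℝ} (hk : StrictMonoOn k S) (hm : ∀ x ∈ S, k x ∈ S)
    (n : ℕ) : StrictMonoOn k^[n] S := by
  induction n with
  | zero => exact fun x _ y _ h => h
  | succ n ih =>
    intro x hx y hy h
    rw [Function.iterate_succ, Function.comp_apply, Function.comp_apply]
    exact ih (hm _ hx) (hm _ hy) (hk hx hy h)

namespace LorenzMap
variable {α : ℝ} {g : LorenzMap α}

theorem rr_maps (hα : 1 < α) (h : g.IsNontrivial) : ∀ x ∈ Icc g.cv0 1, g.rr x ∈ Icc g.cv0 1 :=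
  fun _ hx => ⟨h.1.le.trans ((g.gr_br hα h).inv_mem hx).1, ((g.gr_br hα h).inv_mem hx).2⟩

theorem ell_maps (hα : 1 < α) (h : g.IsNontrivial) : ∀ x ∈ Icc 0 g.cv1, g.ell x ∈ Icc 0 g.cv1 :=
  fun _ hx => ⟨((g.gl_br hα h).inv_mem hx).1, ((g.gl_br hα h).inv_mem hx).2.trans h.2.le⟩

theorem rr_iter (hα : 1 < α) (h : g.IsNontrivial) (a : ℕ) (x : ℝ)
    (H : ∀ i : ℕ, 1 ≤ i → i ≤ a → g.toFun^[i] x ∈ Ioo g.c 1) :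
    g.rr^[a] (g.toFun^[a + 1] x) = g.toFun x := by
  induction a with
  | zero => rfl
  | succ n ih =>
    have h1 := H (n + 1) (by omega) le_rfl
    rw [Function.iterate_succ_apply' g.toFun, Function.iterate_succ_apply, toFun_right h1.1.le, rr,
      (g.gr_br hα h).inv_k (Ioo_subset_Icc_self h1)]
    exact ih fun i hi hi' => H i hi (by omega)

theorem ell_iter (hα : 1 < α) (h : g.IsNontrivial) (a : ℕ) (x : ℝ)
    (H : ∀ i : ℕ, 1 ≤ i → i ≤ a → g.toFun^[i] x ∈ Ioo 0 g.c) :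
    g.ell^[a] (g.toFun^[a + 1] x) = g.toFun x := by
  induction a with
  | zero => rfl
  | succ n ih =>
    have h1 := H (n + 1) (by omega) le_rfl
    rw [Function.iterate_succ_apply' g.toFun, Function.iterate_succ_apply, toFun_left h1.2, ell,
      (g.gl_br hα h).inv_k (Ioo_subset_Icc_self h1)]
    exact ih fun i hi hi' => H i hi (by omega)
end LorenzMap

structure RD {α : ℝ} (g g1 : LorenzMap α) (a b : ℕ) (p q : ℝ) : Prop where
  ha : 1 ≤ a
  hb : 1 ≤ b
  p0 : 0 < p
  pc : p < g.c
  cq : g.c < q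
  q1 : q < 1
  nt : g.IsNontrivial
  nt1 : g1.IsNontrivial
  cp : g.cv0 < p
  qc : q < g.cv1
  c1 : g1.c = (g.c - p) / (q - p)
  conjL : ∀ y ∈ Icc 0 g1.c, g.gl (p + (q - p) * y) = g.rr^[a] (p + (q - p) * g1.gl y)
  conjR : ∀ y ∈ Icc g1.c 1, g.gr (p + (q - p) * y) = g.ell^[b] (p + (q - p) * g1.gr y)
  glp : q ≤ g.gl p
  grq : g.gr q ≤ p

theorem RenormOf.rd {α : ℝ} (hα : 1 < α) {g g1 : LorenzMap α} {a b : ℕ}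
    (nt : g.IsNontrivial) (h : RenormOf g a b g1) : ∃ p q, RD g g1 a b p q := by
  obtain ⟨p, q, ⟨⟨ha, hb, hp, hpc, hcq, hq, hpq, HL, HR⟩, -⟩, hc1, nt1, JL, JR⟩ := h
  refine ⟨p, q, ?_⟩
  have BL := g.gl_br hα nt
  have BR := g.gr_br hα nt
  have BL1 := g1.gl_br hα nt1
  have BR1 := g1.gr_br hα nt1
  have hC : 0 < q - p := by linarith
  have gL : ∀ x ∈ Ioo p g.c, q ≤ g.gl x := fun x hx => by
    obtain ⟨h1, h2⟩ := (HL x hx).1 1 le_rfl ha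
    rw [Function.iterate_one, LorenzMap.toFun_left hx.2] at h1 h2
    by_contra hcon
    push Not at hcon
    exact h2 ⟨by linarith [h1.1], hcon⟩
  have gR : ∀ x ∈ Ioo g.c q, g.gr x ≤ p := fun x hx => by
    obtain ⟨h1, h2⟩ := (HR x hx).1 1 le_rfl hb
    rw [Function.iterate_one, LorenzMap.toFun_right hx.1.le] at h1 h2
    by_contra hcon
    push Not at hcon
    exact h2 ⟨hcon, by linarith [h1.2]⟩
  have glp : q ≤ g.gl p := by
    have hc : ContinuousWithinAt g.gl (Ioo p g.c) p :=
      (BL.cont p ⟨hp, hpc.le⟩).mono fun x hx => ⟨hp.trans hx.1.le, hx.2.le⟩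
    have : NeBot (𝓝[Ioo p g.c] p) := left_nhdsWithin_Ioo_neBot hpc
    exact ge_of_tendsto hc (eventually_mem_nhdsWithin.mono gL)
  have grq : g.gr q ≤ p := by
    have hc : ContinuousWithinAt g.gr (Ioo g.c q) q :=
      (BR.cont q ⟨hcq.le, hq⟩).mono fun x hx => ⟨hx.1.le, hx.2.le.trans hq⟩
    have : NeBot (𝓝[Ioo g.c q] q) := right_nhdsWithin_Ioo_neBot hcq
    exact le_of_tendsto hc (eventually_mem_nhdsWithin.mono gR)
  have p0 : 0 < p := by
    rcases hp.eq_or_lt with h0 | h0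
    · rw [← h0, BL.hA] at glp; linarith [g.hc.1]
    · exact h0
  have q1 : q < 1 := by
    rcases hq.eq_or_lt with h0 | h0
    · rw [h0, BR.hB] at grq; linarith [g.hc.2]
    · exact h0
  have cp : g.cv0 < p := by
    have := BR.mono (left_mem_Icc.2 g.hc.2.le) ⟨hcq.le, hq⟩ hcq
    rw [BR.hA] at this; linarith
  have qc : q < g.cv1 := by
    have := BL.mono ⟨hp, hpc.le⟩ (right_mem_Icc.2 g.hc.1.le) hpc
    rw [BL.hB] at this; linarith
  have hcc : p + (q - p) * g1.c = g.c := by rw [hc1]; field_simp; ring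
  have hinv : ∀ y, (p + (q - p) * y - p) / (q - p) = y := fun y => by field_simp; ring
  refine ⟨ha, hb, p0, hpc, hcq, q1, nt, nt1, cp, qc, hc1, ?_, ?_, glp, grq⟩
  · have e1 : EqOn (fun y => g.gl (p + (q - p) * y)) (fun y => g.rr^[a] (p + (q - p) * g1.gl y))
        (Ioo 0 g1.c) := by
      intro y hy
      have hx : p + (q - p) * y ∈ Ioo p g.c :=
        ⟨by nlinarith [hy.1], by rw [← hcc]; nlinarith [hy.2]⟩
      have j := JL _ hx
      rw [hinv, LorenzMap.toFun_left hy.2] at j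
      have j2 : p + (q - p) * g1.gl y = g.toFun^[a + 1] (p + (q - p) * y) := by
        rw [j]; field_simp; ring
      show g.gl (p + (q - p) * y) = g.rr^[a] (p + (q - p) * g1.gl y)
      rw [j2, LorenzMap.rr_iter hα nt a _ fun i hi hi' => ((HL _ hx).1 i hi hi').1,
        LorenzMap.toFun_left hx.2]
    apply e1.of_subset_closure
    · apply BL.cont.comp (by fun_prop)
      intro y hy
      exact ⟨by nlinarith [hy.1], by rw [← hcc]; nlinarith [hy.2]⟩
    · apply (iterate_cont BR.inv_cont (LorenzMap.rr_maps hα nt) a).comp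
      · exact continuousOn_const.add (continuousOn_const.mul BL1.cont)
      · intro y hy
        have := BL1.maps hy
        have h2 := g1.cv1_le_one
        exact ⟨by nlinarith [this.1], by nlinarith [this.2]⟩
    · exact Ioo_subset_Icc_self
    · rw [closure_Ioo g1.hc.1.ne]
  · have e1 : EqOn (fun y => g.gr (p + (q - p) * y)) (fun y => g.ell^[b] (p + (q - p) * g1.gr y))
        (Ioo g1.c 1) := by
      intro y hy
      have hx : p + (q - p) * y ∈ Ioo g.c q :=
        ⟨by rw [← hcc]; nlinarith [hy.1], by nlinarith [hy.2]⟩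
      have j := JR _ hx
      rw [hinv, LorenzMap.toFun_right hy.1.le] at j
      have j2 : p + (q - p) * g1.gr y = g.toFun^[b + 1] (p + (q - p) * y) := by
        rw [j]; field_simp; ring
      show g.gr (p + (q - p) * y) = g.ell^[b] (p + (q - p) * g1.gr y)
      rw [j2, LorenzMap.ell_iter hα nt b _ fun i hi hi' => ((HR _ hx).1 i hi hi').1,
        LorenzMap.toFun_right hx.1.le]
    apply e1.of_subset_closure
    · apply BR.cont.comp (by fun_prop)
      intro y hy
      exact ⟨by rw [← hcc]; nlinarith [hy.1], by nlinarith [hy.2]⟩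
    · apply (iterate_cont BL.inv_cont (LorenzMap.ell_maps hα nt) b).comp
      · exact continuousOn_const.add (continuousOn_const.mul BR1.cont)
      · intro y hy
        have := BR1.maps hy
        have h2 := g1.cv0_nonneg
        exact ⟨by nlinarith [this.1], by nlinarith [this.2]⟩
    · exact Ioo_subset_Icc_self
    · rw [closure_Ioo g1.hc.2.ne]

theorem RenormOf.nontriv {α : ℝ} (hα : 1 < α) {g g1 : LorenzMap α} {a b : ℕ}
    (h : RenormOf g a b g1) : g.IsNontrivial := by
  obtain ⟨p, q, ⟨⟨ha, hb, hp, hpc, hcq, hq, hpq, HL, HR⟩, -⟩, -⟩ := h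
  constructor
  · have hx : (g.c + q) / 2 ∈ Ioo g.c q := ⟨by linarith, by linarith⟩
    have h1 := ((HR _ hx).1 1 le_rfl hb).1
    rw [Function.iterate_one, LorenzMap.toFun_right hx.1.le] at h1
    refine lt_of_le_of_lt ?_ h1.2
    have hd : 0 < 1 - g.c := by linarith [g.hc.2]
    have h2 : ((g.c + q) / 2 - g.c) / (1 - g.c) ∈ Icc (0:ℝ) 1 :=
      ⟨div_nonneg (by linarith) hd.le, by rw [div_le_one hd]; linarith⟩
    have h3 : (((g.c + q) / 2 - g.c) / (1 - g.c)) ^ α ∈ Icc (0:ℝ) 1 :=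
      ⟨Real.rpow_nonneg h2.1 _, Real.rpow_le_one h2.1 h2.2 (by linarith)⟩
    have hv := g.hv
    apply g.hψmono.monotoneOn ⟨by linarith [hv.2], by linarith [hv.1]⟩
    · exact ⟨by nlinarith [h3.1, h3.2, hv.1, hv.2], by nlinarith [h3.1, h3.2, hv.1, hv.2]⟩
    · nlinarith [h3.1, h3.2, hv.1, hv.2]
  · have hx : (g.c + p) / 2 ∈ Ioo p g.c := ⟨by linarith, by linarith⟩
    have h1 := ((HL _ hx).1 1 le_rfl ha).1
    rw [Function.iterate_one, LorenzMap.toFun_left hx.2] at h1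
    refine lt_of_lt_of_le h1.1 ?_
    have hd := g.hc.1
    have h2 : (g.c - (g.c + p) / 2) / g.c ∈ Icc (0:ℝ) 1 :=
      ⟨div_nonneg (by linarith) hd.le, by rw [div_le_one hd]; linarith⟩
    have h3 : ((g.c - (g.c + p) / 2) / g.c) ^ α ∈ Icc (0:ℝ) 1 :=
      ⟨Real.rpow_nonneg h2.1 _, Real.rpow_le_one h2.1 h2.2 (by linarith)⟩
    have hv := g.hu
    refine g.hφmono.monotoneOn ?_ hv ?_
    · exact ⟨by nlinarith [h3.1, h3.2, hv.1, hv.2], by nlinarith [h3.1, h3.2, hv.1, hv.2]⟩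
    · nlinarith [h3.1, h3.2, hv.1, hv.2]

namespace RD
variable {α : ℝ} {g g1 : LorenzMap α} {a b : ℕ} {p q : ℝ}

theorem hC (h : RD g g1 a b p q) : 0 < q - p := by linarith [h.pc, h.cq]

theorem hcc (h : RD g g1 a b p q) : p + (q - p) * g1.c = g.c := by
  have := h.hC
  rw [h.c1]; field_simp; ring

theorem gl_p (hα : 1 < α) (h : RD g g1 a b p q) : g.gl p = g.rr^[a] p := by
  have := h.conjL 0 ⟨le_rfl, g1.hc.1.le⟩
  rwa [(g1.gl_br hα h.nt1).hA, mul_zero, add_zero] at this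

theorem gr_q (hα : 1 < α) (h : RD g g1 a b p q) : g.gr q = g.ell^[b] q := by
  have := h.conjR 1 ⟨g1.hc.2.le, le_rfl⟩
  rwa [(g1.gr_br hα h.nt1).hB, mul_one, add_sub_cancel] at this

theorem cv1_eq (hα : 1 < α) (h : RD g g1 a b p q) :
    g.cv1 = g.rr^[a] (p + (q - p) * g1.cv1) := by
  have := h.conjL g1.c ⟨g1.hc.1.le, le_rfl⟩
  rwa [(g1.gl_br hα h.nt1).hB, h.hcc, (g.gl_br hα h.nt).hB] at this

theorem cv0_eq (hα : 1 < α) (h : RD g g1 a b p q) :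
    g.cv0 = g.ell^[b] (p + (q - p) * g1.cv0) := by
  have := h.conjR g1.c ⟨le_rfl, g1.hc.2.le⟩
  rwa [(g1.gr_br hα h.nt1).hA, h.hcc, (g.gr_br hα h.nt).hA] at this

theorem s_mem (h : RD g g1 a b p q) : p + (q - p) * g1.cv1 ∈ Ioc g.c q := by
  have h1 := h.nt1.2
  have h2 := g1.cv1_le_one
  have := h.hC
  exact ⟨by rw [← h.hcc]; nlinarith, by nlinarith⟩

theorem t_mem (h : RD g g1 a b p q) : p + (q - p) * g1.cv0 ∈ Ico p g.c := by
  have h1 := h.nt1.1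
  have h2 := g1.cv0_nonneg
  have := h.hC
  exact ⟨by nlinarith, by rw [← h.hcc]; nlinarith⟩

theorem rr_ge (hα : 1 < α) (nt : g.IsNontrivial) (n : ℕ) {s : ℝ} (hs : s ∈ Icc g.c 1) :
    g.rr^[n] s ∈ Icc g.c 1 := by
  apply iterate_maps (S := Icc g.c 1) _ n hs
  intro x hx
  exact (g.gr_br hα nt).inv_mem ⟨nt.1.le.trans hx.1, hx.2⟩

theorem ell_le (hα : 1 < α) (nt : g.IsNontrivial) (n : ℕ) {s : ℝ} (hs : s ∈ Icc 0 g.c) :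
    g.ell^[n] s ∈ Icc 0 g.c := by
  apply iterate_maps (S := Icc 0 g.c) _ n hs
  intro x hx
  exact (g.gl_br hα nt).inv_mem ⟨hx.1, hx.2.trans nt.2.le⟩

theorem uniq_a (hα : 1 < α) {g1' : LorenzMap α} {a' b' : ℕ} {p' q' : ℝ} (h : RD g g1 a b p q)
    (h' : RD g g1' a' b' p' q') : a' ≤ a := by
  by_contra hcon
  push Not at hcon
  obtain ⟨n, rfl⟩ : ∃ n, a' = a + (n + 1) := ⟨a' - a - 1, by omega⟩
  have e : g.rr^[a] (p + (q - p) * g1.cv1) = g.rr^[a + (n + 1)] (p' + (q' - p') * g1'.cv1) := by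
    rw [← h.cv1_eq hα, ← h'.cv1_eq hα]
  rw [Function.iterate_add_apply] at e
  have hB := g.gr_br hα h.nt
  have hs := h.s_mem
  have hs' := h'.s_mem
  have hI : ∀ {x}, x ∈ Icc g.c 1 → x ∈ Icc g.cv0 1 := fun hx => ⟨h.nt.1.le.trans hx.1, hx.2⟩
  have m1 : p + (q - p) * g1.cv1 ∈ Icc g.c 1 := ⟨hs.1.le, hs.2.trans h.q1.le⟩
  have m2 : p' + (q' - p') * g1'.cv1 ∈ Icc g.c 1 := ⟨hs'.1.le, hs'.2.trans h'.q1.le⟩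
  have e2 := (iterate_mono hB.inv_mono (LorenzMap.rr_maps hα h.nt) a).injOn (hI m1)
    (hI (rr_ge hα h.nt (n + 1) m2)) e
  rw [Function.iterate_succ_apply'] at e2
  have e3 : g.gr (p + (q - p) * g1.cv1) = g.rr^[n] (p' + (q' - p') * g1'.cv1) := by
    rw [e2]; exact hB.k_inv (hI (rr_ge hα h.nt n m2))
  have := (rr_ge hα h.nt n m2).1
  have h4 := hB.mono.monotoneOn m1 ⟨h.cq.le, h.q1.le⟩ hs.2
  linarith [h.grq, h.pc]

theorem uniq_b (hα : 1 < α) {g1' : LorenzMap α} {a' b' : ℕ} {p' q' : ℝ} (h : RD g g1 a b p q)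
    (h' : RD g g1' a' b' p' q') : b' ≤ b := by
  by_contra hcon
  push Not at hcon
  obtain ⟨n, rfl⟩ : ∃ n, b' = b + (n + 1) := ⟨b' - b - 1, by omega⟩
  have e : g.ell^[b] (p + (q - p) * g1.cv0) = g.ell^[b + (n + 1)] (p' + (q' - p') * g1'.cv0) := by
    rw [← h.cv0_eq hα, ← h'.cv0_eq hα]
  rw [Function.iterate_add_apply] at e
  have hB := g.gl_br hα h.nt
  have hs := h.t_mem
  have hs' := h'.t_mem
  have hI : ∀ {x}, x ∈ Icc 0 g.c → x ∈ Icc 0 g.cv1 := fun hx => ⟨hx.1, hx.2.trans h.nt.2.le⟩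
  have m1 : p + (q - p) * g1.cv0 ∈ Icc 0 g.c := ⟨h.p0.le.trans hs.1, hs.2.le⟩
  have m2 : p' + (q' - p') * g1'.cv0 ∈ Icc 0 g.c := ⟨h'.p0.le.trans hs'.1, hs'.2.le⟩
  have e2 := (iterate_mono hB.inv_mono (LorenzMap.ell_maps hα h.nt) b).injOn (hI m1)
    (hI (ell_le hα h.nt (n + 1) m2)) e
  rw [Function.iterate_succ_apply'] at e2
  have e3 : g.gl (p + (q - p) * g1.cv0) = g.ell^[n] (p' + (q' - p') * g1'.cv0) := by
    rw [e2]; exact hB.k_inv (hI (ell_le hα h.nt n m2))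
  have := (ell_le hα h.nt n m2).2
  have h4 := hB.mono.monotoneOn ⟨h.p0.le, h.pc.le⟩ m1 hs.1
  linarith [h.glp, h.cq]
end RD

theorem exists_chain {α : ℝ} (hα : 1 < α) {f : LorenzMap α} {ω : ℕ → ℕ × ℕ}
    (h : InfRenormType α f ω) :
    ∃ G : ℕ → LorenzMap α, ∃ p q : ℕ → ℝ, G 0 = f ∧
      ∀ n, RD (G n) (G (n + 1)) (ω n).1 (ω n).2 (p n) (q n) := by
  have key : ∀ n, ∃ pq : ℝ × ℝ, RD ((renormOp α)^[n] f) ((renormOp α)^[n + 1] f) (ω n).1 (ω n).2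
      pq.1 pq.2 := by
    intro n
    obtain ⟨g1, hg1⟩ := h n
    set g := (renormOp α)^[n] f with hg
    have hex : ∃ g' : LorenzMap α, ∃ a b : ℕ, RenormOf g a b g' := ⟨g1, _, _, hg1⟩
    have hop : (renormOp α)^[n + 1] f = hex.choose := by
      rw [Function.iterate_succ_apply', ← hg, renormOp, dif_pos hex]
    obtain ⟨a, b, hab⟩ := hex.choose_spec
    rw [hop]
    have nt := hg1.nontriv hα
    obtain ⟨p, q, h1⟩ := hg1.rd hα nt
    obtain ⟨p', q', h2⟩ := hab.rd hα nt
    have ea : a = (ω n).1 := le_antisymm (h1.uniq_a hα h2) (h2.uniq_a hα h1)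
    have eb : b = (ω n).2 := le_antisymm (h1.uniq_b hα h2) (h2.uniq_b hα h1)
    exact ⟨(p', q'), by rw [← ea, ← eb]; exact h2⟩
  choose pq hpq using key
  exact ⟨fun n => (renormOp α)^[n] f, fun n => (pq n).1, fun n => (pq n).2, rfl, hpq⟩

theorem PS.distort {k : ℝ → ℝ} {A B l r D : ℝ} (h : PS k (Ioo A B)) (hl : A < l) (hr : r < B)
    (hlr : l < r) (h1 : ((r - A) / (l - A)) ^ 2 ≤ D) (h2 : ((B - l) / (B - r)) ^ 2 ≤ D)
    {x y x' y' : ℝ} (hx : l ≤ x) (hxy : x < y) (hy : y ≤ r) (hx' : l ≤ x') (hxy' : x' < y')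
    (hy' : y' ≤ r) : (k y - k x) * (y' - x') ≤ D * ((k y' - k x') * (y - x)) := by
  have hmvt : ∀ {x y : ℝ}, l ≤ x → x < y → y ≤ r → ∃ ξ ∈ Ioo x y, k y - k x = deriv k ξ * (y - x) := by
    intro x y hx hxy hy
    obtain ⟨ξ, hξ, e⟩ := exists_hasDerivAt_eq_slope k (deriv k) hxy
      (fun z hz => (h.hasDeriv ⟨by linarith [hz.1], by linarith [hz.2]⟩).continuousAt.continuousWithinAt)
      (fun z hz => h.hasDeriv ⟨by linarith [hz.1], by linarith [hz.2]⟩)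
    refine ⟨ξ, hξ, ?_⟩
    have : y - x ≠ 0 := by linarith
    rw [e]; field_simp
  obtain ⟨ξ, hξ, e1⟩ := hmvt hx hxy hy
  obtain ⟨η, hη, e2⟩ := hmvt hx' hxy' hy'
  have mη : η ∈ Ioo A B := ⟨by linarith [hη.1], by linarith [hη.2]⟩
  have mξ : ξ ∈ Ioo A B := ⟨by linarith [hξ.1], by linarith [hξ.2]⟩
  have pη := h.deriv_pos mη
  have hD1 : 1 ≤ D := by
    refine le_trans ?_ h1
    have : 1 ≤ (r - A) / (l - A) := by rw [le_div_iff₀ (by linarith)]; linarith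
    nlinarith
  have key : deriv k ξ ≤ D * deriv k η := by
    rcases lt_trichotomy ξ η with hlt | heq | hgt
    · refine ((h.koebe mξ.1 hlt mη.2).1).trans ?_
      gcongr
      refine le_trans ?_ h1
      have p0 : 0 < ξ - A := by linarith [mξ.1]
      have p1 : 0 < l - A := by linarith
      gcongr
      · exact div_nonneg (by linarith) (by linarith)
      · linarith
      · linarith [hη.2]
      · linarith [hξ.1]
    · rw [heq]; nlinarith
    · refine ((h.koebe mη.1 hgt mξ.2).2).trans ?_
      gcongr
      refine le_trans ?_ h2
      have p0 : 0 < B - ξ := by linarith [mξ.2]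
      have p1 : 0 < B - r := by linarith
      gcongr
      · exact div_nonneg (by linarith) (by linarith)
      · linarith
      · linarith [hη.1]
      · linarith [hξ.2]
  rw [e1, e2]
  have : 0 ≤ (y - x) * (y' - x') := mul_nonneg (by linarith) (by linarith)
  nlinarith

theorem PS.of_inverse {k m D1 D2 D3 : ℝ → ℝ} {U V : Set ℝ} (hV : IsOpen V)
    (hm : ∀ y ∈ V, m y ∈ U) (hkm : ∀ y ∈ V, k (m y) = y) (hc : ContinuousOn m V)
    (h1 : ∀ x ∈ U, HasDerivAt k (D1 x) x) (h2 : ∀ x ∈ U, HasDerivAt D1 (D2 x) x)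
    (h3 : ∀ x ∈ U, HasDerivAt D2 (D3 x) x) (hp : ∀ x ∈ U, 0 < D1 x)
    (hS : ∀ x ∈ U, D3 x / D1 x - (3 / 2) * (D2 x / D1 x) ^ 2 < 0) : PS m V := by
  refine ⟨fun y => √(D1 (m y)), fun y => D2 (m y) / (2 * (√(D1 (m y))) ^ 3),
    fun y => (D3 (m y) * (D1 (m y))⁻¹ * (2 * (√(D1 (m y))) ^ 3) - D2 (m y) *
      (2 * (3 * √(D1 (m y)) ^ 2 * (D2 (m y) / (2 * (√(D1 (m y))) ^ 3))))) /
        (2 * (√(D1 (m y))) ^ 3) ^ 2, fun y hy => ?_⟩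
  have hx := hm y hy
  have pos := hp _ hx
  have hder : HasDerivAt m (D1 (m y))⁻¹ y := by
    apply HasDerivAt.of_local_left_inverse (hc.continuousAt (hV.mem_nhds hy)) (h1 _ hx) pos.ne'
    filter_upwards [hV.mem_nhds hy] with z hz using hkm z hz
  have sq := Real.sq_sqrt pos.le
  have spos := Real.sqrt_pos.2 pos
  set T := √(D1 (m y)) with hT
  have hW : HasDerivAt (fun y => √(D1 (m y))) (D2 (m y) / (2 * T ^ 3)) y := by
    have := ((Real.hasDerivAt_sqrt pos.ne').comp y ((h2 _ hx).comp y hder))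
    refine this.congr_deriv ?_
    rw [← hT, ← sq]; field_simp
  refine ⟨spos, ?_, hW, ?_, ?_⟩
  · show HasDerivAt m (1 / T ^ 2) y
    rw [sq]; simpa using hder
  · have hN := (h3 _ hx).comp y hder
    have hD := ((hW.pow 3).const_mul 2)
    refine (hN.div hD (by show 2 * √(D1 (m y)) ^ 3 ≠ 0; positivity)).congr_deriv ?_
    simp only [Function.comp_apply, Pi.pow_apply, Nat.cast_ofNat, Nat.add_one_sub_one]
    rfl
  · apply div_nonpos_of_nonpos_of_nonneg _ (by positivity)
    have hs := hS _ hx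
    simp only [← hT]
    rw [← sq] at hs
    have e : D3 (m y) * (D1 (m y))⁻¹ * (2 * T ^ 3) - D2 (m y) *
      (2 * (3 * T ^ 2 * (D2 (m y) / (2 * T ^ 3)))) =
      2 * T ^ 3 * (D3 (m y) / T ^ 2 - (3 / 2) * (D2 (m y) / T ^ 2) ^ 2) := by
      rw [← sq]; field_simp
    rw [e]
    have : 0 < 2 * T ^ 3 := by positivity
    nlinarith

def Lev {α : ℝ} (E τ : ℝ) (g : LorenzMap α) : Prop :=
  PS g.ell (Ioo 0 g.cv1) ∧ PS g.rr (Ioo g.cv0 1) ∧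
  (∃ P, PS P (Ioo (-τ) (1 + τ)) ∧ ∀ x y x' y', 0 ≤ x → x < y → y ≤ g.c → 0 ≤ x' → x' < y' →
    y' ≤ g.c → (P (g.gl y) - P (g.gl x)) * ((g.c - x') ^ α - (g.c - y') ^ α) ≤
      E * ((P (g.gl y') - P (g.gl x')) * ((g.c - x) ^ α - (g.c - y) ^ α))) ∧
  (∃ P, PS P (Ioo (-τ) (1 + τ)) ∧ ∀ x y x' y', g.c ≤ x → x < y → y ≤ 1 → g.c ≤ x' → x' < y' →
    y' ≤ 1 → (P (g.gr y) - P (g.gr x)) * ((y' - g.c) ^ α - (x' - g.c) ^ α) ≤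
      E * ((P (g.gr y') - P (g.gr x')) * ((y - g.c) ^ α - (x - g.c) ^ α)))

def Geo {α : ℝ} (K : ℝ) (g : LorenzMap α) : Prop :=
  (∀ x y x' y', 0 ≤ x → x < y → y ≤ g.c → 0 ≤ x' → x' < y' →
    y' ≤ g.c → (g.gl y - g.gl x) * ((g.c - x') ^ α - (g.c - y') ^ α) ≤
      K * ((g.gl y' - g.gl x') * ((g.c - x) ^ α - (g.c - y) ^ α))) ∧
  (∀ x y x' y', g.c ≤ x → x < y → y ≤ 1 → g.c ≤ x' → x' < y' →
    y' ≤ 1 → (g.gr y - g.gr x) * ((y' - g.c) ^ α - (x' - g.c) ^ α) ≤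
      K * ((g.gr y' - g.gr x') * ((y - g.c) ^ α - (x - g.c) ^ α)))

theorem distort_combine {A A' w w' m m' E D : ℝ} (hA' : 0 < A') (hw' : 0 ≤ w') (hm' : 0 ≤ m')
    (hD : 0 ≤ D) (h1 : A * m' ≤ E * (A' * m)) (h2 : A' * w ≤ D * (A * w')) :
    w * m' ≤ E * D * (w' * m) := by
  have h3 : A' * w * m' ≤ D * (A * w') * m' := mlR h2 hm'
  have h4 : D * w' * (A * m') ≤ D * w' * (E * (A' * m)) := mlL h1 (by positivity)
  have : A' * (w * m') ≤ A' * (E * D * (w' * m)) := by nlinarith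
  exact lML this hA'

theorem Lev.geo {α : ℝ} (hα : 1 < α) {E τ : ℝ} (hτ : 0 < τ) {g : LorenzMap α}
    (nt : g.IsNontrivial) (h : Lev E τ g) : Geo (E * ((1 + τ) / τ) ^ 2) g := by
  obtain ⟨-, -, ⟨P, hP, H⟩, ⟨P', hP', H'⟩⟩ := h
  have e1 : ((1 - -τ) / (0 - -τ)) ^ 2 ≤ ((1 + τ) / τ) ^ 2 := by
    rw [show (1:ℝ) - -τ = 1 + τ by ring, show (0:ℝ) - -τ = τ by ring]
  have e2 : ((1 + τ - 0) / (1 + τ - 1)) ^ 2 ≤ ((1 + τ) / τ) ^ 2 := by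
    rw [show (1:ℝ) + τ - 0 = 1 + τ by ring, show (1:ℝ) + τ - 1 = τ by ring]
  have hsub : ∀ z ∈ Icc (0:ℝ) 1, z ∈ Ioo (-τ) (1 + τ) := fun z hz =>
    ⟨by linarith [hz.1], by linarith [hz.2]⟩
  have c1 := g.cv1_le_one
  have c0 := g.cv0_nonneg
  constructor
  · intro x y x' y' hx hxy hy hx' hxy' hy'
    have B := g.gl_br hα nt
    have mx : x ∈ Icc 0 g.c := ⟨hx, by linarith⟩
    have my : y ∈ Icc 0 g.c := ⟨by linarith, hy⟩
    have mx' : x' ∈ Icc 0 g.c := ⟨hx', by linarith⟩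
    have my' : y' ∈ Icc 0 g.c := ⟨by linarith, hy'⟩
    have l1 := B.mono mx my hxy
    have l2 := B.mono mx' my' hxy'
    have I : ∀ {z}, z ∈ Icc 0 g.c → g.gl z ∈ Icc (0:ℝ) 1 := fun hz =>
      ⟨(B.maps hz).1, (B.maps hz).2.trans c1⟩
    apply distort_combine _ (by linarith) _ (by positivity) (H x y x' y' hx hxy hy hx' hxy' hy')
    · exact hP.distort (by linarith) (by linarith) one_pos e1 e2 (I mx').1 l2 (I my').2
        (I mx).1 l1 (I my).2
    · exact sub_pos.2 (hP.strictMonoOn (hsub _ (I mx')) (hsub _ (I my')) l2)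
    · exact sub_nonneg.2 (rlr (by linarith) (by linarith) (by linarith))
  · intro x y x' y' hx hxy hy hx' hxy' hy'
    have B := g.gr_br hα nt
    have mx : x ∈ Icc g.c 1 := ⟨hx, by linarith⟩
    have my : y ∈ Icc g.c 1 := ⟨by linarith, hy⟩
    have mx' : x' ∈ Icc g.c 1 := ⟨hx', by linarith⟩
    have my' : y' ∈ Icc g.c 1 := ⟨by linarith, hy'⟩
    have l1 := B.mono mx my hxy
    have l2 := B.mono mx' my' hxy'
    have I : ∀ {z}, z ∈ Icc g.c 1 → g.gr z ∈ Icc (0:ℝ) 1 := fun hz =>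
      ⟨c0.trans (B.maps hz).1, (B.maps hz).2⟩
    apply distort_combine _ (by linarith) _ (by positivity) (H' x y x' y' hx hxy hy hx' hxy' hy')
    · exact hP'.distort (by linarith) (by linarith) one_pos e1 e2 (I mx').1 l2 (I my').2
        (I mx).1 l1 (I my).2
    · exact sub_pos.2 (hP'.strictMonoOn (hsub _ (I mx')) (hsub _ (I my')) l2)
    · exact sub_nonneg.2 (rlr (by linarith) (by linarith) (by linarith))

theorem Lev.step {α : ℝ} (hα : 1 < α) {E τ : ℝ} (hτ : 0 < τ) {g g1 : LorenzMap α} {a b : ℕ}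
    {p q : ℝ} (R : RD g g1 a b p q) (h : Lev E τ g)
    (s1 : τ * (q - p) ≤ p - g.cv0) (s2 : τ * (q - p) ≤ 1 - q) (s3 : τ * (q - p) ≤ p)
    (s4 : τ * (q - p) ≤ g.cv1 - q) : Lev E τ g1 := by
  obtain ⟨hl, hr, ⟨P, hP, H⟩, ⟨P', hP', H'⟩⟩ := h
  have hC := R.hC
  have BL := g.gl_br hα R.nt
  have BR := g.gr_br hα R.nt
  have BL1 := g1.gl_br hα R.nt1
  have BR1 := g1.gr_br hα R.nt1
  have c1 := g.cv1_le_one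
  have c0 := g.cv0_nonneg
  have hrm : ∀ x ∈ Ioo g.cv0 1, g.rr x ∈ Ioo g.cv0 1 := fun x hx =>
    ⟨R.nt.1.trans (BR.inv_Ioo hx).1, (BR.inv_Ioo hx).2⟩
  have hlm : ∀ x ∈ Ioo 0 g.cv1, g.ell x ∈ Ioo 0 g.cv1 := fun x hx =>
    ⟨(BL.inv_Ioo hx).1, (BL.inv_Ioo hx).2.trans R.nt.2⟩
  have hra := hr.iter hrm a
  have hlb := hl.iter hlm b
  have haff : ∀ I, PS (fun y => p + (q - p) * y) I := fun I => by
    have := PS.affine hC p I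
    simpa [add_comm] using this
  have haff2 : ∀ I, PS (fun y => (q - p)⁻¹ * y + -(q - p)⁻¹ * p) I := fun I =>
    PS.affine (inv_pos.2 hC) _ I
  have cc := R.hcc
  have s_m := R.s_mem
  have t_m := R.t_mem
  have bigR : ∀ y ∈ Ioo (-τ) (1 + τ), p + (q - p) * y ∈ Ioo g.cv0 1 := fun y hy =>
    ⟨by nlinarith [hy.1], by nlinarith [hy.2]⟩
  have bigL : ∀ y ∈ Ioo (-τ) (1 + τ), p + (q - p) * y ∈ Ioo 0 g.cv1 := fun y hy =>
    ⟨by nlinarith [hy.1], by nlinarith [hy.2]⟩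
  have itR : ∀ y ∈ Ioo g.cv0 1, g.rr^[a] y ∈ Ioo g.cv0 1 := fun y hy => iterate_maps hrm a hy
  have itL : ∀ y ∈ Ioo 0 g.cv1, g.ell^[b] y ∈ Ioo 0 g.cv1 := fun y hy => iterate_maps hlm b hy
  have sub1 : ∀ {y}, y ∈ Ioo (0:ℝ) 1 → y ∈ Ioo (-τ) (1 + τ) := fun hy =>
    ⟨by linarith [hy.1], by linarith [hy.2]⟩
  refine ⟨?_, ?_, ⟨P ∘ g.rr^[a] ∘ fun y => p + (q - p) * y, ?_, ?_⟩,
    ⟨P' ∘ g.ell^[b] ∘ fun y => p + (q - p) * y, ?_, ?_⟩⟩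
  · have m1 : ∀ y ∈ Ioo 0 g1.cv1, p + (q - p) * y ∈ Ioo g.cv0 1 := fun y hy =>
      bigR y (sub1 ⟨hy.1, hy.2.trans_le g1.cv1_le_one⟩)
    have m2 : ∀ y ∈ Ioo 0 g1.cv1, g.rr^[a] (p + (q - p) * y) ∈ Ioo 0 g.cv1 := fun y hy => by
      refine ⟨lt_of_le_of_lt c0 (itR _ (m1 y hy)).1, ?_⟩
      rw [R.cv1_eq hα]
      apply iterate_mono BR.inv_mono (LorenzMap.rr_maps hα R.nt) a
        (Ioo_subset_Icc_self (m1 y hy)) ⟨by linarith [s_m.1, R.nt.1], by linarith [s_m.2, R.q1]⟩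
      nlinarith [hy.2]
    apply PS.congr isOpen_Ioo (((haff2 univ).comp hl (fun _ _ => mem_univ _)).comp
      (hra.comp (haff _) m1) m2)
    intro y hy
    have m3 := BL1.inv_mem (Ioo_subset_Icc_self hy)
    have hcj := R.conjL _ m3
    rw [BL1.k_inv (Ioo_subset_Icc_self hy)] at hcj
    simp only [Function.comp_apply]
    rw [← hcj, LorenzMap.ell, LorenzMap.ell,
      BL.inv_k ⟨by nlinarith [m3.1, R.p0], by rw [← cc]; nlinarith [m3.2]⟩]
    field_simp; ring
  · have m1 : ∀ y ∈ Ioo g1.cv0 1, p + (q - p) * y ∈ Ioo 0 g.cv1 := fun y hy =>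
      bigL y (sub1 ⟨lt_of_le_of_lt g1.cv0_nonneg hy.1, hy.2⟩)
    have m2 : ∀ y ∈ Ioo g1.cv0 1, g.ell^[b] (p + (q - p) * y) ∈ Ioo g.cv0 1 := fun y hy => by
      refine ⟨?_, lt_of_lt_of_le (itL _ (m1 y hy)).2 c1⟩
      rw [R.cv0_eq hα]
      apply iterate_mono BL.inv_mono (LorenzMap.ell_maps hα R.nt) b
        ⟨by linarith [t_m.1, R.p0], by linarith [t_m.2, R.nt.2]⟩ (Ioo_subset_Icc_self (m1 y hy))
      nlinarith [hy.1]
    apply PS.congr isOpen_Ioo (((haff2 univ).comp hr (fun _ _ => mem_univ _)).comp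
      (hlb.comp (haff _) m1) m2)
    intro y hy
    have m3 := BR1.inv_mem (Ioo_subset_Icc_self hy)
    have hcj := R.conjR _ m3
    rw [BR1.k_inv (Ioo_subset_Icc_self hy)] at hcj
    simp only [Function.comp_apply]
    rw [← hcj, LorenzMap.rr, LorenzMap.rr,
      BR.inv_k ⟨by rw [← cc]; nlinarith [m3.1], by nlinarith [m3.2, R.q1]⟩]
    field_simp; ring
  · apply hP.comp (hra.comp (haff _) bigR)
    intro y hy
    have := itR _ (bigR y hy)
    exact sub1 ⟨lt_of_le_of_lt c0 this.1, this.2⟩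
  · intro x y x' y' hx hxy hy hx' hxy' hy'
    have aux : ∀ z, 0 ≤ z → z ≤ g1.c → P (g.rr^[a] (p + (q - p) * g1.gl z)) =
        P (g.gl (p + (q - p) * z)) := fun z hz hz' => by rw [R.conjL z ⟨hz, hz'⟩]
    have sc : ∀ z, z ≤ g1.c → (g.c - (p + (q - p) * z)) ^ α = (q - p) ^ α * (g1.c - z) ^ α :=
      fun z hz => by rw [← Real.mul_rpow hC.le (by linarith), ← cc]; congr 1; ring
    have := H (p + (q - p) * x) (p + (q - p) * y) (p + (q - p) * x') (p + (q - p) * y')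
      (by nlinarith [R.p0]) (by nlinarith) (by rw [← cc]; nlinarith)
      (by nlinarith [R.p0]) (by nlinarith) (by rw [← cc]; nlinarith)
    rw [sc x (by linarith), sc y (by linarith), sc x' (by linarith), sc y' (by linarith)] at this
    simp only [Function.comp_apply]
    rw [aux x hx (by linarith), aux y (by linarith) hy, aux x' hx' (by linarith),
      aux y' (by linarith) hy']
    have hpos : 0 < (q - p) ^ α := rpp hC _
    refine lML ?_ hpos
    linarith
  · apply hP'.comp (hlb.comp (haff _) bigL)
    intro y hy
    have := itL _ (bigL y hy)
    exact sub1 ⟨this.1, lt_of_lt_of_le this.2 c1⟩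
  · intro x y x' y' hx hxy hy hx' hxy' hy'
    have aux : ∀ z, g1.c ≤ z → z ≤ 1 → P' (g.ell^[b] (p + (q - p) * g1.gr z)) =
        P' (g.gr (p + (q - p) * z)) := fun z hz hz' => by rw [R.conjR z ⟨hz, hz'⟩]
    have sc : ∀ z, g1.c ≤ z → (p + (q - p) * z - g.c) ^ α = (q - p) ^ α * (z - g1.c) ^ α :=
      fun z hz => by rw [← Real.mul_rpow hC.le (by linarith), ← cc]; congr 1; ring
    have := H' (p + (q - p) * x) (p + (q - p) * y) (p + (q - p) * x') (p + (q - p) * y')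
      (by rw [← cc]; nlinarith) (by nlinarith) (by nlinarith [R.q1])
      (by rw [← cc]; nlinarith) (by nlinarith) (by nlinarith [R.q1])
    rw [sc x (by linarith), sc y (by linarith), sc x' (by linarith), sc y' (by linarith)] at this
    simp only [Function.comp_apply]
    rw [aux x hx (by linarith), aux y (by linarith) hy, aux x' hx' (by linarith),
      aux y' (by linarith) hy']
    have hpos : 0 < (q - p) ^ α := rpp hC _
    refine lML ?_ hpos
    linarith

theorem deriv_ratio_le {φ : ℝ → ℝ} (h : IsOPDiffeo 1 φ) {δ : ℝ} (hd : distortion φ ≤ δ)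
    {x y : ℝ} (hx : x ∈ Icc (0:ℝ) 1) (hy : y ∈ Icc (0:ℝ) 1) :
    derivWithin φ (Icc 0 1) x ≤ Real.exp δ * derivWithin φ (Icc 0 1) y := by
  obtain ⟨hc, -, -, -, hpos⟩ := h
  have hcont : ContinuousOn (derivWithin φ (Icc 0 1)) (Icc 0 1) :=
    hc.continuousOn_derivWithin (uniqueDiffOn_Icc one_pos) (by simp)
  have hlc : ContinuousOn (fun x => Real.log (derivWithin φ (Icc 0 1) x)) (Icc 0 1) :=
    hcont.log fun x hx => (hpos x hx).ne'
  obtain ⟨M, hM⟩ := (isCompact_Icc.exists_bound_of_continuousOn hlc)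
  have hb : ∀ x y : Icc (0:ℝ) 1, Real.log (derivWithin φ (Icc 0 1) x.1 / derivWithin φ (Icc 0 1) y.1)
      ≤ 2 * M := fun x y => by
    rw [Real.log_div (hpos _ x.2).ne' (hpos _ y.2).ne']
    have h1 := abs_le.1 (hM _ x.2)
    have h2 := abs_le.1 (hM _ y.2)
    linarith [h1.2, h2.1]
  have : Nonempty (Icc (0:ℝ) 1) := ⟨⟨x, hx⟩⟩
  have h1 : Real.log (derivWithin φ (Icc 0 1) x / derivWithin φ (Icc 0 1) y) ≤ δ := by
    refine le_trans ?_ hd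
    refine le_trans (le_ciSup (f := fun y : Icc (0:ℝ) 1 =>
      Real.log (derivWithin φ (Icc 0 1) x / derivWithin φ (Icc 0 1) y.1)) ?_ ⟨y, hy⟩) ?_
    · exact ⟨2 * M, by rintro _ ⟨z, rfl⟩; exact hb ⟨x, hx⟩ z⟩
    · refine le_ciSup (f := fun x : Icc (0:ℝ) 1 => ⨆ y : Icc (0:ℝ) 1,
        Real.log (derivWithin φ (Icc 0 1) x.1 / derivWithin φ (Icc 0 1) y.1)) ?_ ⟨x, hx⟩
      exact ⟨2 * M, by rintro _ ⟨z, rfl⟩; exact ciSup_le fun w => hb z w⟩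
  have py := hpos y hy
  have := Real.le_exp_log (derivWithin φ (Icc 0 1) x / derivWithin φ (Icc 0 1) y)
  have h2 := this.trans (Real.exp_le_exp.2 h1)
  rwa [div_le_iff₀ py] at h2

theorem diffeo_hasDeriv {φ : ℝ → ℝ} (h : IsOPDiffeo 1 φ) {x : ℝ} (hx : x ∈ Ioo (0:ℝ) 1) :
    HasDerivAt φ (derivWithin φ (Icc 0 1) x) x := by
  have h1 : DifferentiableWithinAt ℝ φ (Icc 0 1) x :=
    (h.1.differentiableOn (by simp)) x (Ioo_subset_Icc_self hx)
  exact h1.hasDerivWithinAt.hasDerivAt (Icc_mem_nhds hx.1 hx.2)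

theorem diffeo_distort {φ : ℝ → ℝ} (h : IsOPDiffeo 1 φ) {δ : ℝ} (hd : distortion φ ≤ δ)
    {x y x' y' : ℝ} (hx : 0 ≤ x) (hxy : x < y) (hy : y ≤ 1) (hx' : 0 ≤ x') (hxy' : x' < y')
    (hy' : y' ≤ 1) : (φ y - φ x) * (y' - x') ≤ Real.exp δ * ((φ y' - φ x') * (y - x)) := by
  have hmvt : ∀ {x y : ℝ}, 0 ≤ x → x < y → y ≤ 1 → ∃ ξ ∈ Ioo x y,
      φ y - φ x = derivWithin φ (Icc 0 1) ξ * (y - x) := by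
    intro x y hx hxy hy
    obtain ⟨ξ, hξ, e⟩ := exists_hasDerivAt_eq_slope φ (derivWithin φ (Icc 0 1)) hxy
      (h.1.continuousOn.mono (Icc_subset_Icc hx hy))
      (fun z hz => diffeo_hasDeriv h ⟨by linarith [hz.1], by linarith [hz.2]⟩)
    refine ⟨ξ, hξ, ?_⟩
    have : y - x ≠ 0 := by linarith
    rw [e]; field_simp
  obtain ⟨ξ, hξ, e1⟩ := hmvt hx hxy hy
  obtain ⟨η, hη, e2⟩ := hmvt hx' hxy' hy'
  have key := deriv_ratio_le h hd (x := ξ) (y := η) ⟨by linarith [hξ.1], by linarith [hξ.2]⟩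
    ⟨by linarith [hη.1], by linarith [hη.2]⟩
  rw [e1, e2]
  have : 0 ≤ (y - x) * (y' - x') := mul_nonneg (by linarith) (by linarith)
  nlinarith

theorem IsOPDiffeo.one {φ : ℝ → ℝ} (h : IsOPDiffeo 3 φ) : IsOPDiffeo 1 φ :=
  ⟨h.1.of_le (by norm_num), h.2⟩

theorem contDiff_chain {F : ℝ → ℝ} {U : Set ℝ} (hU : IsOpen U) (h : ContDiffOn ℝ 3 F U) :
    (∀ x ∈ U, HasDerivAt F (deriv F x) x) ∧
    (∀ x ∈ U, HasDerivAt (deriv F) (deriv (deriv F) x) x) ∧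
    (∀ x ∈ U, HasDerivAt (deriv (deriv F)) (deriv (deriv (deriv F)) x) x) := by
  have h1 : ContDiffOn ℝ 2 (deriv F) U := h.deriv_of_isOpen hU (by norm_num)
  have h2 : ContDiffOn ℝ 1 (deriv (deriv F)) U := h1.deriv_of_isOpen hU (by norm_num)
  refine ⟨fun x hx => ?_, fun x hx => ?_, fun x hx => ?_⟩
  · exact ((h.differentiableOn (by norm_num)).differentiableAt (hU.mem_nhds hx)).hasDerivAt
  · exact ((h1.differentiableOn (by norm_num)).differentiableAt (hU.mem_nhds hx)).hasDerivAt
  · exact ((h2.differentiableOn (by norm_num)).differentiableAt (hU.mem_nhds hx)).hasDerivAt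

theorem branch_smooth {φ Q F : ℝ → ℝ} {U : Set ℝ} (hU : IsOpen U) (h : IsOPDiffeo 3 φ)
    (hF : ∀ x ∈ U, F x = φ (Q x)) (hQ : ∀ x ∈ U, Q x ∈ Ioo (0:ℝ) 1) (hQc : ContDiffOn ℝ 3 Q U)
    (hQd : ∀ x ∈ U, 0 < deriv Q x) : ContDiffOn ℝ 3 F U ∧ ∀ x ∈ U, 0 < deriv F x := by
  constructor
  · refine ContDiffOn.congr (f := φ ∘ Q) ?_ hF
    exact (h.1.mono Ioo_subset_Icc_self).comp hQc hQ
  · intro x hx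
    have e : F =ᶠ[𝓝 x] φ ∘ Q := by filter_upwards [hU.mem_nhds hx] with y hy using hF y hy
    rw [e.deriv_eq]
    have d1 := diffeo_hasDeriv h.one (hQ x hx)
    have d2 : HasDerivAt Q (deriv Q x) x :=
      ((hQc.differentiableOn (by norm_num)).differentiableAt (hU.mem_nhds hx)).hasDerivAt
    rw [(d1.comp x d2).deriv]
    exact mul_pos (h.2.2.2.2 _ (Ioo_subset_Icc_self (hQ x hx))) (hQd x hx)

theorem Lev.base {α : ℝ} (hα : 1 < α) {δ τ : ℝ} (hτ : 0 < τ) {f : LorenzMap α}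
    (nt : f.IsNontrivial) (h3 : f.IsCk 3) (hS : f.NegSchwarzian) (d1 : distortion f.φ ≤ δ)
    (d2 : distortion f.ψ ≤ δ) : Lev (Real.exp δ) τ f := by
  have BL := f.gl_br hα nt
  have BR := f.gr_br hα nt
  have QL := f.QL_br hα nt.u_pos
  have QR := f.QR_br hα nt.v_pos
  have hc0 := f.hc.1
  have hc1 : 0 < 1 - f.c := by linarith [f.hc.2]
  refine ⟨?_, ?_, ⟨fun x => x, PS.id _, ?_⟩, ⟨fun x => x, PS.id _, ?_⟩⟩
  · have hder : ∀ x ∈ Ioo 0 f.c, HasDerivAt (fun x => f.u * (1 - ((f.c - x) / f.c) ^ α))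
        (f.u * (1 / f.c * α * ((f.c - x) / f.c) ^ (α - 1))) x := fun x hx => by
      have h0 : HasDerivAt (fun x => (f.c - x) / f.c) (-1 / f.c) x :=
        ((hasDerivAt_id x).const_sub f.c).div_const f.c
      have h1 := h0.rpow_const (p := α) (Or.inr hα.le)
      refine ((h1.const_sub 1).const_mul f.u).congr_deriv ?_
      ring
    obtain ⟨s1, s2⟩ := branch_smooth (F := f.toFun) (U := Ioo 0 f.c) isOpen_Ioo h3.1
      (Q := fun x => f.u * (1 - ((f.c - x) / f.c) ^ α))
      (fun x hx => LorenzMap.toFun_left hx.2)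
      (fun x hx => ⟨(QL.maps_Ioo hx).1, (QL.maps_Ioo hx).2.trans_le f.hu.2⟩)
      (by
        apply contDiffOn_const.mul (contDiffOn_const.sub _)
        apply ContDiffOn.rpow_const_of_ne (by fun_prop)
        intro x hx
        exact (div_pos (by linarith [hx.2]) hc0).ne')
      (fun x hx => by
        rw [(hder x hx).deriv]
        have : 0 < (f.c - x) / f.c := div_pos (by linarith [hx.2]) hc0
        have := nt.u_pos
        positivity)
    obtain ⟨t1, t2, t3⟩ := contDiff_chain isOpen_Ioo s1
    apply PS.of_inverse (U := Ioo 0 f.c) isOpen_Ioo (fun y hy => BL.inv_Ioo hy) _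
      (BL.inv_cont.mono Ioo_subset_Icc_self) t1 t2 t3 s2
    · intro x hx
      exact hS x ⟨⟨hx.1.le, by linarith [hx.2]⟩, by simpa using hx.2.ne⟩
    · intro y hy
      have := BL.inv_Ioo hy
      rw [LorenzMap.toFun_left (by exact this.2)]
      exact BL.k_inv (Ioo_subset_Icc_self hy)
  · have hder : ∀ x ∈ Ioo f.c 1, HasDerivAt (fun x => 1 + f.v * (-1 + ((x - f.c) / (1 - f.c)) ^ α))
        (f.v * (1 / (1 - f.c) * α * ((x - f.c) / (1 - f.c)) ^ (α - 1))) x := fun x hx => by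
      have h0 : HasDerivAt (fun x => (x - f.c) / (1 - f.c)) (1 / (1 - f.c)) x :=
        ((hasDerivAt_id x).sub_const f.c).div_const (1 - f.c)
      have h1 := h0.rpow_const (p := α) (Or.inr hα.le)
      exact ((h1.const_add (-1)).const_mul f.v).const_add 1
    obtain ⟨s1, s2⟩ := branch_smooth (F := f.toFun) (U := Ioo f.c 1) isOpen_Ioo h3.2
      (Q := fun x => 1 + f.v * (-1 + ((x - f.c) / (1 - f.c)) ^ α))
      (fun x hx => LorenzMap.toFun_right hx.1.le)
      (fun x hx => ⟨by linarith [(QR.maps_Ioo hx).1, f.hv.2], (QR.maps_Ioo hx).2⟩)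
      (by
        apply contDiffOn_const.add (contDiffOn_const.mul (contDiffOn_const.add _))
        apply ContDiffOn.rpow_const_of_ne (by fun_prop)
        intro x hx
        exact (div_pos (by linarith [hx.1]) hc1).ne')
      (fun x hx => by
        rw [(hder x hx).deriv]
        have : 0 < (x - f.c) / (1 - f.c) := div_pos (by linarith [hx.1]) hc1
        have := nt.v_pos
        positivity)
    obtain ⟨t1, t2, t3⟩ := contDiff_chain isOpen_Ioo s1
    apply PS.of_inverse (U := Ioo f.c 1) isOpen_Ioo (fun y hy => BR.inv_Ioo hy) _
      (BR.inv_cont.mono Ioo_subset_Icc_self) t1 t2 t3 s2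
    · intro x hx
      exact hS x ⟨⟨by linarith [hx.1], hx.2.le⟩, by simpa using hx.1.ne'⟩
    · intro y hy
      have := BR.inv_Ioo hy
      rw [LorenzMap.toFun_right (by exact this.1.le)]
      exact BR.k_inv (Ioo_subset_Icc_self hy)
  · intro x y x' y' hx hxy hy hx' hxy' hy'
    have mx : x ∈ Icc 0 f.c := ⟨hx, by linarith⟩
    have my : y ∈ Icc 0 f.c := ⟨by linarith, hy⟩
    have mx' : x' ∈ Icc 0 f.c := ⟨hx', by linarith⟩
    have my' : y' ∈ Icc 0 f.c := ⟨by linarith, hy'⟩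
    have := diffeo_distort h3.1.one d1 (QL.maps mx).1 (QL.mono mx my hxy)
      ((QL.maps my).2.trans f.hu.2) (QL.maps mx').1 (QL.mono mx' my' hxy')
      ((QL.maps my').2.trans f.hu.2)
    have e : ∀ z, z ≤ f.c → ((f.c - z) / f.c) ^ α = (f.c - z) ^ α / f.c ^ α := fun z hz =>
      Real.div_rpow (by linarith) hc0.le _
    have hp : 0 < f.u / f.c ^ α := div_pos nt.u_pos (rpp hc0 _)
    have e2 : ∀ {z w}, z ≤ f.c → w ≤ f.c → f.u * (1 - ((f.c - z) / f.c) ^ α) -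
      f.u * (1 - ((f.c - w) / f.c) ^ α) = f.u / f.c ^ α * ((f.c - w) ^ α - (f.c - z) ^ α) :=
      fun hz hw => by rw [e _ hz, e _ hw]; ring
    rw [e2 my'.2 mx'.2, e2 my.2 mx.2] at this
    refine lML ?_ hp
    simp only [LorenzMap.gl]
    linarith
  · intro x y x' y' hx hxy hy hx' hxy' hy'
    have mx : x ∈ Icc f.c 1 := ⟨hx, by linarith⟩
    have my : y ∈ Icc f.c 1 := ⟨by linarith, hy⟩
    have mx' : x' ∈ Icc f.c 1 := ⟨hx', by linarith⟩
    have my' : y' ∈ Icc f.c 1 := ⟨by linarith, hy'⟩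
    have hv : 0 ≤ 1 - f.v := by linarith [f.hv.2]
    have := diffeo_distort h3.2.one d2 (hv.trans (QR.maps mx).1) (QR.mono mx my hxy)
      (QR.maps my).2 (hv.trans (QR.maps mx').1) (QR.mono mx' my' hxy') (QR.maps my').2
    have e : ∀ z, f.c ≤ z → ((z - f.c) / (1 - f.c)) ^ α = (z - f.c) ^ α / (1 - f.c) ^ α := fun z hz =>
      Real.div_rpow (by linarith) hc1.le _
    have hp : 0 < f.v / (1 - f.c) ^ α := div_pos nt.v_pos (rpp hc1 _)
    have e2 : ∀ {z w}, f.c ≤ z → f.c ≤ w → (1 + f.v * (-1 + ((z - f.c) / (1 - f.c)) ^ α)) -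
      (1 + f.v * (-1 + ((w - f.c) / (1 - f.c)) ^ α)) =
        f.v / (1 - f.c) ^ α * ((z - f.c) ^ α - (w - f.c) ^ α) :=
      fun hz hw => by rw [e _ hz, e _ hw]; ring
    rw [e2 my'.1 mx'.1, e2 my.1 mx.1] at this
    refine lML ?_ hp
    simp only [LorenzMap.gr]
    linarith

theorem rpow_sub_bounds {α x y : ℝ} (hα : 1 < α) (hy : 0 ≤ y) (hyx : y ≤ x) :
    α * y ^ (α - 1) * (x - y) ≤ x ^ α - y ^ α ∧ x ^ α - y ^ α ≤ α * x ^ (α - 1) * (x - y) := by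
  rcases hyx.eq_or_lt with rfl | hlt
  · simp
  have hx : 0 < x := hy.trans_lt hlt
  have e : ∀ {z : ℝ}, 0 ≤ z → z ^ α = z * z ^ (α - 1) := fun {z} hz => by
    rcases hz.eq_or_lt with rfl | h0
    · rw [Real.zero_rpow (by linarith)]; simp
    · rw [← Real.rpow_one_add' hz (by linarith)]; congr 1; ring
  constructor
  · rcases hy.eq_or_lt with rfl | hy0
    · rw [Real.zero_rpow (by linarith : α - 1 ≠ 0), Real.zero_rpow (by linarith)]
      have := Real.rpow_nonneg hx.le α; nlinarith
    have h := one_add_mul_self_le_rpow_one_add (s := (x - y) / y) (by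
      rw [le_div_iff₀ hy0]; nlinarith) hα.le
    have h1 : 1 + (x - y) / y = x / y := by field_simp; ring
    rw [h1, Real.div_rpow hx.le hy, le_div_iff₀ (rpp hy0 _)] at h
    have : (1 + α * ((x - y) / y)) * y ^ α = y ^ α + α * y ^ (α - 1) * (x - y) := by
      rw [e hy]; field_simp
    linarith
  · have h := one_add_mul_self_le_rpow_one_add (s := (y - x) / x) (by
      rw [le_div_iff₀ hx]; nlinarith) hα.le
    have h1 : 1 + (y - x) / x = y / x := by field_simp; ring
    rw [h1, Real.div_rpow hy hx.le, le_div_iff₀ (rpp hx _)] at h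
    have : (1 + α * ((y - x) / x)) * x ^ α = x ^ α + α * x ^ (α - 1) * (y - x) := by
      rw [e hx.le]; field_simp
    linarith

namespace LorenzMap
variable {α : ℝ} (g : LorenzMap α)
def Z (x : ℝ) : ℝ := 1 - x / g.c
def T (x : ℝ) : ℝ := (x - g.c) / (1 - g.c)
variable {g}
theorem Z_c : g.Z g.c = 0 := by simp [Z, g.hc.1.ne']
theorem Z_zero : g.Z 0 = 1 := by simp [Z]
theorem T_c : g.T g.c = 0 := by simp [T]
theorem T_one : g.T 1 = 1 := by
  have : 1 - g.c ≠ 0 := by linarith [g.hc.2]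
  simp [T, this]
theorem cZ (x : ℝ) : g.c * g.Z x = g.c - x := by
  have := g.hc.1
  simp only [Z]; field_simp
theorem eT (x : ℝ) : (1 - g.c) * g.T x = x - g.c := by
  have : 1 - g.c ≠ 0 := by linarith [g.hc.2]
  simp only [T]; field_simp
theorem Z_nonneg {x : ℝ} (hx : x ≤ g.c) : 0 ≤ g.Z x := by
  have := g.hc.1
  have := cZ (g := g) x
  by_contra h; push Not at h; nlinarith
theorem Z_pos {x : ℝ} (hx : x < g.c) : 0 < g.Z x := by
  have := g.hc.1
  have := cZ (g := g) x
  by_contra h; push Not at h; nlinarith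
theorem Z_le_one {x : ℝ} (hx : 0 ≤ x) : g.Z x ≤ 1 := by
  have := div_nonneg hx g.hc.1.le
  simp only [Z]; linarith
theorem Z_anti {x y : ℝ} (h : x ≤ y) : g.Z y ≤ g.Z x := by
  have := div_le_div_of_nonneg_right h g.hc.1.le
  simp only [Z]; linarith
theorem T_nonneg {x : ℝ} (hx : g.c ≤ x) : 0 ≤ g.T x :=
  div_nonneg (by linarith) (by linarith [g.hc.2])
theorem T_le_one {x : ℝ} (hx : x ≤ 1) : g.T x ≤ 1 := by
  rw [T, div_le_one (by linarith [g.hc.2])]; linarith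
theorem T_mono {x y : ℝ} (h : x ≤ y) : g.T x ≤ g.T y :=
  div_le_div_of_nonneg_right (by linarith) (by linarith [g.hc.2])
end LorenzMap

section geo
variable {α : ℝ} {g : LorenzMap α} {K : ℝ}
open LorenzMap

theorem Geo.left (hα : 1 < α) (nt : g.IsNontrivial) (H : Geo K g) {x y : ℝ} (hx : 0 ≤ x)
    (hxy : x ≤ y) (hy : y ≤ g.c) :
    g.gl y - g.gl x ≤ K * (g.cv1 * (g.Z x ^ α - g.Z y ^ α)) ∧
    g.cv1 * (g.Z x ^ α - g.Z y ^ α) ≤ K * (g.gl y - g.gl x) := by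
  rcases hxy.eq_or_lt with rfl | hlt
  · simp
  have hc := g.hc.1
  have B := g.gl_br hα nt
  have hcp : 0 < g.c ^ α := rpp hc _
  have e : ∀ z, z ≤ g.c → (g.c - z) ^ α = g.c ^ α * g.Z z ^ α := fun z hz => by
    rw [← cZ, Real.mul_rpow hc.le (Z_nonneg hz)]
  have h1 := H.1 x y 0 g.c hx hlt hy le_rfl hc le_rfl
  have h2 := H.1 0 g.c x y le_rfl hc le_rfl hx hlt hy
  rw [e x (by linarith), e y hy, B.hA, B.hB, e 0 hc.le, e g.c le_rfl, Z_c, Z_zero,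
    Real.zero_rpow (by linarith), Real.one_rpow] at h1 h2
  constructor
  · refine lML ?_ hcp
    nlinarith
  · refine lML ?_ hcp
    nlinarith

theorem Geo.right (hα : 1 < α) (nt : g.IsNontrivial) (H : Geo K g) {x y : ℝ} (hx : g.c ≤ x)
    (hxy : x ≤ y) (hy : y ≤ 1) :
    g.gr y - g.gr x ≤ K * ((1 - g.cv0) * (g.T y ^ α - g.T x ^ α)) ∧
    (1 - g.cv0) * (g.T y ^ α - g.T x ^ α) ≤ K * (g.gr y - g.gr x) := by
  rcases hxy.eq_or_lt with rfl | hlt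
  · simp
  have hc : 0 < 1 - g.c := by linarith [g.hc.2]
  have B := g.gr_br hα nt
  have hcp : 0 < (1 - g.c) ^ α := rpp hc _
  have e : ∀ z, g.c ≤ z → (z - g.c) ^ α = (1 - g.c) ^ α * g.T z ^ α := fun z hz => by
    rw [← eT, Real.mul_rpow hc.le (T_nonneg hz)]
  have h1 := H.2 x y g.c 1 hx hlt hy le_rfl g.hc.2 le_rfl
  have h2 := H.2 g.c 1 x y le_rfl g.hc.2 le_rfl hx hlt hy
  rw [e x (by linarith), e y (by linarith), B.hA, B.hB, e 1 g.hc.2.le, e g.c le_rfl, T_c, T_one,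
    Real.zero_rpow (by linarith), Real.one_rpow] at h1 h2
  constructor
  · refine lML ?_ hcp
    nlinarith
  · refine lML ?_ hcp
    nlinarith

theorem LorenzMap.ell_mem (hα : 1 < α) (nt : g.IsNontrivial) {w : ℝ} (hw : 0 ≤ w)
    (hw' : w ≤ g.cv1) : 0 ≤ g.ell w ∧ g.ell w ≤ g.c ∧ g.gl (g.ell w) = w :=
  have B := g.gl_br hα nt
  ⟨(B.inv_mem ⟨hw, hw'⟩).1, (B.inv_mem ⟨hw, hw'⟩).2, B.k_inv ⟨hw, hw'⟩⟩

theorem LorenzMap.rr_mem (hα : 1 < α) (nt : g.IsNontrivial) {w : ℝ} (hw : g.cv0 ≤ w)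
    (hw' : w ≤ 1) : g.c ≤ g.rr w ∧ g.rr w ≤ 1 ∧ g.gr (g.rr w) = w :=
  have B := g.gr_br hα nt
  ⟨(B.inv_mem ⟨hw, hw'⟩).1, (B.inv_mem ⟨hw, hw'⟩).2, B.k_inv ⟨hw, hw'⟩⟩

theorem Geo.ellZ (hα : 1 < α) (nt : g.IsNontrivial) (H : Geo K g) {w : ℝ} (hw : 0 ≤ w)
    (hw' : w ≤ g.cv1) : g.cv1 - w ≤ K * (g.cv1 * g.Z (g.ell w) ^ α) ∧
      g.cv1 * g.Z (g.ell w) ^ α ≤ K * (g.cv1 - w) := by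
  obtain ⟨h1, h2, h3⟩ := g.ell_mem hα nt hw hw'
  have := H.left hα nt h1 h2 le_rfl
  rw [h3, (g.gl_br hα nt).hB, Z_c, Real.zero_rpow (by linarith), sub_zero] at this
  exact this

theorem S1 (hα : 1 < α) {g1 : LorenzMap α} {a b : ℕ} {p q : ℝ} (R : RD g g1 a b p q)
    (H : Geo K g) (K1 : 1 ≤ K) (K2 : K ≤ 2) (hc : 1 / 2 ≤ g.c) {m : ℝ} (m0 : 0 < m) (m1 : m < 1)
    (hm : 4 * m ^ ((α - 1) / 2) ≤ 1) {bb : ℕ} (hb1 : 1 ≤ bb) (hb : bb ≤ b)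
    (hn0 : 2 ≤ ((1 + α) / 2) ^ (bb - 1))
    (hn : 4 * 2 ^ α * m ^ (((1 + α) / 2) ^ (bb - 1) - 2) < α ^ (-3 * (bb : ℝ)))
    (he : α ^ (-3 * (bb : ℝ)) * g.Z g.cv0 ≤ (1 - g.c) ^ α) : m ≤ g.Z g.cv0 := by
  by_contra hcon
  push Not at hcon
  have nt := R.nt
  have z0 : 0 < g.Z g.cv0 := Z_pos nt.1
  have c1 := g.cv1_le_one
  have c0 := g.cv0_nonneg
  have hα' : 0 < (1 + α) / 2 := by linarith
  have hα'1 : 1 < (1 + α) / 2 := by linarith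
  obtain ⟨tp, tc⟩ := R.t_mem
  set t := p + (q - p) * g1.cv0
  have t0 : 0 ≤ t := R.p0.le.trans tp
  set x : ℕ → ℝ := fun j => g.ell^[b - j] t with hx
  have xm : ∀ j, 0 ≤ x j ∧ x j ≤ g.c := fun j => RD.ell_le hα nt (b - j) ⟨t0, tc.le⟩
  have x0 : x 0 = g.cv0 := (R.cv0_eq hα).symm
  have xs : ∀ j, j < b → g.gl (x j) = x (j + 1) := by
    intro j hj
    have h1 : b - j = (b - (j + 1)) + 1 := by omega
    have h2 := xm (j + 1)
    simp only [hx]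
    rw [h1, Function.iterate_succ', Function.comp_apply]
    exact (g.ell_mem hα nt h2.1 (h2.2.trans nt.2.le)).2.2
  have zz : ∀ j, j < b → g.cv1 - x (j + 1) ≤ 2 * g.Z (x j) ^ α := by
    intro j hj
    have h := (H.left hα nt (xm j).1 (xm j).2 le_rfl).1
    rw [xs j hj, (g.gl_br hα nt).hB, Z_c, Real.zero_rpow (by linarith), sub_zero] at h
    have h0 : 0 ≤ g.Z (x j) ^ α := Real.rpow_nonneg (Z_nonneg (xm j).2) _
    have hcv : 0 < g.cv1 := by linarith [nt.2]
    have : g.cv1 * g.Z (x j) ^ α ≤ 1 * g.Z (x j) ^ α := mlR c1 h0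
    nlinarith
  have ind : ∀ j, j < b → g.Z (x j) ≤ g.Z g.cv0 ^ (((1 + α) / 2) ^ j) := by
    intro j
    induction j with
    | zero => intro _; rw [x0]; simp
    | succ j ih =>
      intro hj
      have h1 := ih (by omega)
      have h2 := zz j (by omega)
      have hz := Z_nonneg (xm j).2
      have h3 := cZ (g := g) (x (j + 1))
      have h4 : g.Z (x (j + 1)) ≤ 4 * g.Z (x j) ^ α := by
        have := Z_nonneg (xm (j+1)).2
        nlinarith [nt.2]
      have h5 : g.Z (x j) ≤ m := h1.trans (by
        calc g.Z g.cv0 ^ (((1 + α) / 2) ^ j) ≤ g.Z g.cv0 ^ (1:ℝ) :=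
              Real.rpow_le_rpow_of_exponent_ge z0 (hcon.le.trans m1.le) (one_le_pow₀ hα'1.le)
          _ ≤ m := by rw [Real.rpow_one]; exact hcon.le)
      have h6 : 4 * g.Z (x j) ^ ((α - 1) / 2) ≤ 1 :=
        le_trans (by have := rlr hz h5 (by linarith : 0 ≤ (α - 1) / 2); linarith) hm
      have h7 : g.Z (x j) ^ α = g.Z (x j) ^ ((α - 1) / 2) * g.Z (x j) ^ ((1 + α) / 2) := by
        rw [← Real.rpow_add' hz (by linarith)]; congr 1; ring
      have h8 : 0 ≤ g.Z (x j) ^ ((1 + α) / 2) := Real.rpow_nonneg hz _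
      calc g.Z (x (j + 1)) ≤ 4 * g.Z (x j) ^ α := h4
        _ ≤ g.Z (x j) ^ ((1 + α) / 2) := by rw [h7]; nlinarith
        _ ≤ (g.Z g.cv0 ^ (((1 + α) / 2) ^ j)) ^ ((1 + α) / 2) :=
            rlr hz h1 hα'.le
        _ = g.Z g.cv0 ^ (((1 + α) / 2) ^ (j + 1)) := by
            rw [← Real.rpow_mul z0.le, pow_succ]
  have hbb : b - 1 < b := by have := R.hb; omega
  have hz := ind (b - 1) hbb
  have h2 := zz (b - 1) hbb
  rw [show b - 1 + 1 = b from by omega] at h2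
  have xb : x b < g.c := by simp only [hx, Nat.sub_self]; exact tc
  have hζ : g.cv1 - g.c ≤ 2 * g.Z (x (b - 1)) ^ α := by linarith
  obtain ⟨sc, sq⟩ := R.s_mem
  have hs1 := R.cv1_eq hα
  set s := p + (q - p) * g1.cv1
  have hgr : g.c ≤ g.gr g.cv1 := by
    obtain ⟨n, rfl⟩ : ∃ n, a = n + 1 := ⟨a - 1, by have := R.ha; omega⟩
    have h3 := RD.rr_ge hα nt n (s := s) ⟨sc.le, sq.trans R.q1.le⟩
    rw [hs1, Function.iterate_succ', Function.comp_apply,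
      (g.rr_mem hα nt (nt.1.le.trans h3.1) h3.2).2.2]
    exact h3.1
  have h4 := (H.right hα nt le_rfl nt.2.le c1).1
  rw [(g.gr_br hα nt).hA, T_c, Real.zero_rpow (by linarith), sub_zero] at h4
  have hε : 0 < 1 - g.c := by linarith [g.hc.2]
  have hT : g.T g.cv1 ^ α * (1 - g.c) ^ α = (g.cv1 - g.c) ^ α := by
    rw [← Real.mul_rpow (T_nonneg nt.2.le) hε.le, mul_comm, eT]
  have hεα : 0 < (1 - g.c) ^ α := rpp hε _
  have hzb := Z_nonneg (xm (b - 1)).2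
  have hzb1 : g.Z (x (b - 1)) ≤ 1 := Z_le_one (xm (b - 1)).1
  have h5 : (g.cv1 - g.c) ^ α ≤ 2 ^ α * g.Z (x (b - 1)) := by
    calc (g.cv1 - g.c) ^ α ≤ (2 * g.Z (x (b - 1)) ^ α) ^ α :=
          rlr (by linarith [nt.2]) hζ (by linarith)
      _ ≤ (2 * g.Z (x (b - 1))) ^ α := by
          apply rlr (by positivity) _ (by linarith)
          have := Real.rpow_le_rpow_of_exponent_ge' hzb hzb1 (by linarith : (0:ℝ) ≤ 1) hα.le
          rw [Real.rpow_one] at this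
          linarith
      _ = 2 ^ α * g.Z (x (b - 1)) ^ α := Real.mul_rpow (by norm_num) hzb
      _ ≤ 2 ^ α * g.Z (x (b - 1)) := by
          have := Real.rpow_le_rpow_of_exponent_ge' hzb hzb1 (by linarith : (0:ℝ) ≤ 1) hα.le
          rw [Real.rpow_one] at this
          gcongr
  have hTn : 0 ≤ g.T g.cv1 ^ α := Real.rpow_nonneg (T_nonneg nt.2.le) _
  have h6 : g.Z g.cv0 * (1 - g.c) ^ α ≤ 4 * (2 ^ α * g.Z (x (b - 1))) := by
    have h7 : g.Z g.cv0 ≤ 4 * g.T g.cv1 ^ α := by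
      have := cZ (g := g) g.cv0
      have h8 : (1 - g.cv0) * g.T g.cv1 ^ α ≤ 1 * g.T g.cv1 ^ α :=
        mlR (by linarith) hTn
      have h9 : 0 ≤ (1 - g.cv0) * g.T g.cv1 ^ α := mul_nonneg (by linarith [nt.1, g.hc.2]) hTn
      nlinarith
    nlinarith
  have h7 : g.Z g.cv0 ^ (2:ℝ) * α ^ (-3 * (bb:ℝ)) ≤
      4 * 2 ^ α * g.Z g.cv0 ^ (((1 + α) / 2) ^ (bb - 1)) := by
    have h8 : g.Z (x (b - 1)) ≤ g.Z g.cv0 ^ (((1 + α) / 2) ^ (bb - 1)) := hz.trans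
      (Real.rpow_le_rpow_of_exponent_ge z0 (hcon.le.trans m1.le)
        (pow_le_pow_right₀ hα'1.le (by omega)))
    have h9 : (0:ℝ) < 2 ^ α := by positivity
    rw [Real.rpow_two]
    have i1 := mlL he z0.le
    have i2 := mlL h8 h9.le
    calc g.Z g.cv0 ^ 2 * α ^ (-3 * (bb:ℝ)) = g.Z g.cv0 * (α ^ (-3 * (bb:ℝ)) * g.Z g.cv0) := by ring
      _ ≤ 4 * (2 ^ α * g.Z (x (b - 1))) := i1.trans h6
      _ ≤ 4 * (2 ^ α * g.Z g.cv0 ^ (((1 + α) / 2) ^ (bb - 1))) := by linarith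
      _ = _ := by ring
  have h8 : g.Z g.cv0 ^ (((1 + α) / 2) ^ (bb - 1)) =
      g.Z g.cv0 ^ (2:ℝ) * g.Z g.cv0 ^ (((1 + α) / 2) ^ (bb - 1) - 2) := by
    rw [← Real.rpow_add z0]; congr 1; ring
  have h9 : g.Z g.cv0 ^ (((1 + α) / 2) ^ (bb - 1) - 2) ≤ m ^ (((1 + α) / 2) ^ (bb - 1) - 2) :=
    rlr z0.le hcon.le (by linarith)
  have h10 : 0 < g.Z g.cv0 ^ (2:ℝ) := rpp z0 _
  rw [h8] at h7
  have h11 : (0:ℝ) < 2 ^ α := by positivity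
  have h12 : α ^ (-3 * (bb:ℝ)) ≤ 4 * 2 ^ α * g.Z g.cv0 ^ (((1 + α) / 2) ^ (bb - 1) - 2) := by
    refine lML ?_ h10
    linarith
  have h13 := mlL h9 (by positivity : 0 ≤ 4 * (2:ℝ) ^ α)
  linarith
end geo

section rrsec
variable {α : ℝ} {g : LorenzMap α} {K m : ℝ}
open LorenzMap

theorem cv0_gap (hm : m ≤ g.Z g.cv0) : m ≤ 1 - g.cv0 := by
  have h1 := cZ (g := g) g.cv0
  have h2 : g.Z g.cv0 ≤ 1 := Z_le_one g.cv0_nonneg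
  nlinarith [g.hc.2]

theorem Geo.rr_top (hα : 1 < α) (nt : g.IsNontrivial) (H : Geo K g) (K2 : K ≤ 2)
    (m0 : 0 < m) (hm : m ≤ g.Z g.cv0) {w : ℝ} (hw : g.cv0 ≤ w) (hw1 : w ≤ 1) :
    1 - g.rr w ≤ 2 * (1 - g.c) / m * (1 - w) := by
  obtain ⟨h1, h2, h3⟩ := g.rr_mem hα nt hw hw1
  have h := (H.right hα nt h1 h2 le_rfl).2
  rw [h3, (g.gr_br hα nt).hB, T_one, Real.one_rpow] at h
  have hT0 := T_nonneg h1
  have hT : g.T (g.rr w) ^ α ≤ g.T (g.rr w) := by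
    have := Real.rpow_le_rpow_of_exponent_ge' hT0 (T_le_one h2) (by linarith : (0:ℝ) ≤ 1) hα.le
    rwa [Real.rpow_one] at this
  have hT1 := T_le_one (g := g) h2
  have e := eT (g := g) (g.rr w)
  have h4 := cv0_gap hm
  have hε : 0 < 1 - g.c := by linarith [g.hc.2]
  have h5 : m * (1 - g.T (g.rr w)) ≤ 2 * (1 - w) := by nlinarith
  rw [div_mul_eq_mul_div, le_div_iff₀ m0]
  have : 1 - g.rr w = (1 - g.c) * (1 - g.T (g.rr w)) := by linarith
  rw [this]; nlinarith

theorem Geo.rr_lower (hα : 1 < α) (nt : g.IsNontrivial) (H : Geo K g) (K1 : 1 ≤ K) (K2 : K ≤ 2)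
    {w w' : ℝ} (hw : g.cv0 ≤ w) (hww : w ≤ w') (hw1 : w' ≤ 1) :
    (1 - g.c) / (2 * α) * (w' - w) ≤ g.rr w' - g.rr w := by
  obtain ⟨h1, h2, h3⟩ := g.rr_mem hα nt hw (hww.trans hw1)
  obtain ⟨h1', h2', h3'⟩ := g.rr_mem hα nt (hw.trans hww) hw1
  have hle : g.rr w ≤ g.rr w' := (g.gr_br hα nt).inv_mono.monotoneOn ⟨hw, hww.trans hw1⟩
    ⟨hw.trans hww, hw1⟩ hww
  have h := (H.right hα nt h1 hle h2').1
  rw [h3, h3'] at h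
  have h4 := (rpow_sub_bounds hα (T_nonneg h1) (T_mono hle)).2
  have h5 : g.T (g.rr w') ^ (α - 1) ≤ 1 :=
    Real.rpow_le_one (T_nonneg h1') (T_le_one h2') (by linarith)
  have e := eT (g := g) (g.rr w)
  have e' := eT (g := g) (g.rr w')
  have hT := T_mono (g := g) hle
  have hε : 0 < 1 - g.c := by linarith [g.hc.2]
  have h6 : g.T (g.rr w') ^ α - g.T (g.rr w) ^ α ≤ α * (g.T (g.rr w') - g.T (g.rr w)) := by
    refine h4.trans ?_
    have : α * g.T (g.rr w') ^ (α - 1) ≤ α * 1 := mlL h5 (by linarith)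
    nlinarith
  have h7 : 0 ≤ g.T (g.rr w') ^ α - g.T (g.rr w) ^ α := by
    have := rlr (T_nonneg h1) hT (by linarith : 0 ≤ α)
    linarith
  have h8 : w' - w ≤ 2 * (α * (g.T (g.rr w') - g.T (g.rr w))) := by
    have i1 : (1 - g.cv0) * (g.T (g.rr w') ^ α - g.T (g.rr w) ^ α) ≤
      1 * (g.T (g.rr w') ^ α - g.T (g.rr w) ^ α) :=
      mlR (by linarith [g.cv0_nonneg]) h7
    have i2 : 0 ≤ (1 - g.cv0) * (g.T (g.rr w') ^ α - g.T (g.rr w) ^ α) :=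
      mul_nonneg (by linarith [nt.1]) h7
    nlinarith
  rw [div_mul_eq_mul_div, div_le_iff₀ (by linarith)]
  have : g.rr w' - g.rr w = (1 - g.c) * (g.T (g.rr w') - g.T (g.rr w)) := by linarith
  rw [this]; nlinarith

theorem Geo.rr_upper (hα : 1 < α) (nt : g.IsNontrivial) (H : Geo K g) (K1 : 1 ≤ K) (K2 : K ≤ 2)
    (m0 : 0 < m) (hm : m ≤ g.Z g.cv0)
    {w w' : ℝ} (hw : m / 4 ≤ w - g.cv0) (hww : w ≤ w') (hw1 : w' ≤ 1) :
    g.rr w' - g.rr w ≤ 16 / m ^ 2 * (1 - g.c) * (w' - w) := by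
  have hw0 : g.cv0 ≤ w := by linarith
  obtain ⟨h1, h2, h3⟩ := g.rr_mem hα nt hw0 (hww.trans hw1)
  obtain ⟨h1', h2', h3'⟩ := g.rr_mem hα nt (hw0.trans hww) hw1
  have hle : g.rr w ≤ g.rr w' := (g.gr_br hα nt).inv_mono.monotoneOn ⟨hw0, hww.trans hw1⟩
    ⟨hw0.trans hww, hw1⟩ hww
  have hε : 0 < 1 - g.c := by linarith [g.hc.2]
  have hT0 := T_nonneg h1
  have hT1 := T_le_one (g := g) h2
  have hT := T_mono (g := g) hle
  have hb := (H.right hα nt le_rfl h1 h2).1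
  rw [h3, (g.gr_br hα nt).hA, T_c, Real.zero_rpow (by linarith), sub_zero] at hb
  have hTn : 0 ≤ g.T (g.rr w) ^ α := Real.rpow_nonneg hT0 _
  have hTα : m / 8 ≤ g.T (g.rr w) ^ α := by
    have i1 : (1 - g.cv0) * g.T (g.rr w) ^ α ≤ 1 * g.T (g.rr w) ^ α :=
      mlR (by linarith [g.cv0_nonneg]) hTn
    have i2 : 0 ≤ (1 - g.cv0) * g.T (g.rr w) ^ α := mul_nonneg (by linarith [nt.1]) hTn
    nlinarith
  have hTα1 : m / 8 ≤ g.T (g.rr w) ^ (α - 1) := hTα.trans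
    (Real.rpow_le_rpow_of_exponent_ge' hT0 hT1 (by linarith) (by linarith))
  have h := (H.right hα nt h1 hle h2').2
  rw [h3, h3'] at h
  have h4 := (rpow_sub_bounds hα hT0 hT).1
  have h6 : m / 8 * (g.T (g.rr w') - g.T (g.rr w)) ≤ g.T (g.rr w') ^ α - g.T (g.rr w) ^ α := by
    refine le_trans ?_ h4
    apply mlR _ (by linarith)
    nlinarith
  have h7 := cv0_gap hm
  have h8 : m * (m / 8 * (g.T (g.rr w') - g.T (g.rr w))) ≤ 2 * (w' - w) := by
    have i0 : 0 ≤ m / 8 * (g.T (g.rr w') - g.T (g.rr w)) := mul_nonneg (by linarith) (by linarith)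
    have i1 := mul_le_mul h7 h6 i0 (by linarith)
    have i2 : K * (w' - w) ≤ 2 * (w' - w) := mlR K2 (by linarith)
    linarith
  have e := eT (g := g) (g.rr w)
  have e' := eT (g := g) (g.rr w')
  have : g.rr w' - g.rr w = (1 - g.c) * (g.T (g.rr w') - g.T (g.rr w)) := by linarith
  rw [this, div_mul_eq_mul_div, div_mul_eq_mul_div, le_div_iff₀ (by positivity)]
  nlinarith

theorem Geo.rr_top_iter (hα : 1 < α) (nt : g.IsNontrivial) (H : Geo K g) (K2 : K ≤ 2)
    (m0 : 0 < m) (hm : m ≤ g.Z g.cv0) (n : ℕ) {w : ℝ} (hw : g.cv0 ≤ w) (hw1 : w ≤ 1) :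
    1 - g.rr^[n] w ≤ (2 * (1 - g.c) / m) ^ n * (1 - w) := by
  have hε : 0 < 1 - g.c := by linarith [g.hc.2]
  induction n with
  | zero => simp
  | succ n ih =>
    have hmem := iterate_maps (S := Icc g.cv0 1) (g.rr_maps hα nt) n ⟨hw, hw1⟩
    rw [Function.iterate_succ', Function.comp_apply]
    have h1 := H.rr_top hα nt K2 m0 hm hmem.1 hmem.2
    have h2 : 0 ≤ 2 * (1 - g.c) / m := by positivity
    calc _ ≤ _ := h1
      _ ≤ 2 * (1 - g.c) / m * ((2 * (1 - g.c) / m) ^ n * (1 - w)) :=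
        mlL ih h2
      _ = _ := by ring

theorem Geo.rr_lower_iter (hα : 1 < α) (nt : g.IsNontrivial) (H : Geo K g) (K1 : 1 ≤ K) (K2 : K ≤ 2)
    (n : ℕ) {w w' : ℝ} (hw : g.cv0 ≤ w) (hww : w ≤ w') (hw1 : w' ≤ 1) :
    ((1 - g.c) / (2 * α)) ^ n * (w' - w) ≤ g.rr^[n] w' - g.rr^[n] w := by
  have hε : 0 < 1 - g.c := by linarith [g.hc.2]
  induction n with
  | zero => simp
  | succ n ih =>
    have hmem := iterate_maps (S := Icc g.cv0 1) (g.rr_maps hα nt) n ⟨hw, hww.trans hw1⟩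
    have hmem' := iterate_maps (S := Icc g.cv0 1) (g.rr_maps hα nt) n ⟨hw.trans hww, hw1⟩
    have hle := (iterate_mono (S := Icc g.cv0 1) (g.gr_br hα nt).inv_mono
      (g.rr_maps hα nt) n).monotoneOn ⟨hw, hww.trans hw1⟩ ⟨hw.trans hww, hw1⟩ hww
    rw [Function.iterate_succ', Function.comp_apply, Function.comp_apply]
    have h1 := H.rr_lower hα nt K1 K2 hmem.1 hle hmem'.2
    have h2 : 0 ≤ (1 - g.c) / (2 * α) := by positivity
    calc _ = (1 - g.c) / (2 * α) * (((1 - g.c) / (2 * α)) ^ n * (w' - w)) := by ring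
      _ ≤ _ := (mlL ih h2).trans h1

theorem Geo.rr_upper_iter (hα : 1 < α) (nt : g.IsNontrivial) (H : Geo K g) (K1 : 1 ≤ K) (K2 : K ≤ 2)
    (m0 : 0 < m) (hm : m ≤ g.Z g.cv0) (hm' : m / 4 ≤ g.c - g.cv0) (n : ℕ)
    {w w' : ℝ} (hw : m / 4 ≤ w - g.cv0) (hww : w ≤ w') (hw1 : w' ≤ 1) :
    g.rr^[n] w' - g.rr^[n] w ≤ (16 / m ^ 2 * (1 - g.c)) ^ n * (w' - w) := by
  have hε : 0 < 1 - g.c := by linarith [g.hc.2]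
  have hw0 : g.cv0 ≤ w := by linarith
  induction n with
  | zero => simp
  | succ n ih =>
    have hmem := iterate_maps (S := Icc g.cv0 1) (g.rr_maps hα nt) n ⟨hw0, hww.trans hw1⟩
    have hmem' := iterate_maps (S := Icc g.cv0 1) (g.rr_maps hα nt) n ⟨hw0.trans hww, hw1⟩
    have hle := (iterate_mono (S := Icc g.cv0 1) (g.gr_br hα nt).inv_mono
      (g.rr_maps hα nt) n).monotoneOn ⟨hw0, hww.trans hw1⟩ ⟨hw0.trans hww, hw1⟩ hww
    rw [Function.iterate_succ', Function.comp_apply, Function.comp_apply]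
    have h0 : m / 4 ≤ g.rr^[n] w - g.cv0 := by
      rcases n with _ | n
      · exact hw
      · have := iterate_maps (S := Icc g.cv0 1) (g.rr_maps hα nt) n ⟨hw0, hww.trans hw1⟩
        rw [Function.iterate_succ', Function.comp_apply]
        linarith [(g.rr_mem hα nt this.1 this.2).1]
    have h1 := H.rr_upper hα nt K1 K2 m0 hm h0 hle hmem'.2
    have h2 : 0 ≤ 16 / m ^ 2 * (1 - g.c) := by positivity
    calc _ ≤ 16 / m ^ 2 * (1 - g.c) * ((16 / m ^ 2 * (1 - g.c)) ^ n * (w' - w)) :=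
          h1.trans (mlL ih h2)
      _ = _ := by ring
end rrsec

section apr
variable {α : ℝ} {g g1 : LorenzMap α} {K m : ℝ} {a b : ℕ} {p q : ℝ}
open LorenzMap

theorem RD.L_alpha (hα : 1 < α) (R : RD g g1 a b p q) (H : Geo K g) (K1 : 1 ≤ K) (K2 : K ≤ 2)
    (hc : 1 / 2 ≤ g.c) : (g.c - p) ^ α ≤ 4 * (g.cv1 - g.gl p) ∧
      g.cv1 - g.gl p ≤ 2 * 2 ^ α * (g.c - p) ^ α := by
  have nt := R.nt
  have h := H.left hα nt R.p0.le R.pc.le le_rfl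
  rw [(g.gl_br hα nt).hB, Z_c, Real.zero_rpow (by linarith), sub_zero] at h
  have hz := Z_nonneg (g := g) R.pc.le
  have e := cZ (g := g) p
  have c1 := g.hc.2
  have h1 : (g.c - p) ^ α ≤ g.Z p ^ α :=
    rlr (by linarith [R.pc]) (by nlinarith) (by linarith)
  have h2 : g.Z p ^ α ≤ 2 ^ α * (g.c - p) ^ α := by
    rw [← Real.mul_rpow (by norm_num) (by linarith [R.pc])]
    exact rlr hz (by nlinarith) (by linarith)
  have h0 : 0 ≤ g.Z p ^ α := Real.rpow_nonneg hz _
  have v1 := g.cv1_le_one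
  have v0 : 1 / 2 ≤ g.cv1 := by linarith [nt.2]
  have hgp : g.gl p ≤ g.cv1 := ((g.gl_br hα nt).maps ⟨R.p0.le, R.pc.le⟩).2
  constructor
  · have : K * (g.cv1 - g.gl p) ≤ 2 * (g.cv1 - g.gl p) :=
      mlR K2 (by linarith)
    nlinarith
  · have i1 : g.cv1 * g.Z p ^ α ≤ 1 * g.Z p ^ α := mlR v1 h0
    have i2 : 0 ≤ g.cv1 * g.Z p ^ α := by positivity
    nlinarith

theorem RD.S2 (hα : 1 < α) (R : RD g g1 a b p q) (H : Geo K g) (K1 : 1 ≤ K) (K2 : K ≤ 2)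
    (hc : 1 / 2 ≤ g.c) (m0 : 0 < m) (hm : m ≤ g.Z g.cv0)
    (n1 : 8 * (1 - g.c) / m ≤ (m / 4) ^ α) (n2 : 2 * (1 - g.c) / m ≤ 1 / 2) :
    m / 4 ≤ p - g.cv0 ∧ m / 2 ≤ g.c - g.cv0 ∧ (1 - g.c) / 2 ≤ g.cv1 - g.c := by
  have nt := R.nt
  have hε : 0 < 1 - g.c := by linarith [g.hc.2]
  have h0 : 0 ≤ 2 * (1 - g.c) / m := by positivity
  have hpow : (2 * (1 - g.c) / m) ^ a ≤ 2 * (1 - g.c) / m := by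
    have := pow_le_pow_of_le_one h0 (by linarith) R.ha
    simpa using this
  have e0 := cZ (g := g) g.cv0
  have hcv : m / 2 ≤ g.c - g.cv0 := by nlinarith
  refine ⟨?_, hcv, ?_⟩
  · have h1 := (R.L_alpha hα H K1 K2 hc).1
    have h2 := H.rr_top_iter hα nt K2 m0 hm a R.cp.le (R.pc.le.trans g.hc.2.le)
    rw [← R.gl_p hα] at h2
    have h3 : (g.c - p) ^ α ≤ (m / 4) ^ α := by
      refine le_trans ?_ n1
      have : (2 * (1 - g.c) / m) ^ a * (1 - p) ≤ 2 * (1 - g.c) / m * 1 :=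
        mul_le_mul hpow (by linarith [R.p0]) (by linarith [R.pc, g.hc.2]) h0
      have e : 8 * (1 - g.c) / m = 4 * (2 * (1 - g.c) / m * 1) := by ring
      rw [e]
      linarith [g.cv1_le_one]
    have h4 := (Real.rpow_le_rpow_iff (by linarith [R.pc]) (by positivity) (by linarith)).1 h3
    linarith
  · have hs := R.s_mem
    have h2 := H.rr_top_iter hα nt K2 m0 hm a (nt.1.le.trans hs.1.le) (hs.2.trans R.q1.le)
    rw [← R.cv1_eq hα] at h2
    set s := p + (q - p) * g1.cv1
    have : (2 * (1 - g.c) / m) ^ a * (1 - s) ≤ 1 / 2 * (1 - g.c) :=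
      mul_le_mul (hpow.trans n2) (by linarith [hs.1]) (by linarith [hs.2, R.q1]) (by norm_num)
    linarith

theorem ell_log (hα : 1 < α) (nt : g.IsNontrivial) (H : Geo K g) (K1 : 1 ≤ K) (K2 : K ≤ 2)
    (hcv : (1 - g.c) / 2 ≤ g.cv1 - g.c) (j : ℕ) :
    0 < g.Z (g.ell^[j + 1] g.c) ∧ -Real.log (g.Z (g.ell^[j + 1] g.c)) ≤
      (α ^ (j + 1))⁻¹ * Real.log (4 / (1 - g.c)) + Real.log K / (α - 1) := by
  have hε : 0 < 1 - g.c := by linarith [g.hc.2]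
  have hα0 : 0 < α := by linarith
  have hα1 : 0 < α - 1 := by linarith
  have v1 := g.cv1_le_one
  have v0 : 0 < g.cv1 := by linarith [nt.2, g.hc.1]
  have hlK : 0 ≤ Real.log K := Real.log_nonneg K1
  have key : ∀ w, 0 ≤ w → w < g.cv1 → 0 < g.Z (g.ell w) ∧
      Real.log ((g.cv1 - w) / g.cv1) - Real.log K ≤ α * Real.log (g.Z (g.ell w)) := by
    intro w hw hw'
    have h1 := (H.ellZ hα nt hw hw'.le).1
    have hm := g.ell_mem hα nt hw hw'.le
    have hz := Z_nonneg hm.2.1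
    have hzp : 0 < g.Z (g.ell w) := by
      rcases hz.eq_or_lt with h | h
      · rw [← h, Real.zero_rpow (by linarith)] at h1
        simp at h1; linarith
      · exact h
    refine ⟨hzp, ?_⟩
    rw [← Real.log_div (by have : 0 < (g.cv1 - w) / g.cv1 := div_pos (by linarith) v0
                           exact this.ne') (by linarith), ← Real.log_rpow hzp]
    apply Real.log_le_log (div_pos (div_pos (by linarith) v0) (by linarith))
    rw [div_div, div_le_iff₀ (by positivity)]
    linarith
  induction j with
  | zero =>
    obtain ⟨h1, h2⟩ := key g.c g.hc.1.le nt.2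
    refine ⟨h1, ?_⟩
    have h3 : Real.log ((1 - g.c) / 2) ≤ Real.log ((g.cv1 - g.c) / g.cv1) := by
      apply Real.log_le_log (by linarith)
      rw [le_div_iff₀ v0]
      nlinarith
    have h4 : Real.log (4 / (1 - g.c)) = Real.log 2 - Real.log ((1 - g.c) / 2) := by
      rw [← Real.log_div (by norm_num) (by linarith)]
      congr 1; field_simp; norm_num
    have h5 : Real.log K ≤ Real.log 2 := Real.log_le_log (by linarith) K2
    have h6 : 0 ≤ Real.log K / (α - 1) := by positivity
    simp only [zero_add, pow_one, Function.iterate_one]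
    have h7 : α * -Real.log (g.Z (g.ell g.c)) ≤ Real.log (4 / (1 - g.c)) := by linarith
    have h8 : -Real.log (g.Z (g.ell g.c)) ≤ α⁻¹ * Real.log (4 / (1 - g.c)) := by
      rw [inv_mul_eq_div, le_div_iff₀ hα0]; linarith
    linarith
  | succ j ih =>
    have hm := RD.ell_le hα nt (j + 1) (s := g.c) ⟨g.hc.1.le, le_rfl⟩
    set w := g.ell^[j + 1] g.c
    obtain ⟨h1, h2⟩ := key w hm.1 (hm.2.trans_lt nt.2)
    rw [Function.iterate_succ', Function.comp_apply]
    refine ⟨h1, ?_⟩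
    have h3 : Real.log (g.Z w) ≤ Real.log ((g.cv1 - w) / g.cv1) := by
      apply Real.log_le_log ih.1
      rw [Z, sub_div, div_self v0.ne']
      have := div_le_div_of_nonneg_left hm.1 g.hc.1 nt.2.le
      linarith
    have h4 : α * -Real.log (g.Z (g.ell w)) ≤ (α ^ (j + 1))⁻¹ * Real.log (4 / (1 - g.c)) +
      Real.log K / (α - 1) + Real.log K := by linarith [ih.2]
    have h5 : (α ^ (j + 1))⁻¹ * Real.log (4 / (1 - g.c)) +
      Real.log K / (α - 1) + Real.log K = α * ((α ^ (j + 1 + 1))⁻¹ * Real.log (4 / (1 - g.c)) +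
      Real.log K / (α - 1)) := by
      rw [pow_succ α (j + 1)]; field_simp; ring
    rw [h5] at h4
    exact lML h4 hα0

theorem ell_small (hα : 1 < α) (nt : g.IsNontrivial) (H : Geo K g) (K1 : 1 ≤ K) (K2 : K ≤ 2)
    (hcv : (1 - g.c) / 2 ≤ g.cv1 - g.c) {bb j : ℕ} (hb : bb ≤ j) {κ : ℝ}
    (n3 : (α ^ (bb + 1))⁻¹ * Real.log (4 / (1 - g.c)) + Real.log K / (α - 1) ≤ κ) :
    g.ell^[j + 1] g.c ≤ κ ∧ 1 - κ ≤ g.Z (g.ell^[j + 1] g.c) := by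
  obtain ⟨h1, h2⟩ := ell_log hα nt H K1 K2 hcv j
  have hε : 0 < 1 - g.c := by linarith [g.hc.2]
  have hlog : 0 ≤ Real.log (4 / (1 - g.c)) := Real.log_nonneg (by
    rw [le_div_iff₀ hε]; linarith [g.hc.1])
  have h3 : (α ^ (j + 1))⁻¹ ≤ (α ^ (bb + 1))⁻¹ := by
    gcongr
    · exact hα.le
  have h4 := mlR h3 hlog
  have h5 := Real.log_le_sub_one_of_pos h1
  have h6 : 1 - κ ≤ g.Z (g.ell^[j + 1] g.c) := by linarith
  refine ⟨?_, h6⟩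
  have e := cZ (g := g) (g.ell^[j + 1] g.c)
  have hm := RD.ell_le hα nt (j + 1) (s := g.c) ⟨g.hc.1.le, le_rfl⟩
  have hz1 : g.Z (g.ell^[j + 1] g.c) ≤ 1 := Z_le_one hm.1
  nlinarith [g.hc.2, g.hc.1]

theorem RD.ell_q_le (hα : 1 < α) (R : RD g g1 a b p q) (j : ℕ) {y : ℝ} (hy0 : 0 ≤ y) (hy : y ≤ q) :
    g.ell^[j + 1] y ≤ g.ell^[j] g.c := by
  have nt := R.nt
  have hm := g.ell_mem hα nt hy0 (hy.trans R.qc.le)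
  rw [Function.iterate_succ, Function.comp_apply]
  exact (iterate_mono (S := Icc 0 g.cv1) (g.gl_br hα nt).inv_mono
      (g.ell_maps hα nt) j).monotoneOn ⟨hm.1, hm.2.1.trans nt.2.le⟩ ⟨g.hc.1.le, nt.2.le⟩ hm.2.1

theorem RD.Rα (hα : 1 < α) (R : RD g g1 a b p q) (H : Geo K g) (K1 : 1 ≤ K) (K2 : K ≤ 2)
    (m0 : 0 < m) (hm : m ≤ g.Z g.cv0) : m / 2 * g.T q ^ α ≤ g.gr q - g.cv0 ∧
      g.gr q - g.cv0 ≤ 2 * g.T q ^ α := by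
  have nt := R.nt
  have h := H.right hα nt le_rfl R.cq.le R.q1.le
  rw [(g.gr_br hα nt).hA, T_c, Real.zero_rpow (by linarith), sub_zero] at h
  have h0 : 0 ≤ g.T q ^ α := Real.rpow_nonneg (T_nonneg R.cq.le) _
  have h1 := cv0_gap hm
  have hgq : g.cv0 ≤ g.gr q := ((g.gr_br hα nt).maps ⟨R.cq.le, R.q1.le⟩).1
  constructor
  · have i1 := mlR h1 h0
    have i2 : K * (g.gr q - g.cv0) ≤ 2 * (g.gr q - g.cv0) :=
      mlR K2 (by linarith)
    linarith
  · have i1 : (1 - g.cv0) * g.T q ^ α ≤ 1 * g.T q ^ α :=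
      mlR (by linarith [g.cv0_nonneg]) h0
    have i2 : 0 ≤ (1 - g.cv0) * g.T q ^ α := mul_nonneg (by linarith) h0
    nlinarith

theorem RD.S2' (hα : 1 < α) (R : RD g g1 a b p q) (H : Geo K g) (K1 : 1 ≤ K) (K2 : K ≤ 2)
    (m0 : 0 < m) (m1 : m < 1) (hm : m ≤ g.Z g.cv0)
    (hcv : (1 - g.c) / 2 ≤ g.cv1 - g.c) {bb : ℕ} (hb : bb + 2 ≤ b)
    (n3 : (α ^ (bb + 1))⁻¹ * Real.log (4 / (1 - g.c)) + Real.log K / (α - 1) ≤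
      m / 2 * (1 / 8) ^ α) :
    q - g.c ≤ (1 - g.c) / 8 ∧ g.gr q ≤ 1 / 8 ∧
      ∀ y, 0 ≤ y → y ≤ q → 1 / 2 ≤ g.Z (g.ell^[b] y) := by
  have nt := R.nt
  have hε : 0 < 1 - g.c := by linarith [g.hc.2]
  obtain ⟨h1, h2⟩ := ell_small hα nt H K1 K2 hcv (j := b - 2) (by omega) n3
  have hb2 : b - 2 + 1 + 1 = b := by omega
  have h8 : (1 / 8 : ℝ) ^ α ≤ 1 / 8 := by
    have := Real.rpow_le_rpow_of_exponent_ge' (by norm_num : (0:ℝ) ≤ 1 / 8) (by norm_num)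
      (by norm_num : (0:ℝ) ≤ 1) hα.le
    rwa [Real.rpow_one] at this
  have h80 : 0 < (1 / 8 : ℝ) ^ α := by positivity
  have hq := R.ell_q_le hα (b - 2 + 1) (R.p0.le.trans (R.pc.le.trans R.cq.le)) le_rfl
  rw [hb2, ← R.gr_q hα] at hq
  refine ⟨?_, by nlinarith, ?_⟩
  · have h3 := (R.Rα hα H K1 K2 m0 hm).1
    have h4 : g.T q ^ α ≤ (1 / 8) ^ α := by
      have : m / 2 * g.T q ^ α ≤ m / 2 * (1 / 8) ^ α := by linarith [g.cv0_nonneg]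
      exact lML this (by linarith)
    have h5 := (Real.rpow_le_rpow_iff (T_nonneg R.cq.le) (by norm_num) (by linarith)).1 h4
    rw [← eT]; nlinarith
  · intro y hy0 hy
    have := R.ell_q_le hα (b - 2 + 1) hy0 hy
    rw [hb2] at this
    have := Z_anti (g := g) this
    nlinarith
end apr

section elld
variable {α : ℝ} {g g1 : LorenzMap α} {K m : ℝ} {a b : ℕ} {p q : ℝ}
open LorenzMap

theorem rpow_split {α z : ℝ} (hα : 1 < α) (hz : 0 ≤ z) : z ^ α = z * z ^ (α - 1) := by
  rcases hz.eq_or_lt with rfl | h0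
  · rw [Real.zero_rpow (by linarith)]; simp
  · rw [← Real.rpow_one_add' hz (by linarith)]; congr 1; ring

theorem Geo.ell_step (hα : 1 < α) (nt : g.IsNontrivial) (H : Geo K g) (K1 : 1 ≤ K)
    {w w' : ℝ} (hw : 0 ≤ w) (hww : w ≤ w') (hw' : w' ≤ g.cv1) :
    (g.ell w' - g.ell w) * (g.cv1 - w') ≤ K ^ 2 / α * ((w' - w) * (g.c * g.Z (g.ell w'))) ∧
    (w' - w) * (g.c * g.Z (g.ell w)) ≤ K ^ 2 * α * ((g.cv1 - w) * (g.ell w' - g.ell w)) := by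
  obtain ⟨h1, h2, h3⟩ := g.ell_mem hα nt hw (hww.trans hw')
  obtain ⟨h1', h2', h3'⟩ := g.ell_mem hα nt (hw.trans hww) hw'
  have hle : g.ell w ≤ g.ell w' := (g.gl_br hα nt).inv_mono.monotoneOn ⟨hw, hww.trans hw'⟩
    ⟨hw.trans hww, hw'⟩ hww
  have h := H.left hα nt h1 hle h2'
  rw [h3, h3'] at h
  obtain ⟨a1, a2⟩ := H.ellZ hα nt hw (hww.trans hw')
  obtain ⟨b1, b2⟩ := H.ellZ hα nt (hw.trans hww) hw'
  have hZ := Z_nonneg h2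
  have hZ' := Z_nonneg h2'
  obtain ⟨e1, e2⟩ := rpow_sub_bounds hα hZ' (Z_anti hle)
  have c1 := cZ (g := g) (g.ell w)
  have c1' := cZ (g := g) (g.ell w')
  set x := g.Z (g.ell w)
  set y := g.Z (g.ell w')
  have hxy : y ≤ x := Z_anti hle
  have hD : g.ell w' - g.ell w = g.c * (x - y) := by linarith
  have hc := g.hc.1
  have v0 : 0 < g.cv1 := by linarith [nt.2]
  have hα0 : 0 < α := by linarith
  have py : 0 ≤ y ^ (α - 1) := Real.rpow_nonneg hZ' _
  have px : 0 ≤ x ^ (α - 1) := Real.rpow_nonneg hZ _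
  rw [rpow_split hα hZ'] at b1
  rw [hD]
  constructor
  · have i1 : α * (g.cv1 * (y ^ (α - 1) * (x - y))) ≤ K * (w' - w) := by
      have := mlL e1 v0.le
      linarith [h.2]
    have i2 : g.c * (x - y) * (g.cv1 - w') ≤ g.c * (x - y) * (K * (g.cv1 * (y * y ^ (α - 1)))) :=
      mlL b1 (mul_nonneg hc.le (by linarith))
    refine i2.trans ?_
    rw [div_mul_eq_mul_div, le_div_iff₀ hα0]
    have i3 : 0 ≤ g.c * K * y := by positivity
    have := mlL i1 i3
    linarith
  · have i1 : w' - w ≤ K * (g.cv1 * (α * x ^ (α - 1) * (x - y))) := by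
      refine h.1.trans ?_
      gcongr
    have i2 : 0 ≤ g.c * x := by positivity
    have i3 := mlR i1 i2
    refine i3.trans ?_
    have i4 : K * (g.cv1 * (α * x ^ (α - 1) * (x - y))) * (g.c * x) =
      K * α * g.c * (x - y) * (g.cv1 * x ^ α) := by rw [rpow_split hα hZ]; ring
    have i5 : 0 ≤ K * α * g.c * (x - y) := mul_nonneg (by positivity) (by linarith)
    rw [i4]
    have := mlL a2 i5
    linarith

theorem ell_iter_mem (hα : 1 < α) (nt : g.IsNontrivial) (j : ℕ) {y : ℝ} (hy0 : 0 ≤ y)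
    (hy : y < g.cv1) : 0 ≤ g.ell^[j + 1] y ∧ g.ell^[j + 1] y < g.c := by
  have h := iterate_maps (S := Ico 0 g.cv1) (k := g.ell) (fun x hx => by
    have h1 := (g.gl_br hα nt).inv_mono ⟨hx.1, hx.2.le⟩ ⟨(hx.1.trans hx.2.le), le_rfl⟩ hx.2
    rw [(g.gl_br hα nt).inv_B] at h1
    exact ⟨(g.ell_mem hα nt hx.1 hx.2.le).1, h1.trans nt.2⟩) j (x := y) ⟨hy0, hy⟩
  rw [Function.iterate_succ', Function.comp_apply]
  have h1 := (g.gl_br hα nt).inv_mono ⟨h.1, h.2.le⟩ ⟨(h.1.trans h.2.le), le_rfl⟩ h.2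
  rw [(g.gl_br hα nt).inv_B] at h1
  exact ⟨(g.ell_mem hα nt h.1 h.2.le).1, h1⟩

theorem ell_iter_le (hα : 1 < α) (nt : g.IsNontrivial) (j : ℕ) {x y : ℝ} (hx : 0 ≤ x) (hxy : x ≤ y)
    (hy : y ≤ g.cv1) : g.ell^[j] x ≤ g.ell^[j] y :=
  (iterate_mono (S := Icc 0 g.cv1) (g.gl_br hα nt).inv_mono
      (g.ell_maps hα nt) j).monotoneOn ⟨hx, hxy.trans hy⟩ ⟨hx.trans hxy, hy⟩ hxy

theorem Geo.ell_up (hα : 1 < α) (nt : g.IsNontrivial) (H : Geo K g) (K1 : 1 ≤ K)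
    {x y : ℝ} (hx : 0 ≤ x) (hxy : x ≤ y) (hy : y < g.cv1) (j : ℕ) :
    (g.ell^[j + 1] y - g.ell^[j + 1] x) * (g.cv1 - y) ≤
      (K ^ 2 / α) ^ (j + 1) * ((y - x) * g.Z (g.ell^[j + 1] y)) := by
  have hc := g.hc.1
  have hα0 : 0 < α := by linarith
  induction j with
  | zero =>
    have h := (H.ell_step hα nt K1 hx hxy hy.le).1
    simp only [zero_add, Function.iterate_one, pow_one]
    refine h.trans ?_
    have hz := Z_nonneg (g.ell_mem hα nt (hx.trans hxy) hy.le).2.1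
    have : 0 ≤ K ^ 2 / α * ((y - x) * g.Z (g.ell y)) :=
      mul_nonneg (by positivity) (mul_nonneg (by linarith) hz)
    nlinarith [g.hc.2]
  | succ j ih =>
    have hyj := ell_iter_mem hα nt j (hx.trans hxy) hy
    have hxj := ell_iter_mem hα nt j hx (hxy.trans_lt hy)
    have hle := ell_iter_le hα nt (j + 1) hx hxy hy.le
    have hs := (H.ell_step hα nt K1 hxj.1 hle (hyj.2.le.trans nt.2.le)).1
    have hle2 := ell_iter_le hα nt (j + 2) hx hxy hy.le
    rw [Function.iterate_succ' g.ell (j + 1), Function.comp_apply, Function.comp_apply] at *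
    set X := g.ell^[j + 1] x
    set Y := g.ell^[j + 1] y
    have hzY : 0 < g.Z Y := Z_pos hyj.2
    have e := cZ (g := g) Y
    have hzn := Z_nonneg (g.ell_mem hα nt hyj.1 (hyj.2.le.trans nt.2.le)).2.1
    have h1 : (g.ell Y - g.ell X) * g.Z Y ≤ K ^ 2 / α * ((Y - X) * g.Z (g.ell Y)) := by
      have : (g.ell Y - g.ell X) * (g.c * g.Z Y) ≤
        K ^ 2 / α * ((Y - X) * (g.c * g.Z (g.ell Y))) :=
        (mlL (by rw [e]; linarith [nt.2]) (by linarith)).trans hs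
      refine lML ?_ hc
      linarith
    refine lML ?_ hzY
    have i1 := mlR h1 (by linarith : 0 ≤ g.cv1 - y)
    have i2 : 0 ≤ K ^ 2 / α * g.Z (g.ell Y) := by positivity
    have i3 := mlL ih i2
    calc _ = (g.ell Y - g.ell X) * g.Z Y * (g.cv1 - y) := by ring
      _ ≤ _ := i1
      _ = K ^ 2 / α * g.Z (g.ell Y) * ((Y - X) * (g.cv1 - y)) := by ring
      _ ≤ _ := i3
      _ = _ := by ring

theorem Geo.ell_Zlow (hα : 1 < α) (nt : g.IsNontrivial) (H : Geo K g) (K1 : 1 ≤ K) (K2 : K ≤ 2)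
    {x η : ℝ} (hx : 0 ≤ x) (hxc : x < g.cv1) (hη : 0 ≤ η) (h1 : η ^ α ≤ (g.cv1 - x) / 2)
    (h2 : η ^ α ≤ η / 2) (j : ℕ) : η ≤ g.Z (g.ell^[j + 1] x) := by
  have v1 := g.cv1_le_one
  have v0 : 0 < g.cv1 := by linarith [nt.2, g.hc.1]
  have key : ∀ w, 0 ≤ w → w ≤ g.cv1 → η ^ α ≤ (1 - w / g.cv1) / 2 → η ≤ g.Z (g.ell w) := by
    intro w hw hw' h
    have ha := (H.ellZ hα nt hw hw').1
    have hz := Z_nonneg (g.ell_mem hα nt hw hw').2.1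
    have hzα : 0 ≤ g.Z (g.ell w) ^ α := Real.rpow_nonneg hz _
    have e : g.cv1 * (1 - w / g.cv1) = g.cv1 - w := by field_simp
    have h3 : (1 - w / g.cv1) ≤ K * g.Z (g.ell w) ^ α := by
      refine lML ?_ v0
      rw [e]; linarith
    have h4 : η ^ α ≤ g.Z (g.ell w) ^ α := by nlinarith
    exact (Real.rpow_le_rpow_iff hη hz (by linarith)).1 h4
  induction j with
  | zero =>
    apply key x hx hxc.le
    have : g.cv1 - x ≤ 1 - x / g.cv1 := by
      have e : g.cv1 * (1 - x / g.cv1) = g.cv1 - x := by field_simp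
      have : 0 ≤ 1 - x / g.cv1 := by rw [sub_nonneg, div_le_one v0]; exact hxc.le
      nlinarith
    linarith
  | succ j ih =>
    have hm := ell_iter_mem hα nt j hx hxc
    rw [Function.iterate_succ', Function.comp_apply]
    apply key _ hm.1 (hm.2.le.trans nt.2.le)
    have := div_le_div_of_nonneg_left hm.1 g.hc.1 nt.2.le
    simp only [Z] at ih
    linarith

theorem Geo.ell_down (hα : 1 < α) (nt : g.IsNontrivial) (H : Geo K g) (K1 : 1 ≤ K)
    {x y ν : ℝ} (hx : 0 ≤ x) (hxy : x ≤ y) (hy : y < g.cv1) (hν : 0 ≤ ν)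
    (hZ : ∀ j, 1 - g.c ≤ ν * (g.c * g.Z (g.ell^[j + 1] x))) (j : ℕ) :
    (y - x) * (g.c * g.Z (g.ell^[j + 1] x)) ≤ (K ^ 2 * α * (1 + ν)) ^ (j + 1) *
      ((g.cv1 - x) * (g.ell^[j + 1] y - g.ell^[j + 1] x)) := by
  have hc := g.hc.1
  have hα0 : 0 < α := by linarith
  induction j with
  | zero =>
    have h := (H.ell_step hα nt K1 hx hxy hy.le).2
    have hle := ell_iter_le hα nt 1 hx hxy hy.le
    simp only [zero_add, Function.iterate_one, pow_one] at *
    refine h.trans ?_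
    have : 0 ≤ K ^ 2 * α * ((g.cv1 - x) * (g.ell y - g.ell x)) :=
      mul_nonneg (by positivity) (mul_nonneg (by linarith) (by linarith))
    nlinarith
  | succ j ih =>
    have hyj := ell_iter_mem hα nt j (hx.trans hxy) hy
    have hxj := ell_iter_mem hα nt j hx (hxy.trans_lt hy)
    have hle := ell_iter_le hα nt (j + 1) hx hxy hy.le
    have hs := (H.ell_step hα nt K1 hxj.1 hle (hyj.2.le.trans nt.2.le)).2
    have hle2 := ell_iter_le hα nt (j + 2) hx hxy hy.le
    have hZj := hZ j
    rw [Function.iterate_succ' g.ell (j + 1), Function.comp_apply, Function.comp_apply] at *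
    set X := g.ell^[j + 1] x
    set Y := g.ell^[j + 1] y
    have hzX : 0 < g.c * g.Z X := mul_pos hc (Z_pos hxj.2)
    have e := cZ (g := g) X
    have hzn := Z_nonneg (g.ell_mem hα nt hxj.1 (hxj.2.le.trans nt.2.le)).2.1
    have h0 : g.cv1 - X ≤ (1 + ν) * (g.c * g.Z X) := by
      have := g.cv1_le_one; linarith
    have hd : 0 ≤ g.ell Y - g.ell X := by linarith
    have h1 : (Y - X) * (g.c * g.Z (g.ell X)) ≤
        K ^ 2 * α * ((1 + ν) * (g.c * g.Z X) * (g.ell Y - g.ell X)) :=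
      hs.trans (by gcongr)
    refine lML ?_ hzX
    have hcz : 0 ≤ g.c * g.Z (g.ell X) := by positivity
    have i3 := mlR ih hcz
    have hA : 0 ≤ (K ^ 2 * α * (1 + ν)) ^ (j + 1) * (g.cv1 - x) :=
      mul_nonneg (by positivity) (by linarith)
    have i4 := mlL h1 hA
    calc _ = (y - x) * (g.c * g.Z X) * (g.c * g.Z (g.ell X)) := by ring
      _ ≤ _ := i3
      _ = (K ^ 2 * α * (1 + ν)) ^ (j + 1) * (g.cv1 - x) * ((Y - X) * (g.c * g.Z (g.ell X))) := by
        ring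
      _ ≤ _ := i4
      _ = _ := by ring
end elld

def nlo (α : ℝ) (bb : ℕ) : ℝ := α ^ (-(bb : ℝ) / α)
def nhi (α σ θ : ℝ) (bb : ℕ) : ℝ := θ * α ^ (-(bb : ℝ) * σ / α ^ 2)
def nlam (α σ e : ℝ) : ℝ := (e / (2 * α)) ^ (2 * α - 1 - σ) / (2 * 2 ^ α)
def nup (α σ m e : ℝ) : ℝ := 8 * (16 / m ^ 2 * e) ^ (α - 1 + σ)

structure NumE (α σ β θ m K : ℝ) (bb : ℕ) (e : ℝ) : Prop where
  e1 : e ≤ 1 / 2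
  e2 : 8 * e / m ≤ (m / 4) ^ α
  e3 : 2 * e / m ≤ 1 / 2
  e4 : 16 / m ^ 2 * e ≤ 1 / 2
  e5 : (α ^ (bb - 2 + 1))⁻¹ * Real.log (4 / e) + Real.log K / (α - 1) ≤ m / 2 * (1 / 8) ^ α
  e6 : ∃ η ν : ℝ, 0 ≤ η ∧ 0 ≤ ν ∧ η ^ α ≤ e / 8 ∧ η ^ α ≤ η / 2 ∧ e ≤ ν * (η / 2) ∧
    (1 + ν) ^ (2 * bb) ≤ 2
  e7 : nup α σ m e ≤ (e / (16 * (bb : ℝ) ^ 4)) ^ (α - 1)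
  e8 : 32 / m * α ^ (-(bb : ℝ)) * e ^ (α - 1) < nlam α σ e
  e9 : 16 / m * α ^ (-(bb : ℝ)) * e ^ (α - 1) ≤ nhi α σ θ bb ^ α * nlam α σ e
  e10 : nlo α bb ^ α * (64 * 2 ^ (α - 1) * nup α σ m e) ≤
    α ^ (-((1 + (σ / α) ^ 2 - β) * (bb : ℝ))) * e ^ (α - 1) * m

structure NumB (α σ β θ m K : ℝ) (bb : ℕ) : Prop where
  m0 : 0 < m
  m1 : m < 1
  m4 : 4 * m ^ ((α - 1) / 2) ≤ 1
  K1 : 1 ≤ K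
  K4 : K ^ (2 * (2 * bb)) ≤ 2
  bb3 : 3 ≤ bb
  K3 : K ^ 2 < α
  bbN : 2 * α + 2 * bb + 1 ≤ (bb : ℝ) ^ 2
  s1 : 2 ≤ ((1 + α) / 2) ^ (bb - 1)
  s2 : 4 * 2 ^ α * m ^ (((1 + α) / 2) ^ (bb - 1) - 2) < α ^ (-3 * (bb : ℝ))
  hi0 : 0 ≤ nhi α σ θ bb
  he : ∀ e, nlo α bb ≤ e → e ≤ nhi α σ θ bb → NumE α σ β θ m K bb e

theorem NumB.K2 {α σ β θ m K : ℝ} {bb : ℕ} (N : NumB α σ β θ m K bb) : K ≤ 2 := by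
  have h := N.K4
  have h3 := N.bb3
  calc K = K ^ 1 := (pow_one K).symm
    _ ≤ K ^ (2 * (2 * bb)) := pow_le_pow_right₀ N.K1 (by omega)
    _ ≤ 2 := h

structure LevOut {α : ℝ} (g : LorenzMap α) (b : ℕ) (p q m : ℝ) (bb : ℕ) (σ : ℝ) : Prop where
  o1 : 8 * (bb : ℝ) ^ 4 * (q - p) ≤ 1 - g.c
  o2 : m / 4 ≤ p - g.cv0
  o3 : m / 2 ≤ g.c - g.cv0
  o4 : (1 - g.c) / 2 ≤ g.cv1 - g.c
  o5 : q - g.c ≤ (1 - g.c) / 8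
  o6 : g.gr q ≤ 1 / 8
  o7 : g.c - p ≤ (1 - g.c) / 8
  up : ∀ j x y, j ≤ b → p ≤ x → x ≤ y → y ≤ q →
    g.ell^[j] y - g.ell^[j] x ≤ 8 / (1 - g.c) * (y - x)
  dn : ∀ x y, p ≤ x → x ≤ y → y ≤ q →
    (y - x) / (32 * (1 - g.c) * α ^ b) ≤ g.ell^[b] y - g.ell^[b] x
  llo : nlam α σ (1 - g.c) ≤ (g.c - p) ^ (α - 1)

section lev
variable {α σ β θ m K : ℝ} {bb : ℕ} {g g1 : LorenzMap α} {a b : ℕ} {p q : ℝ}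
open LorenzMap

theorem RD.eps' (R : RD g g1 a b p q) : 1 - g1.c = (q - g.c) / (q - p) := by
  have := R.hC
  have h := R.hcc
  rw [eq_div_iff this.ne']; linarith

theorem lev_up0 (hα : 1 < α) (R : RD g g1 a b p q) (H : Geo K g) (K1 : 1 ≤ K)
    (hK : ∀ j ≤ b, K ^ (2 * j) ≤ 2) {e : ℝ} (hε : 0 < e) (i1' : e / 4 ≤ g.cv1 - q) :
    ∀ j x y, j + 1 ≤ b → p ≤ x → x ≤ y → y ≤ q →
      g.ell^[j + 1] y - g.ell^[j + 1] x ≤ 8 / e * (α ^ (j + 1))⁻¹ * (y - x) := by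
  intro j x y hj hx hxy hy
  have nt := R.nt
  have hy' : y < g.cv1 := hy.trans_lt R.qc
  have hx0 : 0 ≤ x := R.p0.le.trans hx
  have h := H.ell_up hα nt K1 hx0 hxy hy' j
  have hz1 : g.Z (g.ell^[j + 1] y) ≤ 1 := Z_le_one (ell_iter_mem hα nt j (hx0.trans hxy) hy').1
  have hz0 : 0 ≤ g.Z (g.ell^[j + 1] y) :=
    Z_nonneg (ell_iter_mem hα nt j (hx0.trans hxy) hy').2.le
  have hle := ell_iter_le hα nt (j + 1) hx0 hxy hy'.le
  have i1 : e / 4 ≤ g.cv1 - y := by linarith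
  have i2 : (K ^ 2 / α) ^ (j + 1) ≤ 2 * (α ^ (j + 1))⁻¹ := by
    rw [div_pow, ← pow_mul, div_eq_mul_inv]
    exact mlR (hK (j + 1) hj) (by positivity)
  have i3 : (y - x) * g.Z (g.ell^[j + 1] y) ≤ (y - x) * 1 :=
    mlL hz1 (by linarith)
  have i4 : (K ^ 2 / α) ^ (j + 1) * ((y - x) * g.Z (g.ell^[j + 1] y)) ≤
    2 * (α ^ (j + 1))⁻¹ * ((y - x) * 1) :=
    mul_le_mul i2 i3 (mul_nonneg (by linarith) hz0) (by positivity)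
  have i5 : (g.ell^[j + 1] y - g.ell^[j + 1] x) * (e / 4) ≤
    (g.ell^[j + 1] y - g.ell^[j + 1] x) * (g.cv1 - y) :=
    mlL i1 (by linarith)
  rw [div_mul_eq_mul_div, div_mul_eq_mul_div, le_div_iff₀ hε]
  linarith

theorem lev_up (hα : 1 < α) {e : ℝ} (hε : 0 < e) (e1 : e ≤ 1 / 2)
    (up0 : ∀ j x y, j + 1 ≤ b → p ≤ x → x ≤ y → y ≤ q →
      g.ell^[j + 1] y - g.ell^[j + 1] x ≤ 8 / e * (α ^ (j + 1))⁻¹ * (y - x)) :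
    ∀ j x y, j ≤ b → p ≤ x → x ≤ y → y ≤ q →
      g.ell^[j] y - g.ell^[j] x ≤ 8 / e * (y - x) := by
  intro j x y hj hx hxy hy
  rcases j with _ | j
  · have : 1 ≤ 8 / e := by rw [le_div_iff₀ hε]; linarith
    simp only [Function.iterate_zero, id]
    nlinarith
  · refine (up0 j x y hj hx hxy hy).trans ?_
    apply mlR _ (by linarith)
    have i1 : (α ^ (j + 1))⁻¹ ≤ 1 := inv_le_one_of_one_le₀ (one_le_pow₀ hα.le)
    have i2 : 0 < 8 / e := by positivity
    nlinarith

theorem lev_dn (hα : 1 < α) (R : RD g g1 a b p q) (H : Geo K g) (K1 : 1 ≤ K) (K2 : K ≤ 2)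
    (hc : 1 / 2 ≤ g.c)
    (j1 : K ^ (2 * b) ≤ 2) {e η ν : ℝ} (hε : 0 < e) (he : e = 1 - g.c)
    (i1' : e / 4 ≤ g.cv1 - q) (i3' : g.cv1 - p ≤ 2 * e)
    (hη : 0 ≤ η) (hν : 0 ≤ ν) (e6a : η ^ α ≤ e / 8) (e6b : η ^ α ≤ η / 2)
    (e6c : e ≤ ν * (η / 2)) (e6d : (1 + ν) ^ b ≤ 2)
    (o6' : ∀ x, 0 ≤ x → x ≤ q → 1 / 2 ≤ g.Z (g.ell^[b] x)) :
    ∀ x y, p ≤ x → x ≤ y → y ≤ q →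
      (y - x) / (32 * e * α ^ b) ≤ g.ell^[b] y - g.ell^[b] x := by
  intro x y hx hxy hy
  have nt := R.nt
  have hα0 : 0 < α := by linarith
  have hy' : y < g.cv1 := hy.trans_lt R.qc
  have hx0 : 0 ≤ x := R.p0.le.trans hx
  have hx' : x < g.cv1 := hxy.trans_lt hy'
  have hb1 := R.hb
  obtain ⟨j, hj⟩ : ∃ j, b = j + 1 := ⟨b - 1, by omega⟩
  have hZ : ∀ j, 1 - g.c ≤ ν * (g.c * g.Z (g.ell^[j + 1] x)) := by
    intro j
    have := H.ell_Zlow hα nt K1 K2 hx0 hx' hη (by linarith) e6b j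
    rw [← he]
    refine e6c.trans (mlL ?_ hν)
    nlinarith
  have h := H.ell_down hα nt K1 hx0 hxy hy' hν hZ j
  rw [← hj] at h
  have hz := o6' x hx0 (hxy.trans hy)
  have hle := ell_iter_le hα nt b hx0 hxy hy'.le
  have i2 : (K ^ 2 * α * (1 + ν)) ^ b ≤ 4 * α ^ b := by
    rw [mul_pow, mul_pow, ← pow_mul]
    have : K ^ (2 * b) * (1 + ν) ^ b ≤ 2 * 2 := mul_le_mul j1 e6d (by positivity) (by norm_num)
    have := mlR this (pow_pos hα0 b).le
    linarith
  have i3 : g.cv1 - x ≤ 2 * e := by linarith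
  have hcz : 1 / 4 ≤ g.c * g.Z (g.ell^[b] x) := by nlinarith
  have i4 : (y - x) * (1 / 4) ≤ (y - x) * (g.c * g.Z (g.ell^[b] x)) :=
    mlL hcz (by linarith)
  have i5 : (K ^ 2 * α * (1 + ν)) ^ b * ((g.cv1 - x) * (g.ell^[b] y - g.ell^[b] x)) ≤
      4 * α ^ b * (2 * e * (g.ell^[b] y - g.ell^[b] x)) := by
    apply mul_le_mul i2 _ _ (by positivity)
    · exact mlR i3 (by linarith)
    · exact mul_nonneg (by linarith) (by linarith)
  rw [div_le_iff₀ (by positivity)]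
  linarith

theorem lev_fin (hα : 1 < α) (m0 : 0 < m) {e l r C A Tq E1 qt z lam up hi lo e' : ℝ}
    (hε : 0 < e) (l0 : 0 < l) (r0 : 0 < r) (hC : C = l + r) (A0 : 0 < A)
    (hT0 : 0 ≤ Tq) (hT : Tq * e ^ α = r ^ α) (qt0 : 0 < qt) (qtC : qt ≤ C)
    (Ra1 : m / 2 * Tq ≤ E1) (Ra2 : E1 ≤ 2 * Tq) (up1 : E1 ≤ 8 / e * A * qt)
    (dn1 : A * qt / (32 * e) ≤ E1)
    (llo : lam ≤ l ^ (α - 1)) (lup : r ≤ l → l ^ (α - 1) ≤ up)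
    (e8 : 32 / m * A * e ^ (α - 1) < lam) (hi0 : 0 ≤ hi)
    (e9 : 16 / m * A * e ^ (α - 1) ≤ hi ^ α * lam) (lo0 : 0 ≤ lo)
    (e10 : lo ^ α * (64 * 2 ^ (α - 1) * up) ≤ A * e ^ (α - 1) * m)
    (z0 : 0 ≤ z) (hz : C * z ≤ qt) (he' : e' = r / C) :
    r ≤ l ∧ e' ≤ hi ∧ lo ^ α * z ≤ m * e' ^ α := by
  have hα0 : 0 < α := by linarith
  have C0 : 0 < C := by linarith
  have eα : e ^ α = e * e ^ (α - 1) := rpow_split hα hε.le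
  have ea0 : 0 < e ^ (α - 1) := rpp hε _
  have hCα : C ^ α = C * C ^ (α - 1) := rpow_split hα C0.le
  have hCα0 : 0 < C ^ α := rpp C0 _
  have ru : r ^ α ≤ 16 / m * A * e ^ (α - 1) * qt := by
    have i3 : Tq ≤ 2 / m * (8 / e * A * qt) := by
      rw [div_mul_eq_mul_div, le_div_iff₀ m0]; linarith
    rw [← hT]
    calc Tq * e ^ α ≤ 2 / m * (8 / e * A * qt) * e ^ α :=
          mlR i3 (by positivity)
      _ = _ := by rw [eα]; field_simp; norm_num
  have rd : A * e ^ (α - 1) * qt ≤ 64 * r ^ α := by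
    rw [← hT, eα]
    have i1 := dn1.trans Ra2
    rw [div_le_iff₀ (by positivity)] at i1
    have i2 := mlL i1 ea0.le
    linarith
  have hrl : r ≤ l := by
    by_contra hcon
    push Not at hcon
    have i1 : qt ≤ 2 * r := by linarith
    rw [rpow_split hα r0.le] at ru
    have i2 : r ^ (α - 1) ≤ 32 / m * A * e ^ (α - 1) := by
      refine lML ?_ r0
      have := mlL i1
        (by positivity : 0 ≤ 16 / m * A * e ^ (α - 1))
      refine (ru.trans this).trans (le_of_eq ?_)
      ring
    have i4 : l ^ (α - 1) ≤ r ^ (α - 1) := rlr l0.le hcon.le (by linarith)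
    linarith
  refine ⟨hrl, ?_, ?_⟩
  · rw [he']
    refine (Real.rpow_le_rpow_iff (by positivity) hi0 hα0).1 ?_
    rw [Real.div_rpow r0.le C0.le, div_le_iff₀ hCα0, hCα]
    have i1 : l ^ (α - 1) ≤ C ^ (α - 1) := rlr l0.le (by linarith) (by linarith)
    have i2 : lam ≤ C ^ (α - 1) := llo.trans i1
    have i3 : r ^ α ≤ 16 / m * A * e ^ (α - 1) * C :=
      ru.trans (mlL qtC (by positivity))
    have i4 : 0 ≤ hi ^ α := Real.rpow_nonneg hi0 _
    have i5 := mlL i2 i4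
    have i6 := mlR (e9.trans i5) C0.le
    linarith
  · rw [he', Real.div_rpow r0.le C0.le, mul_div_assoc', le_div_iff₀ hCα0, hCα]
    have lo0 : 0 ≤ lo ^ α := Real.rpow_nonneg lo0 _
    have i1 : C ^ (α - 1) ≤ 2 ^ (α - 1) * up := by
      calc C ^ (α - 1) ≤ (2 * l) ^ (α - 1) :=
            rlr C0.le (by linarith) (by linarith)
        _ = 2 ^ (α - 1) * l ^ (α - 1) := Real.mul_rpow (by norm_num) l0.le
        _ ≤ _ := mlL (lup hrl) (by positivity)
    have i3 : lo ^ α * (64 * C ^ (α - 1)) ≤ A * e ^ (α - 1) * m :=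
      (mlL (by linarith) lo0).trans e10
    have i4 : A * e ^ (α - 1) * (C * z) ≤ 64 * r ^ α :=
      (mlL hz (by positivity)).trans rd
    have i5 := mlR i3 (mul_nonneg C0.le z0)
    have i6 := mlL i4 m0.le
    linarith

theorem lev_L (hα : 1 < α) {e l r sp G : ℝ} (m0 : 0 < m) (hε : 0 < e) (e1 : e ≤ 1 / 2)
    (e4 : 16 / m ^ 2 * e ≤ 1) (ha1 : α + σ ≤ (a : ℝ) + 1) (ha2 : (a : ℝ) + 1 ≤ 2 * α - σ)
    (l0 : 0 < l) (hs1 : l ≤ sp) (hs2 : sp ≤ l + r) (hLa1 : l ^ α ≤ 4 * G)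
    (hLa2 : G ≤ 2 * 2 ^ α * l ^ α)
    (hup : G ≤ (16 / m ^ 2 * e) ^ a * sp) (hlow : (e / (2 * α)) ^ a * sp ≤ G) :
    (r ≤ l → l ^ (α - 1) ≤ nup α σ m e) ∧ nlam α σ e ≤ l ^ (α - 1) := by
  have hα0 : 0 < α := by linarith
  have hC2 : 0 < 16 / m ^ 2 * e := by positivity
  constructor
  · intro hrl
    have hapow : (16 / m ^ 2 * e) ^ a ≤ (16 / m ^ 2 * e) ^ (α - 1 + σ) := by
      rw [← Real.rpow_natCast]
      exact Real.rpow_le_rpow_of_exponent_ge hC2 e4 (by linarith)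
    have i1 : l ^ α ≤ 4 * ((16 / m ^ 2 * e) ^ a * sp) := by linarith
    have i2 : sp ≤ 2 * l := by linarith
    rw [rpow_split hα l0.le] at i1
    have i3 : 0 ≤ (16 / m ^ 2 * e) ^ a := by positivity
    have i4 := mlL i2 i3
    have i5 : l ^ (α - 1) ≤ 8 * (16 / m ^ 2 * e) ^ a := by
      refine lML ?_ l0
      linarith
    simp only [nup]; linarith
  · have i0 : (e / (2 * α)) ^ (2 * α - 1 - σ) ≤ (e / (2 * α)) ^ a := by
      rw [← Real.rpow_natCast]
      apply Real.rpow_le_rpow_of_exponent_ge (by positivity) _ (by linarith)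
      rw [div_le_one (by positivity)]; linarith
    have i1 : (e / (2 * α)) ^ a * l ≤ (e / (2 * α)) ^ a * sp :=
      mlL hs1 (by positivity)
    have i2 : (e / (2 * α)) ^ a * l ≤ 2 * 2 ^ α * l ^ α := by linarith
    rw [rpow_split hα l0.le] at i2
    have i3 : (e / (2 * α)) ^ a ≤ 2 * 2 ^ α * l ^ (α - 1) := by
      refine le_of_mul_le_mul_right ?_ l0
      linarith
    rw [nlam, div_le_iff₀ (by positivity)]
    linarith

set_option maxHeartbeats 1000000 in
theorem level (hα : 1 < α) (hσ : σ ∈ Ioo (0:ℝ) 1) (hβ : β ∈ Ioo (0 : ℝ) ((σ / α) ^ 2))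
    (N : NumB α σ β θ m K bb) (R : RD g g1 a b p q) (H : Geo K g) (ho : memOmega α σ β bb (a, b))
    (h1 : nlo α bb ≤ 1 - g.c) (h2 : 1 - g.c ≤ nhi α σ θ bb) (hm : m ≤ g.Z g.cv0) :
    LevOut g b p q m bb σ ∧ 1 - g1.c ≤ nhi α σ θ bb ∧
    α ^ (-3 * (bb : ℝ)) * g1.Z g1.cv0 ≤ (1 - g1.c) ^ α ∧
    (m ≤ g1.Z g1.cv0 → nlo α bb ≤ 1 - g1.c) := by
  obtain ⟨-, -, ha1, ha2, hb1, hb2⟩ := ho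
  simp only at ha1 ha2 hb1 hb2
  obtain ⟨e1, e2, e3, e4, e5, ⟨η, ν, hη, hν, e6a, e6b, e6c, e6d⟩, e7, e8, e9, e10⟩ := N.he _ h1 h2
  have nt := R.nt
  have K1 := N.K1
  have K2 := N.K2
  have m0 := N.m0
  have bb3 := N.bb3
  have hε : 0 < 1 - g.c := by linarith [g.hc.2]
  have hc : 1 / 2 ≤ g.c := by linarith
  have hα0 : 0 < α := by linarith
  have hbb : bb ≤ b := by exact_mod_cast hb1
  have hb2' : b ≤ 2 * bb := by
    have : (σ / α) ^ 2 < 1 := by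
      have h0 : 0 ≤ σ / α := div_nonneg hσ.1.le hα0.le
      have : σ / α < 1 := by rw [div_lt_one hα0]; linarith [hσ.2]
      nlinarith
    have hbn : (0:ℝ) ≤ bb := by positivity
    have : (b : ℝ) ≤ 2 * bb := by nlinarith [hβ.1]
    exact_mod_cast this
  obtain ⟨o2, o3, o4⟩ := R.S2 hα H K1 K2 hc m0 hm e2 e3
  obtain ⟨o5, o6, o6'⟩ := R.S2' hα H K1 K2 m0 N.m1 hm o4 (bb := bb - 2) (by omega) e5
  have hsm := R.s_mem
  have htm := R.t_mem
  have hcv1 := R.cv1_eq hα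
  have hcv0 := R.cv0_eq hα
  have hLa := R.L_alpha hα H K1 K2 hc
  have hRa := R.Rα hα H K1 K2 m0 hm
  rw [R.gr_q hα, hcv0] at hRa
  rw [hcv1, R.gl_p hα] at hLa
  have l0 : 0 < g.c - p := sub_pos.2 R.pc
  have r0 : 0 < q - g.c := sub_pos.2 R.cq
  have hup := H.rr_upper_iter hα nt K1 K2 m0 hm (by linarith) a (w := p)
    (w' := p + (q - p) * g1.cv1) o2
    (by linarith [hsm.1, R.pc]) (hsm.2.trans R.q1.le)
  have hlow := H.rr_lower_iter hα nt K1 K2 a (w := p) (w' := p + (q - p) * g1.cv1)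
    (by linarith) (by linarith [hsm.1, R.pc]) (hsm.2.trans R.q1.le)
  have hls : g.c - p ≤ p + (q - p) * g1.cv1 - p := by linarith [hsm.1]
  have hls2 : p + (q - p) * g1.cv1 - p ≤ (g.c - p) + (q - g.c) := by linarith [hsm.2]
  obtain ⟨lup, llo⟩ := lev_L hα m0 hε e1 (e4.trans (by norm_num)) ha1 ha2 l0 hls hls2 (by linarith [hLa.1]) hLa.2 hup hlow
  have bbr : (3:ℝ) ≤ bb := by exact_mod_cast bb3
  have bb4 : (1:ℝ) ≤ (bb:ℝ) ^ 4 := one_le_pow₀ (by linarith)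
  have lup2 : q - g.c ≤ g.c - p → g.c - p ≤ (1 - g.c) / (16 * (bb:ℝ) ^ 4) := by
    intro hrl
    exact (Real.rpow_le_rpow_iff l0.le (by positivity) (by linarith)).1 ((lup hrl).trans e7)
  have o7 : g.c - p ≤ (1 - g.c) / 8 := by
    rcases le_total (q - g.c) (g.c - p) with h | h
    · refine (lup2 h).trans ?_
      apply div_le_div_of_nonneg_left hε.le (by norm_num) (by linarith)
    · linarith
  have hK : ∀ j ≤ b, K ^ (2 * j) ≤ 2 := fun j hj =>
    (pow_le_pow_right₀ K1 (by omega)).trans N.K4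
  have i1' : (1 - g.c) / 4 ≤ g.cv1 - q := by linarith
  have up0 := lev_up0 hα R H K1 hK hε i1'
  have up := lev_up hα hε e1 up0
  have dn := lev_dn hα R H K1 K2 hc (hK b le_rfl) hε rfl i1' (by linarith [g.cv1_le_one])
    hη hν e6a e6b e6c ((pow_le_pow_right₀ (by linarith) hb2').trans e6d) o6'
  obtain ⟨j, hj⟩ : ∃ j, b = j + 1 := ⟨b - 1, by omega⟩
  have hqt : 0 < q - (p + (q - p) * g1.cv0) := by linarith [htm.2, R.cq]
  have up1 := up0 j _ q hj.ge htm.1 (by linarith) le_rfl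
  rw [← hj] at up1
  have dn1 := dn _ q htm.1 (by linarith) le_rfl
  have hA0 : 0 < (α ^ b)⁻¹ := by positivity
  have hA1 : (α ^ b)⁻¹ ≤ α ^ (-(bb:ℝ)) := by
    rw [← Real.rpow_natCast, ← Real.rpow_neg hα0.le]
    exact Real.rpow_le_rpow_of_exponent_le hα.le (by linarith)
  have hA2 : α ^ (-((1 + (σ / α) ^ 2 - β) * (bb:ℝ))) ≤ (α ^ b)⁻¹ := by
    rw [← Real.rpow_natCast α b, ← Real.rpow_neg hα0.le]
    exact Real.rpow_le_rpow_of_exponent_le hα.le (by linarith)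
  have ea0 : 0 < (1 - g.c) ^ (α - 1) := rpp hε _
  have hA1' : ∀ k : ℝ, 0 < k → k / m * (α ^ b)⁻¹ * (1 - g.c) ^ (α - 1) ≤
      k / m * α ^ (-(bb:ℝ)) * (1 - g.c) ^ (α - 1) := fun k hk =>
    mlR (mlL hA1 (by positivity)) ea0.le
  have hT : g.T q ^ α * (1 - g.c) ^ α = (q - g.c) ^ α := by
    rw [← Real.mul_rpow (T_nonneg R.cq.le) hε.le, mul_comm, eT]
  have lo0 : 0 < nlo α bb := rpp hα0 _
  have z0 : 0 < g1.Z g1.cv0 := Z_pos R.nt1.1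
  have z1 : g1.Z g1.cv0 ≤ 1 - g1.cv0 := cv0_gap le_rfl
  have hz : (q - p) * g1.Z g1.cv0 ≤ q - (p + (q - p) * g1.cv0) := by
    have := mlL z1 R.hC.le
    linarith
  obtain ⟨hrl, hhi, low⟩ := lev_fin (lam := nlam α σ (1 - g.c)) (up := nup α σ m (1 - g.c))
    hα m0 hε l0 r0 (show q - p = (g.c - p) + (q - g.c) by ring) hA0
    (Real.rpow_nonneg (T_nonneg R.cq.le) _) hT hqt (by linarith [htm.1]) hRa.1 hRa.2 up1
    (le_trans (le_of_eq (by field_simp)) dn1) llo lup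
    ((hA1' 32 (by norm_num)).trans_lt e8) N.hi0
    ((hA1' 16 (by norm_num)).trans e9) lo0.le
    (e10.trans (mlR (mlR hA2 ea0.le) m0.le))
    z0.le hz R.eps'
  refine ⟨⟨?_, o2, o3, o4, o5, o6, o7, up, dn, llo⟩, hhi, ?_⟩
  · have := lup2 hrl
    rw [le_div_iff₀ (by positivity)] at this
    have i2 : q - p ≤ 2 * (g.c - p) := by linarith
    have := mlL i2 (by linarith : 0 ≤ (bb:ℝ) ^ 4)
    linarith
  · have e'0 : 0 < 1 - g1.c := by linarith [g1.hc.2]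
    have e'α : 0 < (1 - g1.c) ^ α := rpp e'0 _
    have hlo : nlo α bb ^ α = α ^ (-(bb:ℝ)) := by
      rw [nlo, ← Real.rpow_mul hα0.le, div_mul_cancel₀ _ hα0.ne']
    constructor
    · have i1 : α ^ (-3 * (bb:ℝ)) ≤ nlo α bb ^ α := by
        rw [hlo]; apply Real.rpow_le_rpow_of_exponent_le hα.le; linarith
      have := mlR i1 z0.le
      have := mlR N.m1.le e'α.le
      linarith
    · intro hmz
      refine (Real.rpow_le_rpow_iff lo0.le e'0.le hα0).1 ?_
      have := mlL hmz (Real.rpow_nonneg lo0.le α)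
      refine lML ?_ m0
      linarith
end lev

theorem num_tend {α : ℝ} (hα : 1 < α) (s t : ℝ) (ht : 0 < t) :
    Tendsto (fun n : ℕ => (n:ℝ) ^ s * α ^ (-(n:ℝ) * t)) atTop (𝓝 0) := by
  have h := (tendsto_rpow_mul_exp_neg_mul_atTop_nhds_zero s (t * Real.log α)
    (mul_pos ht (Real.log_pos hα))).comp tendsto_natCast_atTop_atTop
  refine h.congr fun n => ?_
  simp only [Function.comp]
  rw [Real.rpow_def_of_pos (by linarith : 0 < α)]
  congr 2; ring

theorem num_tend0 {α : ℝ} (hα : 1 < α) (C t : ℝ) (ht : 0 < t) :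
    Tendsto (fun n : ℕ => C * α ^ (-(n:ℝ) * t)) atTop (𝓝 0) := by
  have := (num_tend hα 0 t ht).const_mul C
  simpa using this

def nK (bb : ℕ) : ℝ := Real.exp ((1 / (bb:ℝ)) ^ 2) * ((1 + (bb:ℝ) ^ 2) / (bb:ℝ) ^ 2) ^ 2

theorem nK_le {bb : ℕ} (h : 1 ≤ bb) : nK bb ≤ Real.exp (3 * (1 / (bb:ℝ)) ^ 2) := by
  have hb : (0:ℝ) < bb := by exact_mod_cast h
  have e1 : (1 + (bb:ℝ) ^ 2) / (bb:ℝ) ^ 2 = (1 / (bb:ℝ)) ^ 2 + 1 := by field_simp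
  have h1 := Real.add_one_le_exp ((1 / (bb:ℝ)) ^ 2)
  rw [nK, e1]
  calc _ ≤ Real.exp ((1 / (bb:ℝ)) ^ 2) * (Real.exp ((1 / (bb:ℝ)) ^ 2)) ^ 2 := by gcongr
    _ = _ := by rw [← Real.exp_nat_mul, ← Real.exp_add]; congr 1; push_cast; ring

theorem nK_ge {bb : ℕ} (h : 1 ≤ bb) : 1 ≤ nK bb := by
  have hb : (0:ℝ) < bb := by exact_mod_cast h
  have e1 : 1 ≤ (1 + (bb:ℝ) ^ 2) / (bb:ℝ) ^ 2 := by rw [le_div_iff₀ (by positivity)]; linarith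
  have e2 : 1 ≤ Real.exp ((1 / (bb:ℝ)) ^ 2) := Real.one_le_exp (by positivity)
  rw [nK]
  exact one_le_mul_of_one_le_of_one_le e2 (one_le_pow₀ e1)

theorem num_e6 {α : ℝ} (hα : 1 < α) {e : ℝ} {bb : ℕ} (e0 : 0 < e) (c1 : e ^ ((α - 1) / 2) ≤ 1 / 8)
    (c2 : (4 * bb : ℝ) * e ^ ((1 - 1 / α) / 2) ≤ Real.log 2) :
    ∃ η ν : ℝ, 0 ≤ η ∧ 0 ≤ ν ∧ η ^ α ≤ e / 8 ∧ η ^ α ≤ η / 2 ∧ e ≤ ν * (η / 2) ∧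
    (1 + ν) ^ (2 * bb) ≤ 2 := by
  have hα0 : 0 < α := by linarith
  have hs : 0 < (1 - 1 / α) / 2 := by
    have : 1 / α < 1 := by rw [div_lt_one hα0]; exact hα
    linarith
  refine ⟨e ^ ((1 + 1 / α) / 2), 2 * e ^ ((1 - 1 / α) / 2), by positivity, by positivity,
    ?_, ?_, ?_, ?_⟩
  · rw [← Real.rpow_mul e0.le, show (1 + 1 / α) / 2 * α = 1 + (α - 1) / 2 by field_simp; ring,
      Real.rpow_add e0, Real.rpow_one]
    nlinarith
  · rw [← Real.rpow_mul e0.le,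
      show (1 + 1 / α) / 2 * α = (1 + 1 / α) / 2 + ((α - 1) / 2 + (1 - 1 / α) / 2) by
        field_simp; ring, Real.rpow_add e0]
    have i1 : 0 < e ^ ((1 + 1 / α) / 2) := by positivity
    have i2 : e ^ ((α - 1) / 2 + (1 - 1 / α) / 2) ≤ 1 / 8 := by
      rw [Real.rpow_add e0]
      have he1 : e ≤ 1 := by
        by_contra h
        push Not at h
        have : 1 ≤ e ^ ((α - 1) / 2) := Real.one_le_rpow h.le (by linarith)
        linarith
      have : e ^ ((1 - 1 / α) / 2) ≤ 1 := Real.rpow_le_one e0.le he1 hs.le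
      have : 0 < e ^ ((α - 1) / 2) := by positivity
      nlinarith
    nlinarith
  · rw [show 2 * e ^ ((1 - 1 / α) / 2) * (e ^ ((1 + 1 / α) / 2) / 2) =
      e ^ ((1 - 1 / α) / 2) * e ^ ((1 + 1 / α) / 2) by ring, ← Real.rpow_add e0,
      show (1 - 1 / α) / 2 + (1 + 1 / α) / 2 = 1 by ring, Real.rpow_one]
  · have i1 := Real.add_one_le_exp (2 * e ^ ((1 - 1 / α) / 2))
    calc (1 + 2 * e ^ ((1 - 1 / α) / 2)) ^ (2 * bb) ≤
        (Real.exp (2 * e ^ ((1 - 1 / α) / 2))) ^ (2 * bb) := by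
          apply pow_le_pow_left₀ (by positivity); linarith
      _ = Real.exp ((4 * bb : ℝ) * e ^ ((1 - 1 / α) / 2)) := by
        rw [← Real.exp_nat_mul]; congr 1; push_cast; ring
      _ ≤ Real.exp (Real.log 2) := Real.exp_le_exp.2 c2
      _ = 2 := Real.exp_log (by norm_num)

theorem nlo_rpow {α : ℝ} (hα : 1 < α) (bb : ℕ) : nlo α bb ^ α = α ^ (-(bb:ℝ)) := by
  have hα0 : 0 < α := by linarith
  rw [nlo, ← Real.rpow_mul hα0.le, div_mul_cancel₀ _ hα0.ne']

theorem num_89 {α σ : ℝ} (hα : 1 < α) (hσ : σ ∈ Ioo (0:ℝ) 1) {e : ℝ} {bb : ℕ}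
    (h1 : nlo α bb ≤ e) : α ^ (-(bb:ℝ)) * e ^ (α - 1) ≤
      (2 * 2 ^ α * (2 * α) ^ (2 * α - 1 - σ)) * α ^ (-(bb:ℝ) * (σ / α)) * nlam α σ e := by
  have hα0 : 0 < α := by linarith
  have lo0 : 0 < nlo α bb := rpp hα0 _
  have e0 : 0 < e := lo0.trans_le h1
  have e' : (2 * 2 ^ α * (2 * α) ^ (2 * α - 1 - σ)) * α ^ (-(bb:ℝ) * (σ / α)) * nlam α σ e =
      α ^ (-(bb:ℝ) * (σ / α)) * e ^ (2 * α - 1 - σ) := by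
    rw [nlam, Real.div_rpow e0.le (by positivity)]
    have : (0:ℝ) < (2 * α) ^ (2 * α - 1 - σ) := by positivity
    have : (0:ℝ) < 2 ^ α := by positivity
    field_simp
  rw [e', show 2 * α - 1 - σ = (α - σ) + (α - 1) by ring, Real.rpow_add e0, ← mul_assoc]
  apply mlR _ (by positivity)
  have h2 : nlo α bb ^ (α - σ) ≤ e ^ (α - σ) :=
    rlr lo0.le h1 (by linarith [hσ.2])
  have h3 : nlo α bb ^ (α - σ) = α ^ (-(bb:ℝ) * (1 - σ / α)) := by
    rw [nlo, ← Real.rpow_mul hα0.le]; congr 1; field_simp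
  rw [h3] at h2
  calc α ^ (-(bb:ℝ)) = α ^ (-(bb:ℝ) * (σ / α)) * α ^ (-(bb:ℝ) * (1 - σ / α)) := by
        rw [← Real.rpow_add hα0]; congr 1; ring
    _ ≤ _ := mlL h2 (by positivity)

set_option maxHeartbeats 1000000 in
theorem num_exists {α σ β θ : ℝ} (hα : 1 < α) (hσ : σ ∈ Ioo (0:ℝ) 1)
    (hβ : β ∈ Ioo (0 : ℝ) ((σ / α) ^ 2)) (hθ : 1 < θ) :
    ∃ θ' m : ℝ, θ ≤ θ' ∧ ∀ᶠ bb : ℕ in atTop, NumB α σ β θ' m (nK bb) bb := by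
  have hα0 : 0 < α := by linarith
  obtain ⟨m, hm⟩ : ∃ m : ℝ, m = 4 ^ (-2 / (α - 1)) := ⟨_, rfl⟩
  have m0 : 0 < m := by rw [hm]; positivity
  have m1 : m < 1 := by
    rw [hm]; apply Real.rpow_lt_one_of_one_lt_of_neg (by norm_num)
    exact div_neg_of_neg_of_pos (by norm_num) (by linarith)
  have m4 : 4 * m ^ ((α - 1) / 2) ≤ 1 := by
    rw [hm, ← Real.rpow_mul (by norm_num)]
    rw [show -2 / (α - 1) * ((α - 1) / 2) = -1 by
      have : α - 1 ≠ 0 := by linarith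
      field_simp]
    rw [Real.rpow_neg_one]; norm_num
  obtain ⟨C, hC⟩ : ∃ C : ℝ, C = 2 * 2 ^ α * (2 * α) ^ (2 * α - 1 - σ) := ⟨_, rfl⟩
  have C0 : 0 < C := by rw [hC]; positivity
  obtain ⟨θ', hθ'⟩ : ∃ θ' : ℝ, θ' = max θ (16 / m * C) := ⟨_, rfl⟩
  have t1 : θ ≤ θ' := by rw [hθ']; exact le_max_left _ _
  have t2 : 16 / m * C ≤ θ' := by rw [hθ']; exact le_max_right _ _
  have t0 : 1 < θ' := hθ.trans_le t1
  refine ⟨θ', m, t1, ?_⟩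
  have hi_eq : ∀ bb : ℕ, nhi α σ θ' bb = θ' * α ^ (-(bb:ℝ) * (σ / α ^ 2)) := fun bb => by
    rw [nhi]; congr 2; ring
  have hi_t : ∀ s t : ℝ, 0 < t → Tendsto (fun n : ℕ => (n:ℝ) ^ s * nhi α σ θ' n ^ t) atTop (𝓝 0) := by
    intro s t ht
    have h := (num_tend hα s (σ / α ^ 2 * t)
      (mul_pos (div_pos hσ.1 (by positivity)) ht)).const_mul (θ' ^ t)
    rw [mul_zero] at h
    refine h.congr fun n => ?_
    rw [hi_eq, Real.mul_rpow (by linarith) (by positivity), ← Real.rpow_mul hα0.le]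
    rw [show -(n:ℝ) * (σ / α ^ 2) * t = -(n:ℝ) * (σ / α ^ 2 * t) by ring]
    ring
  have hi_lt : ∀ C s t δ : ℝ, 0 < t → 0 < δ →
      ∀ᶠ n : ℕ in atTop, C * ((n:ℝ) ^ s * nhi α σ θ' n ^ t) < δ := by
    intro C s t δ ht hδ
    have := (hi_t s t ht).const_mul C
    rw [mul_zero] at this
    exact this.eventually_lt_const hδ
  have hi_lt' : ∀ C δ : ℝ, 0 < δ → ∀ᶠ n : ℕ in atTop, C * nhi α σ θ' n < δ := by
    intro C δ hδ
    have := hi_lt C 0 1 δ one_pos hδ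
    simpa using this
  have σα : 0 < σ / α := div_pos hσ.1 hα0
  have E5 : ∀ᶠ n : ℕ in atTop, (α ^ (n - 2 + 1))⁻¹ * Real.log (4 / nlo α n) +
      3 * (1 / (n:ℝ)) ^ 2 / (α - 1) < m / 2 * (1 / 8) ^ α := by
    have h1 := ((num_tend0 hα (α * Real.log 4) 1 one_pos).add
      ((num_tend hα 1 1 one_pos).const_mul (Real.log α)))
    have h2 : Tendsto (fun n : ℕ => 3 * (1 / (n:ℝ)) ^ 2 / (α - 1)) atTop (𝓝 0) := by
      have := ((tendsto_one_div_atTop_nhds_zero_nat (𝕜 := ℝ)).pow 2).const_mul (3 / (α - 1))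
      simp only [ne_eq, OfNat.ofNat_ne_zero, not_false_eq_true, zero_pow, mul_zero] at this
      refine this.congr fun n => by ring
    have h3 := h1.add h2
    simp only [mul_zero, add_zero] at h3
    have h4 : ∀ᶠ n : ℕ in atTop, _ < _ := h3.eventually_lt_const
      (show 0 < m / 2 * (1 / 8) ^ α by positivity)
    filter_upwards [h4, eventually_ge_atTop 2] with n hn hn2
    refine lt_of_eq_of_lt ?_ hn
    congr 1
    rw [nlo, Real.log_div (by norm_num) (by positivity), Real.log_rpow hα0,
      show n - 2 + 1 = n - 1 by omega, mul_one, Real.rpow_neg hα0.le, Real.rpow_natCast,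
      Real.rpow_one]
    have : α ^ n = α ^ (n - 1) * α := by rw [← pow_succ]; congr 1; omega
    rw [this]
    field_simp
    ring
  have S : ∀ M : ℝ, ∀ᶠ n : ℕ in atTop, M * n ≤ ((1 + α) / 2) ^ (n - 1) := by
    intro M
    have h := (tendsto_pow_const_div_const_pow_of_one_lt 1
      (show 1 < (1 + α) / 2 by linarith)).const_mul (M * ((1 + α) / 2))
    rw [mul_zero] at h
    filter_upwards [h.eventually_lt_const one_pos, eventually_ge_atTop 1] with n hn hn1
    have h1 : ((1 + α) / 2) ^ n = ((1 + α) / 2) ^ (n - 1) * ((1 + α) / 2) := by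
      rw [← pow_succ]; congr 1; omega
    have h2 : 0 < (1 + α) / 2 := by linarith
    rw [h1, pow_one, mul_div_assoc', div_lt_one (by positivity)] at hn
    have : M * n * ((1 + α) / 2) < ((1 + α) / 2) ^ (n - 1) * ((1 + α) / 2) := by linarith
    exact (lt_of_mul_lt_mul_right this h2.le).le
  have K3 : ∀ᶠ n : ℕ in atTop, 6 * (1 / (n:ℝ)) ^ 2 < Real.log α := by
    have := ((tendsto_one_div_atTop_nhds_zero_nat (𝕜 := ℝ)).pow 2).const_mul 6
    simp only [ne_eq, OfNat.ofNat_ne_zero, not_false_eq_true, zero_pow, mul_zero] at this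
    exact this.eventually_lt_const (Real.log_pos hα)
  have bN : ∀ᶠ n : ℕ in atTop, 2 * α + 1 ≤ (n:ℝ) :=
    tendsto_natCast_atTop_atTop.eventually_ge_atTop _
  obtain ⟨M, hM⟩ : ∃ M : ℝ, m ^ M = α ^ (-4 : ℝ) := by
    refine ⟨Real.log (α ^ (-4:ℝ)) / Real.log m, ?_⟩
    have hl : Real.log m ≠ 0 := (Real.log_neg m0 m1).ne
    rw [Real.rpow_def_of_pos m0, mul_div_cancel₀ _ hl, Real.exp_log (by positivity)]
  filter_upwards [K3, bN, eventually_ge_atTop 18, S 2, S M,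
    (num_tend0 hα (4 * 2 ^ α * m ^ (-2:ℝ)) 1 one_pos).eventually_lt_const one_pos, E5,
    hi_lt' 1 (1/2) (by norm_num), hi_lt' (8 / m) ((m / 4) ^ α) (by positivity),
    hi_lt' (2 / m) (1 / 2) (by norm_num), hi_lt' (16 / m ^ 2) (1 / 2) (by norm_num),
    hi_lt 1 0 ((α - 1) / 2) (1 / 8) (by linarith) (by norm_num),
    hi_lt 4 1 ((1 - 1 / α) / 2) (Real.log 2) (by
      have : 1 / α < 1 := by rw [div_lt_one hα0]; exact hα
      linarith) (Real.log_pos (by norm_num)),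
    hi_lt (8 * (16 / m ^ 2) ^ (α - 1 + σ) * 16 ^ (α - 1)) (4 * (α - 1)) σ 1 hσ.1 one_pos,
    (num_tend0 hα (32 / m * C) (σ / α) σα).eventually_lt_const one_pos,
    (num_tend0 hα (64 * 2 ^ (α - 1) * (8 * (16 / m ^ 2) ^ (α - 1 + σ)) * θ' ^ σ) β
      hβ.1).eventually_lt_const m0]
    with n K3 bN n18 s1 sM s2 e5 e1 e2 e3 e4 e6a e6b e7 e8 e10
  have nr : (18:ℝ) ≤ n := by exact_mod_cast n18
  have K1 := nK_ge (bb := n) (by omega)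
  have Kle := nK_le (bb := n) (by omega)
  have hi0 : 0 ≤ nhi α σ θ' n := by rw [hi_eq]; positivity
  refine ⟨m0, m1, m4, K1, ?_, by omega, ?_, by nlinarith, by linarith, ?_, hi0, ?_⟩
  · calc nK n ^ (2 * (2 * n)) ≤ (Real.exp (3 * (1 / (n:ℝ)) ^ 2)) ^ (2 * (2 * n)) :=
        pow_le_pow_left₀ (by linarith) Kle _
      _ = Real.exp (12 / n) := by
        rw [← Real.exp_nat_mul]; congr 1; push_cast; field_simp; norm_num
      _ ≤ Real.exp (Real.log 2) := by
        apply Real.exp_le_exp.2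
        have := Real.log_two_gt_d9
        rw [div_le_iff₀ (by linarith)]
        nlinarith
      _ = 2 := Real.exp_log (by norm_num)
  · calc nK n ^ 2 ≤ (Real.exp (3 * (1 / (n:ℝ)) ^ 2)) ^ 2 := pow_le_pow_left₀ (by linarith) Kle _
      _ = Real.exp (6 * (1 / (n:ℝ)) ^ 2) := by
        rw [← Real.exp_nat_mul]; congr 1; push_cast; ring
      _ < Real.exp (Real.log α) := Real.exp_lt_exp.2 K3
      _ = α := Real.exp_log hα0
  · have i1 : m ^ (((1 + α) / 2) ^ (n - 1) - 2) ≤ m ^ (M * n - 2) :=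
      Real.rpow_le_rpow_of_exponent_ge m0 m1.le (by linarith)
    have i2 : m ^ (M * n - 2) = m ^ (-2:ℝ) * (α ^ (-(n:ℝ)) * α ^ (-3 * (n:ℝ))) := by
      rw [sub_eq_add_neg, Real.rpow_add m0, Real.rpow_mul m0.le, hM, ← Real.rpow_mul hα0.le,
        ← Real.rpow_add hα0, mul_comm]
      congr 2; ring
    rw [i2] at i1
    have i3 : (0:ℝ) < α ^ (-3 * (n:ℝ)) := by positivity
    rw [mul_one] at s2
    have i4 : (0:ℝ) < 4 * 2 ^ α := by positivity
    have i5 := mlL i1 i4.le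
    have i6 := mul_lt_mul_of_pos_right s2 i3
    linarith
  · intro e h1 h2
    have lo0 : 0 < nlo α n := rpp hα0 _
    have e0 : 0 < e := lo0.trans_le h1
    have hp : ∀ t : ℝ, 0 < t → e ^ t ≤ nhi α σ θ' n ^ t := fun t ht =>
      rlr e0.le h2 ht.le
    have hup : nup α σ m e = 8 * (16 / m ^ 2) ^ (α - 1 + σ) * (e ^ (α - 1) * e ^ σ) := by
      rw [nup, Real.mul_rpow (by positivity) e0.le, Real.rpow_add e0]; ring
    have ea0 : 0 < e ^ (α - 1) := by positivity
    have h89 := num_89 hα hσ h1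
    rw [← hC] at h89
    have lam0 : 0 < nlam α σ e := by rw [nlam]; positivity
    refine ⟨by linarith, ?_, ?_, ?_, ?_, ?_, ?_, ?_, ?_, ?_⟩
    · refine le_trans ?_ e2.le
      rw [mul_div_right_comm]; gcongr
    · refine le_trans ?_ e3.le
      rw [mul_div_right_comm]; gcongr
    · refine le_trans ?_ e4.le
      gcongr
    · refine le_trans ?_ e5.le
      have j1 : Real.log (4 / e) ≤ Real.log (4 / nlo α n) := by
        apply Real.log_le_log (by positivity); gcongr
      have j2 : Real.log (nK n) ≤ 3 * (1 / (n:ℝ)) ^ 2 := by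
        rw [Real.log_le_iff_le_exp (by linarith)]; exact Kle
      have j3 : 0 < α - 1 := by linarith
      gcongr
    · apply num_e6 hα e0
      · have := hp ((α - 1) / 2) (by linarith)
        rw [Real.rpow_zero] at e6a
        linarith
      · have := hp ((1 - 1 / α) / 2) (by
          have : 1 / α < 1 := by rw [div_lt_one hα0]; exact hα
          linarith)
        rw [Real.rpow_one] at e6b
        have := mlL this (by linarith : (0:ℝ) ≤ 4 * n)
        linarith
    · rw [hup, Real.div_rpow e0.le (by positivity), le_div_iff₀ (by positivity),
        Real.mul_rpow (by norm_num) (by positivity), ← Real.rpow_natCast (n:ℝ) 4,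
        ← Real.rpow_mul (by linarith)]
      have j := hp σ hσ.1
      have k0 : (0:ℝ) ≤ 8 * (16 / m ^ 2) ^ (α - 1 + σ) * 16 ^ (α - 1) *
        (n:ℝ) ^ (4 * (α - 1)) := by positivity
      have j2 := mlL j k0
      have j3 : 8 * (16 / m ^ 2) ^ (α - 1 + σ) * 16 ^ (α - 1) *
        (n:ℝ) ^ (4 * (α - 1)) * e ^ σ ≤ 1 := by linarith
      have j4 := mlL j3 ea0.le
      push_cast
      linarith
    · have j0 : 0 < 32 / m := by positivity
      have j1 := mlL h89 j0.le
      have j2 := mul_lt_mul_of_pos_right e8 lam0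
      linarith
    · have j0 : 0 < 16 / m := by positivity
      have j1 := mlL h89 j0.le
      have j2 : nhi α σ θ' n ^ α = θ' ^ α * α ^ (-(n:ℝ) * (σ / α)) := by
        rw [hi_eq, Real.mul_rpow (by linarith) (by positivity), ← Real.rpow_mul hα0.le]
        congr 2; field_simp
      have j3 : θ' ≤ θ' ^ α := by
        have := Real.rpow_le_rpow_of_exponent_le t0.le hα.le
        rwa [Real.rpow_one] at this
      rw [j2]
      have j4 : 0 < α ^ (-(n:ℝ) * (σ / α)) * nlam α σ e := by positivity
      have j5 := mlR (t2.trans j3) j4.le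
      linarith
    · rw [nlo_rpow hα, hup]
      have j1 : e ^ σ ≤ θ' ^ σ * α ^ (-(n:ℝ) * (σ / α) ^ 2) := by
        refine (hp σ hσ.1).trans (le_of_eq ?_)
        rw [hi_eq, Real.mul_rpow (by linarith) (by positivity), ← Real.rpow_mul hα0.le]
        congr 2; ring
      have j2 : α ^ (-((1 + (σ / α) ^ 2 - β) * (n:ℝ))) * α ^ (-(n:ℝ) * β) =
          α ^ (-(n:ℝ)) * α ^ (-(n:ℝ) * (σ / α) ^ 2) := by
        rw [← Real.rpow_add hα0, ← Real.rpow_add hα0]; congr 1; ring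
      have k0 : (0:ℝ) ≤ α ^ (-(n:ℝ)) * (64 * 2 ^ (α - 1) * (8 * (16 / m ^ 2) ^ (α - 1 + σ)) *
        e ^ (α - 1)) := by positivity
      have j3 := mlL j1 k0
      have k1 : (0:ℝ) ≤ α ^ (-((1 + (σ / α) ^ 2 - β) * (n:ℝ))) * e ^ (α - 1) := by positivity
      have j4 := mlL e10.le k1
      have j5 : α ^ (-((1 + (σ / α) ^ 2 - β) * (n:ℝ))) * e ^ (α - 1) *
          (64 * 2 ^ (α - 1) * (8 * (16 / m ^ 2) ^ (α - 1 + σ)) * θ' ^ σ * α ^ (-(n:ℝ) * β)) =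
          (64 * 2 ^ (α - 1) * (8 * (16 / m ^ 2) ^ (α - 1 + σ)) * θ' ^ σ) * e ^ (α - 1) *
          (α ^ (-(n:ℝ)) * α ^ (-(n:ℝ) * (σ / α) ^ 2)) := by
        rw [← j2]; ring
      rw [j5] at j4
      linarith

structure LV {α : ℝ} (σ β θ m : ℝ) (bb : ℕ) (g g1 : LorenzMap α) (a b : ℕ) (p q : ℝ) : Prop where
  R : RD g g1 a b p q
  lev : Lev (Real.exp ((1 / (bb:ℝ)) ^ 2)) ((bb:ℝ) ^ 2) g
  H : Geo (nK bb) g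
  out : LevOut g b p q m bb σ
  lo : nlo α bb ≤ 1 - g.c
  hi : 1 - g.c ≤ nhi α σ θ bb
  hm : m ≤ g.Z g.cv0
  om : memOmega α σ β bb (a, b)

theorem chain_all {α σ β θ θ' m : ℝ} {bb : ℕ} (hα : 1 < α) (hσ : σ ∈ Ioo (0:ℝ) 1)
    (hβ : β ∈ Ioo (0 : ℝ) ((σ / α) ^ 2)) (hθ : θ ≤ θ') (N : NumB α σ β θ' m (nK bb) bb)
    {f : LorenzMap α} (h3 : f.IsCk 3) (hS : f.NegSchwarzian) (hK : memK α σ θ bb f)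
    {ω : ℕ → ℕ × ℕ} (hω : ∀ n, memOmega α σ β bb (ω n)) (hI : InfRenormType α f ω) :
    ∃ G : ℕ → LorenzMap α, ∃ p q : ℕ → ℝ, G 0 = f ∧
      ∀ n, LV σ β θ' m bb (G n) (G (n + 1)) (ω n).1 (ω n).2 (p n) (q n) := by
  obtain ⟨G, p, q, hG, hR⟩ := exists_chain hα hI
  refine ⟨G, p, q, hG, ?_⟩
  have hα0 : 0 < α := by linarith
  have bb3 := N.bb3
  have bbr : (3:ℝ) ≤ bb := by exact_mod_cast bb3
  have hτ : (0:ℝ) < (bb:ℝ) ^ 2 := by positivity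
  have lo0 : 0 < nlo α bb := rpp hα0 _
  have hb : ∀ n, bb ≤ (ω n).2 := fun n => by exact_mod_cast (hω n).2.2.2.2.1
  have lohi : ∀ n, 1 - (G n).c ≤ nhi α σ θ' bb → nlo α bb ≤ 1 - (G n).c → 1 / 2 ≤ (G n).c := by
    intro n h1 h2
    linarith [(N.he _ h2 h1).e1]
  have hiS : nlo α bb ≤ nhi α σ θ' bb → nhi α σ θ' bb ≤ 1 / 2 := fun h => (N.he _ h le_rfl).e1
  have key : ∀ n, Lev (Real.exp ((1 / (bb:ℝ)) ^ 2)) ((bb:ℝ) ^ 2) (G n) ∧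
      nlo α bb ≤ 1 - (G n).c ∧ 1 - (G n).c ≤ nhi α σ θ' bb ∧ m ≤ (G n).Z (G n).cv0 := by
    intro n
    induction n with
    | zero =>
      obtain ⟨-, k1, k2, k3, k4⟩ := hK
      have nt : f.IsNontrivial := by rw [← hG]; exact (hR 0).nt
      have L : Lev (Real.exp ((1 / (bb:ℝ)) ^ 2)) ((bb:ℝ) ^ 2) f :=
        Lev.base hα hτ nt h3 hS k3 k4
      have k2' : 1 - f.c ≤ nhi α σ θ' bb := by
        refine k2.trans ?_
        rw [nhi]; gcongr
      have R0 := hR 0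
      rw [hG] at R0 ⊢
      have hlh := lohi 0
      rw [hG] at hlh
      refine ⟨L, k1, k2', ?_⟩
      have hz0 : 0 < f.Z f.cv0 := LorenzMap.Z_pos nt.1
      have hz1 : f.Z f.cv0 ≤ 1 := LorenzMap.Z_le_one f.cv0_nonneg
      refine S1 hα R0 (L.geo hα hτ nt) N.K1 N.K2 (hlh k2' k1) N.m0 N.m1 N.m4
        (by omega) (hb 0) N.s1 N.s2 ?_
      have i1 : nlo α bb ^ α ≤ (1 - f.c) ^ α := rlr lo0.le k1 hα0.le
      rw [nlo_rpow hα] at i1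
      have i2 : α ^ (-3 * (bb:ℝ)) ≤ α ^ (-(bb:ℝ)) :=
        Real.rpow_le_rpow_of_exponent_le hα.le (by linarith)
      have i3 : 0 < α ^ (-3 * (bb:ℝ)) := by positivity
      nlinarith
    | succ n ih =>
      obtain ⟨L, k1, k2, k4⟩ := ih
      have R0 := hR n
      have nt := R0.nt
      obtain ⟨O, l1, l2, l3⟩ := level hα hσ hβ N R0 (L.geo hα hτ nt) (hω n) k1 k2 k4
      have hc := lohi n k2 k1
      have hε : 0 < 1 - (G n).c := by linarith [(G n).hc.2]
      have N0 := N.he _ k1 k2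
      have o1 := O.o1
      have hC := R0.hC
      have hs : (bb:ℝ) ^ 2 * (q n - p n) ≤ (1 - (G n).c) / 4 := by
        have j1 : (bb:ℝ) ^ 2 ≤ (bb:ℝ) ^ 4 := pow_le_pow_right₀ (by linarith) (by norm_num)
        have := mlR j1 hC.le
        linarith
      have m0 := N.m0
      have m1 := N.m1
      have em : 1 - (G n).c ≤ m := by
        have := N0.e4
        rw [div_mul_eq_mul_div, div_le_iff₀ (by positivity)] at this
        nlinarith
      have o2 := O.o2
      have o4 := O.o4
      have o5 := O.o5
      have o7 := O.o7
      have L1 : Lev (Real.exp ((1 / (bb:ℝ)) ^ 2)) ((bb:ℝ) ^ 2) (G (n + 1)) :=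
        L.step hα hτ R0 (by linarith) (by linarith) (by linarith) (by linarith)
      have m2 : m ≤ (G (n + 1)).Z (G (n + 1)).cv0 := by
        refine S1 hα (hR (n + 1)) (L1.geo hα hτ R0.nt1) N.K1 N.K2 ?_ N.m0 N.m1 N.m4
          (by omega) (hb (n + 1)) N.s1 N.s2 l2
        have := hiS (k1.trans k2)
        linarith
      exact ⟨L1, l3 m2, l1, m2⟩
  intro n
  obtain ⟨L, k1, k2, k4⟩ := key n
  exact ⟨hR n, L, L.geo hα hτ (hR n).nt,
    (level hα hσ hβ N (hR n) (L.geo hα hτ (hR n).nt) (hω n) k1 k2 k4).1, k1, k2, k4, hω n⟩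

structure Frac (O : ℕ → Bool → Set ℝ) (N : ℕ) (ρ κ : ℝ) : Prop where
  sub : ∀ n s, O n s ⊆ Icc 0 1
  ne : ∀ n s, (O n s).Nonempty
  N1 : 1 ≤ N
  ρ0 : 0 < ρ
  ρ1 : ρ < 1
  κ0 : 0 < κ
  κ1 : κ < 1
  ρN : ρ * (N : ℝ) ^ 2 ≤ 1
  cov : ∀ n s, ∃ (F : ℕ → ℝ → ℝ) (S : ℕ → Bool),
    (∀ i < N, ∀ x ∈ O (n + 1) (S i), F i x ∈ O n s) ∧
    (∀ i < N, ∀ x ∈ O (n + 1) (S i), ∀ y ∈ O (n + 1) (S i), |F i x - F i y| ≤ ρ * |x - y|) ∧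
    (∀ i < N, InjOn (F i) (O (n + 1) (S i))) ∧
    ∀ x ∈ O n s, ∃ i < N, ∃ y ∈ O (n + 1) (S i), F i y = x
  sep : ∀ n s, ∃ M : Bool → ℝ → ℝ,
    (∀ d, ∀ x ∈ O (n + 1) d, M d x ∈ O n s) ∧
    (∀ d, ∀ x ∈ O (n + 1) d, ∀ y ∈ O (n + 1) d, |M d x - M d y| ≤ ρ * |x - y|) ∧
    (∀ d, ∀ x ∈ O (n + 1) d, ∀ y ∈ O (n + 1) d, κ * |x - y| ≤ |M d x - M d y|) ∧
    ∀ x ∈ O (n + 1) false, ∀ y ∈ O (n + 1) true, κ ≤ |M false x - M true y|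

namespace Frac
variable {O : ℕ → Bool → Set ℝ} {N : ℕ} {ρ κ : ℝ}

theorem dist_le (h : Frac O N ρ κ) {n s x y} (hx : x ∈ O n s) (hy : y ∈ O n s) : |x - y| ≤ 1 := by
  have h1 := h.sub n s hx
  have h2 := h.sub n s hy
  rw [abs_le]; constructor <;> linarith [h1.1, h1.2, h2.1, h2.2]

theorem cover (h : Frac O N ρ κ) (k : ℕ) : ∀ n s, ∃ P : Finset ℝ, P.card ≤ N ^ k ∧ (∀ c ∈ P, c ∈ O n s) ∧
    ∀ x ∈ O n s, ∃ c ∈ P, |x - c| ≤ ρ ^ k := by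
  induction k with
  | zero =>
    intro n s
    obtain ⟨c, hc⟩ := h.ne n s
    exact ⟨{c}, by simp, by simpa using hc, fun x hx => ⟨c, by simp, by simpa using h.dist_le hx hc⟩⟩
  | succ k ih =>
    intro n s
    obtain ⟨F, S, h1, h2, -, h4⟩ := h.cov n s
    choose P hP1 hP2 hP3 using fun t => ih (n + 1) t
    refine ⟨(Finset.range N).biUnion fun i => (P (S i)).image (F i), ?_, ?_, ?_⟩
    · refine Finset.card_biUnion_le.trans ?_
      calc ∑ i ∈ Finset.range N, ((P (S i)).image (F i)).card ≤ ∑ i ∈ Finset.range N, N ^ k :=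
            Finset.sum_le_sum fun i _ => Finset.card_image_le.trans (hP1 _)
        _ = N ^ (k + 1) := by simp [pow_succ']
    · intro c hc
      simp only [Finset.mem_biUnion, Finset.mem_range, Finset.mem_image] at hc
      obtain ⟨i, hi, y, hy, rfl⟩ := hc
      exact h1 i hi y (hP2 _ _ hy)
    · intro x hx
      obtain ⟨i, hi, y, hy, rfl⟩ := h4 x hx
      obtain ⟨c, hc, hc'⟩ := hP3 _ y hy
      refine ⟨F i c, ?_, ?_⟩
      · simp only [Finset.mem_biUnion, Finset.mem_range, Finset.mem_image]
        exact ⟨i, hi, c, hc, rfl⟩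
      · refine (h2 i hi y hy c (hP2 _ _ hc)).trans ?_
        rw [pow_succ']
        exact mlL hc' h.ρ0.le

theorem dim_le (h : Frac O N ρ κ) (n : ℕ) (s : Bool) : dimH (closure (O n s)) ≤ (1 / 2 : NNReal) := by
  choose P hP1 hP2 hP3 using fun k => h.cover k n s
  have ρ0 := h.ρ0
  have key : μH[((1 / 2 : NNReal) : ℝ)] (closure (O n s)) ≤ ENNReal.ofReal (√2) := by
    have hr : Tendsto (fun k : ℕ => ENNReal.ofReal (2 * ρ ^ k)) atTop (𝓝 0) := by
      have h1 := (tendsto_pow_atTop_nhds_zero_of_lt_one ρ0.le h.ρ1).const_mul 2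
      rw [mul_zero] at h1
      simpa using ENNReal.tendsto_ofReal h1
    have hd : ∀ (k : ℕ) (i : {x // x ∈ P k}), Metric.ediam (Metric.closedBall (i : ℝ) (ρ ^ k)) ≤
        ENNReal.ofReal (2 * ρ ^ k) := by
      intro k i
      refine Metric.ediam_le_of_forall_dist_le fun x hx y hy => ?_
      rw [Metric.mem_closedBall] at hx hy
      linarith [dist_triangle_right x y (i : ℝ)]
    refine (Measure.hausdorffMeasure_le_liminf_sum (ι := fun k => {x // x ∈ P k}) _ _ _ hr
      (fun k i => Metric.closedBall (i : ℝ) (ρ ^ k)) (Eventually.of_forall hd)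
      (Eventually.of_forall fun k => ?_)).trans ?_
    · refine closure_minimal (fun x hx => ?_) ?_
      · obtain ⟨c, hc, hc'⟩ := hP3 k x hx
        exact mem_iUnion.2 ⟨⟨c, hc⟩, by simpa [Real.dist_eq] using hc'⟩
      · exact isClosed_iUnion_of_finite fun i => Metric.isClosed_closedBall
    · refine (liminf_le_liminf (v := fun _ => ENNReal.ofReal (√2))
        (Eventually.of_forall fun k => ?_)).trans (by simp)
      have h1 : ∀ i ∈ (Finset.univ : Finset {x // x ∈ P k}),
          Metric.ediam (Metric.closedBall (i : ℝ) (ρ ^ k)) ^ ((1 / 2 : NNReal) : ℝ) ≤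
          ENNReal.ofReal (√(2 * ρ ^ k)) := by
        intro i _
        refine (ENNReal.rpow_le_rpow (hd k i) (by positivity)).trans ?_
        rw [ENNReal.ofReal_rpow_of_nonneg (by positivity) (by positivity), Real.sqrt_eq_rpow]
        simp
      refine (Finset.sum_le_sum h1).trans ?_
      rw [Finset.sum_const, nsmul_eq_mul, Finset.card_univ, Fintype.card_coe,
        ← ENNReal.ofReal_natCast, ← ENNReal.ofReal_mul (by positivity)]
      refine ENNReal.ofReal_le_ofReal ?_
      have h2 : ((P k).card : ℝ) ≤ (N : ℝ) ^ k := by exact_mod_cast hP1 k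
      refine (mlR h2 (by positivity)).trans ?_
      refine Real.le_sqrt_of_sq_le ?_
      rw [mul_pow, Real.sq_sqrt (by positivity)]
      have h3 : (ρ * (N : ℝ) ^ 2) ^ k ≤ 1 := pow_le_one₀ (by positivity) h.ρN
      calc ((N : ℝ) ^ k) ^ 2 * (2 * ρ ^ k) = 2 * (ρ * (N : ℝ) ^ 2) ^ k := by
            rw [mul_pow, ← pow_mul, ← pow_mul]; ring
        _ ≤ 2 := by linarith
  exact dimH_le_of_hausdorffMeasure_ne_top (ne_top_of_le_ne_top ENNReal.ofReal_ne_top key)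

theorem near (h : Frac O N ρ κ) (k : ℕ) : ∀ n s, ∀ x ∈ O n s, ∃ y ∈ O n s, y ≠ x ∧ |y - x| ≤ ρ ^ k := by
  induction k with
  | zero =>
    intro n s x hx
    obtain ⟨M, h1, -, -, h4⟩ := h.sep n s
    obtain ⟨u, hu⟩ := h.ne (n + 1) false
    obtain ⟨v, hv⟩ := h.ne (n + 1) true
    have hne : M false u ≠ M true v := fun he => by
      have := h4 u hu v hv
      rw [he, sub_self, abs_zero] at this
      linarith [h.κ0]
    by_cases hx' : M false u = x
    · exact ⟨_, h1 true v hv, fun he => hne (hx'.trans he.symm), by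
        simpa using h.dist_le (h1 true v hv) hx⟩
    · exact ⟨_, h1 false u hu, hx', by simpa using h.dist_le (h1 false u hu) hx⟩
  | succ k ih =>
    intro n s x hx
    obtain ⟨F, S, h1, h2, h3, h4⟩ := h.cov n s
    obtain ⟨i, hi, y, hy, rfl⟩ := h4 x hx
    obtain ⟨z, hz, hne, hd⟩ := ih _ _ y hy
    refine ⟨F i z, h1 i hi z hz, fun he => hne (h3 i hi hz hy he), (h2 i hi z hz y hy).trans ?_⟩
    rw [pow_succ']
    exact mlL hd h.ρ0.le

theorem preperf (h : Frac O N ρ κ) (n : ℕ) (s : Bool) : Preperfect (O n s) := by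
  rw [preperfect_iff_nhds]
  intro x hx U hU
  obtain ⟨e, he, hU⟩ := Metric.mem_nhds_iff.1 hU
  obtain ⟨k, hk⟩ := exists_pow_lt_of_lt_one he h.ρ1
  obtain ⟨y, hy, hne, hd⟩ := h.near k n s x hx
  exact ⟨y, ⟨hU (by rw [Metric.mem_ball, Real.dist_eq]; linarith), hy⟩, hne⟩

theorem dim_pos (h : Frac O N ρ κ) (n : ℕ) (s : Bool) : 0 < dimH (closure (O n s)) := by
  choose M hM1 hM2 hM3 hM4 using h.sep
  choose z hz using h.ne
  have ρ0 := h.ρ0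
  have κ0 := h.κ0
  let X : ℕ → ℕ → Bool → (ℕ → Bool) → ℝ := fun k => Nat.rec (fun n s _ => z n s)
    (fun _ Y n s w => M n s (w 0) (Y (n + 1) (w 0) (fun i => w (i + 1)))) k
  have X0 : ∀ n s w, X 0 n s w = z n s := fun _ _ _ => rfl
  have XS : ∀ k n s w, X (k + 1) n s w =
    M n s (w 0) (X k (n + 1) (w 0) (fun i => w (i + 1))) := fun _ _ _ _ => rfl
  have Xm : ∀ k n s w, X k n s w ∈ O n s := by
    intro k
    induction k with
    | zero => intro n s w; exact hz n s
    | succ k ih => intro n s w; rw [XS]; exact hM1 _ _ _ _ (ih _ _ _)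
  have Xd : ∀ k n s w, |X k n s w - X (k + 1) n s w| ≤ ρ ^ k := by
    intro k
    induction k with
    | zero => intro n s w; simpa using h.dist_le (Xm 0 n s w) (Xm 1 n s w)
    | succ k ih =>
      intro n s w
      rw [XS, XS (k + 1), pow_succ']
      refine (hM2 n s (w 0) _ (Xm k (n + 1) (w 0) fun i => w (i + 1)) _
        (Xm (k + 1) (n + 1) (w 0) fun i => w (i + 1))).trans ?_
      exact mlL (ih (n + 1) (w 0) _) ρ0.le
  have Xsep : ∀ k j n s (w w' : ℕ → Bool), (∀ i < k, w i = w' i) → w k ≠ w' k →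
      κ ^ (k + 1) ≤ |X (k + 1 + j) n s w - X (k + 1 + j) n s w'| := by
    intro k j
    induction k with
    | zero =>
      intro n s w w' _ hne
      rw [show 0 + 1 + j = j + 1 by ring, XS, XS, zero_add, pow_one]
      cases h0 : w 0 <;> cases h0' : w' 0
      · exact absurd (h0.trans h0'.symm) hne
      · exact hM4 _ _ _ (Xm _ _ _ _) _ (Xm _ _ _ _)
      · rw [abs_sub_comm]; exact hM4 _ _ _ (Xm _ _ _ _) _ (Xm _ _ _ _)
      · exact absurd (h0.trans h0'.symm) hne
    | succ k ih =>
      intro n s w w' he hne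
      rw [show k + 1 + 1 + j = k + 1 + j + 1 by ring, XS, XS, ← he 0 (by omega), pow_succ']
      refine le_trans (mlL ?_ κ0.le)
        (hM3 _ _ _ _ (Xm _ _ _ _) _ (Xm _ _ _ _))
      exact ih _ _ _ _ (fun i hi => he _ (by omega)) hne
  have Xc : ∀ w, ∃ l, Tendsto (fun k => X k n s w) atTop (𝓝 l) := fun w =>
    cauchySeq_tendsto_of_complete (cauchySeq_of_le_geometric ρ 1 h.ρ1 fun k => by
      rw [Real.dist_eq, one_mul]; exact Xd k n s w)
  choose π hπ using Xc
  have hπm : ∀ w, π w ∈ closure (O n s) := fun w =>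
    mem_closure_of_tendsto (hπ w) (Eventually.of_forall fun k => Xm k n s w)
  have hπs : ∀ k (w w' : ℕ → Bool), (∀ i < k, w i = w' i) → w k ≠ w' k →
      κ ^ (k + 1) ≤ |π w - π w'| := by
    intro k w w' he hne
    refine ge_of_tendsto ((hπ w).sub (hπ w')).abs ?_
    filter_upwards [eventually_ge_atTop (k + 1)] with j hj
    obtain ⟨i, rfl⟩ := Nat.exists_eq_add_of_le hj
    exact Xsep k i n s w w' he hne
  have hfirst : ∀ w w' : ℕ → Bool, w ≠ w' → ∃ k, (∀ i < k, w i = w' i) ∧ w k ≠ w' k := by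
    intro w w' hne
    have hex : ∃ k, w k ≠ w' k := Function.ne_iff.1 hne
    exact ⟨Nat.find hex, fun i hi => not_not.1 (Nat.find_min hex hi), Nat.find_spec hex⟩
  have hinj : Function.Injective π := by
    intro w w' he
    by_contra hne
    obtain ⟨k, h1, h2⟩ := hfirst w w' hne
    have := hπs k w w' h1 h2
    rw [he, sub_self, abs_zero] at this
    have : 0 < κ ^ (k + 1) := by positivity
    linarith
  let D : (ℕ → Bool) → ℝ := fun w => Real.ofDigits (b := 2) fun i => finTwoEquiv.symm (w i)
  let Ψ : ℝ → ℝ := fun x => D (Function.invFun π x)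
  have hΨ : ∀ w, Ψ (π w) = D w := fun w => by
    show D (Function.invFun π (π w)) = D w
    rw [Function.leftInverse_invFun hinj w]
  have hlk : Real.log κ < 0 := Real.log_neg κ0 h.κ1
  have hl2 : 0 < Real.log 2 := Real.log_pos (by norm_num)
  obtain ⟨r, hr0, hr⟩ : ∃ r : ℝ, 0 < r ∧ κ ^ r = 1 / 2 := by
    refine ⟨-Real.log 2 / Real.log κ, div_pos_of_neg_of_neg (by linarith) hlk, ?_⟩
    rw [Real.rpow_def_of_pos κ0, mul_div_cancel₀ _ hlk.ne, Real.exp_neg, Real.exp_log (by norm_num)]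
    norm_num
  lift r to NNReal using hr0.le
  have hH : HolderOnWith 2 r Ψ (range π) := by
    rintro _ ⟨w, rfl⟩ _ ⟨w', rfl⟩
    rw [hΨ, hΨ]
    by_cases hne : w = w'
    · subst hne; simp
    obtain ⟨k, h1, h2⟩ := hfirst w w' hne
    have h3 := hπs k w w' h1 h2
    have h4 : |D w - D w'| ≤ (((2:ℕ) : ℝ) ^ k)⁻¹ :=
      Real.abs_ofDigits_sub_ofDigits_le fun i hi => by rw [h1 i hi]
    have h5 : |D w - D w'| ≤ 2 * |π w - π w'| ^ (r : ℝ) := by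
      have h6 := rlr (by positivity) h3 hr0.le
      rw [← Real.rpow_natCast, ← Real.rpow_mul κ0.le, mul_comm, Real.rpow_mul κ0.le, hr,
        Real.rpow_natCast] at h6
      refine h4.trans (le_trans (le_of_eq ?_) (mlL h6 zero_le_two))
      rw [pow_succ, one_div, inv_pow]; push_cast; ring
    rw [edist_dist, edist_dist, Real.dist_eq, Real.dist_eq,
      ENNReal.ofReal_rpow_of_nonneg (abs_nonneg _) hr0.le]
    refine (ENNReal.ofReal_le_ofReal h5).trans ?_
    rw [ENNReal.ofReal_mul (by norm_num)]
    simp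
  have h1 := hH.dimH_image_le (by exact_mod_cast hr0)
  have h2 : Icc (0:ℝ) 1 ⊆ Ψ '' range π := by
    intro y hy
    obtain ⟨dg, -, hdg⟩ := Real.ofDigits_SurjOn (b := 2) (by norm_num) hy
    refine ⟨π (fun i => finTwoEquiv (dg i)), ⟨_, rfl⟩, ?_⟩
    rw [hΨ, ← hdg]
    show Real.ofDigits _ = _
    simp
  have h3 : (1 : ENNReal) ≤ dimH (range π) / r := by
    refine le_trans ?_ ((dimH_mono h2).trans h1)
    rw [Real.dimH_of_nonempty_interior (by simp)]
    simp
  have h4 : dimH (range π) ≤ dimH (closure (O n s)) :=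
    dimH_mono (range_subset_iff.2 hπm)
  refine lt_of_lt_of_le (pos_iff_ne_zero.2 fun h0 => ?_) h4
  rw [h0, ENNReal.zero_div] at h3
  exact absurd h3 (by simp)

theorem main (h : Frac O N ρ κ) {Λ : Set ℝ} (hΛ : Λ = closure (O 0 true ∪ O 0 false)) :
    (Λ.Nonempty ∧ IsCompact Λ ∧ Perfect Λ ∧ IsTotallyDisconnected Λ) ∧
      volume Λ = 0 ∧ (0 < dimH Λ ∧ dimH Λ < 1) := by
  have hcl : Λ = closure (O 0 true) ∪ closure (O 0 false) := by rw [hΛ, closure_union]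
  have hd : dimH Λ < 1 := by
    rw [hcl, dimH_union]
    refine (max_le (h.dim_le _ _) (h.dim_le _ _)).trans_lt ?_
    rw [← ENNReal.coe_one, ENNReal.coe_lt_coe]
    exact NNReal.half_lt_self one_ne_zero
  have hsub : Λ ⊆ Icc 0 1 := by
    rw [hΛ]
    exact closure_minimal (union_subset (h.sub _ _) (h.sub _ _)) isClosed_Icc
  refine ⟨⟨?_, ?_, ?_, ?_⟩, ?_, ?_, hd⟩
  · rw [hΛ]; exact ((h.ne 0 true).mono subset_union_left).closure
  · exact isCompact_Icc.of_isClosed_subset (by rw [hΛ]; exact isClosed_closure) hsub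
  · rw [hΛ]
    refine Preperfect.perfect_closure ?_
    rw [preperfect_iff_nhds]
    intro x hx U hU
    rcases hx with hx | hx
    · obtain ⟨y, hy, hne⟩ := preperfect_iff_nhds.1 (h.preperf 0 true) x hx U hU
      exact ⟨y, ⟨hy.1, Or.inl hy.2⟩, hne⟩
    · obtain ⟨y, hy, hne⟩ := preperfect_iff_nhds.1 (h.preperf 0 false) x hx U hU
      exact ⟨y, ⟨hy.1, Or.inr hy.2⟩, hne⟩
  · intro t ht hpc x hx y hy
    by_contra hne
    have : ∀ u ∈ t, ∀ v ∈ t, ¬ u < v := by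
      intro u hu v hv huv
      have h1 : Icc u v ⊆ Λ := (hpc.ordConnected.out hu hv).trans ht
      have h2 := dimH_mono h1
      rw [Real.dimH_of_nonempty_interior (by simpa using huv)] at h2
      simp only [Module.finrank_self, Nat.cast_one] at h2
      exact absurd hd (not_lt.2 h2)
    rcases lt_or_gt_of_ne hne with h1 | h1
    · exact this x hx y hy h1
    · exact this y hy x hx h1
  · have := hausdorffMeasure_of_dimH_lt (d := 1) hd
    rw [NNReal.coe_one, hausdorffMeasure_real] at this
    exact this
  · rw [hcl, dimH_union]
    exact lt_of_lt_of_le (h.dim_pos 0 true) (le_max_left _ _)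
end Frac

inductive Orb {α : ℝ} (g : LorenzMap α) (St : Bool → ℝ → Prop) : Bool → ℝ → Prop
  | start {s : Bool} {x : ℝ} (h : St s x) : Orb g St s x
  | stepL {s : Bool} {x : ℝ} (h : Orb g St s x) (hx : x < g.c) : Orb g St false (g.gl x)
  | stepR {s : Bool} {x : ℝ} (h : Orb g St s x) (hx : g.c ≤ x) : Orb g St true (g.gr x)

def CS {α : ℝ} (g : LorenzMap α) (s : Bool) (x : ℝ) : Prop := x = if s then g.cv0 else g.cv1

def PT {α : ℝ} (g : LorenzMap α) (y : ℝ) (s : Bool) (x : ℝ) : Prop :=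
  (s = false ∧ y < g.c ∧ x = g.gl y) ∨ (s = true ∧ g.c ≤ y ∧ x = g.gr y)

def Form {α : ℝ} (g : LorenzMap α) (a b : ℕ) (p q : ℝ) (O : Bool → ℝ → Prop) (s : Bool) (x : ℝ) :
    Prop :=
  (∃ j y, j ≤ b ∧ (s = decide (j = b)) ∧ O true y ∧ x = g.ell^[j] (p + (q - p) * y)) ∨
  (∃ i y, i ≤ a ∧ (s = !decide (i = a)) ∧ O false y ∧ x = g.rr^[i] (p + (q - p) * y))

section orb
variable {α : ℝ} {g g1 : LorenzMap α} {a b : ℕ} {p q : ℝ}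
open LorenzMap

theorem Orb.mem (hα : 1 < α) (nt : g.IsNontrivial) {St : Bool → ℝ → Prop}
    (hS : ∀ s x, St s x → x ∈ Icc (0:ℝ) 1) {s x} (h : Orb g St s x) : x ∈ Icc (0:ℝ) 1 := by
  induction h with
  | start h => exact hS _ _ h
  | stepL h hx ih =>
    have := (g.gl_br hα nt).maps ⟨ih.1, hx.le⟩
    exact ⟨this.1, this.2.trans g.cv1_le_one⟩
  | stepR h hx ih =>
    have := (g.gr_br hα nt).maps ⟨hx, ih.2⟩
    exact ⟨g.cv0_nonneg.trans this.1, this.2⟩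

theorem CS.mem {s x} (h : CS g s x) (nt : g.IsNontrivial) : x ∈ Icc (0:ℝ) 1 := by
  rw [CS] at h
  subst h
  have := g.hc
  have := g.cv0_nonneg
  have := g.cv1_le_one
  have := nt.1
  have := nt.2
  split_ifs
  · exact ⟨by linarith, by linarith [g.hc.2]⟩
  · exact ⟨by linarith [g.hc.1], by linarith⟩

theorem PT.mem (hα : 1 < α) (nt : g.IsNontrivial) {y s x} (hy : y ∈ Icc (0:ℝ) 1)
    (h : PT g y s x) : x ∈ Icc (0:ℝ) 1 := by
  rcases h with ⟨-, h1, rfl⟩ | ⟨-, h1, rfl⟩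
  · have := (g.gl_br hα nt).maps ⟨hy.1, h1.le⟩
    exact ⟨this.1, this.2.trans g.cv1_le_one⟩
  · have := (g.gr_br hα nt).maps ⟨h1, hy.2⟩
    exact ⟨g.cv0_nonneg.trans this.1, this.2⟩

theorem RD.h_mem (R : RD g g1 a b p q) {y : ℝ} (hy : y ∈ Icc (0:ℝ) 1) :
    p + (q - p) * y ∈ Icc p q := by
  have := R.hC
  exact ⟨by nlinarith [hy.1], by nlinarith [hy.2]⟩

theorem RD.rr_c (hα : 1 < α) (R : RD g g1 a b p q) (i : ℕ) {x : ℝ} (hx : x ∈ Icc p q) :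
    g.rr^[i + 1] x ∈ Icc g.c 1 ∧ g.gr (g.rr^[i + 1] x) = g.rr^[i] x := by
  have h := iterate_maps (S := Icc g.cv0 1) (g.rr_maps hα R.nt) i (x := x)
    ⟨R.cp.le.trans hx.1, hx.2.trans R.q1.le⟩
  rw [Function.iterate_succ_apply']
  obtain ⟨h1, h2, h3⟩ := g.rr_mem hα R.nt h.1 h.2
  exact ⟨⟨h1, h2⟩, h3⟩

theorem RD.ell_c (hα : 1 < α) (R : RD g g1 a b p q) (i : ℕ) {x : ℝ} (hx : x ∈ Icc p q) :
    g.ell^[i + 1] x ∈ Ico 0 g.c ∧ g.gl (g.ell^[i + 1] x) = g.ell^[i] x := by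
  have hx0 := R.p0.le.trans hx.1
  have hx1 := hx.2.trans_lt R.qc
  have h0 := ell_iter_mem hα R.nt i hx0 hx1
  have h := iterate_maps (S := Icc 0 g.cv1) (g.ell_maps hα R.nt) i (x := x) ⟨hx0, hx1.le⟩
  refine ⟨h0, ?_⟩
  rw [Function.iterate_succ_apply']
  exact (g.ell_mem hα R.nt h.1 h.2).2.2

theorem Orb.form (hα : 1 < α) (R : RD g g1 a b p q) {St St1 : Bool → ℝ → Prop}
    (hS1 : ∀ s x, St1 s x → x ∈ Icc (0:ℝ) 1)
    (hS : ∀ s x, St s x → Form g a b p q (Orb g1 St1) s x) {s x} (h : Orb g St s x) :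
    Form g a b p q (Orb g1 St1) s x := by
  have hmem : ∀ s y, Orb g1 St1 s y → y ∈ Icc (0:ℝ) 1 := fun s y hy => hy.mem hα R.nt1 hS1
  have hC := R.hC
  have hcc := R.hcc
  have hL : ∀ s y, Orb g1 St1 s y → p + (q - p) * y < g.c →
      Form g a b p q (Orb g1 St1) false (g.gl (p + (q - p) * y)) := by
    intro s y hy hlt
    have hy1 : y < g1.c := by nlinarith
    refine Or.inr ⟨a, g1.gl y, le_rfl, by simp, hy.stepL hy1, R.conjL y ⟨(hmem _ _ hy).1, hy1.le⟩⟩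
  have hR : ∀ s y, Orb g1 St1 s y → g.c ≤ p + (q - p) * y →
      Form g a b p q (Orb g1 St1) true (g.gr (p + (q - p) * y)) := by
    intro s y hy hlt
    have hy1 : g1.c ≤ y := by nlinarith
    refine Or.inl ⟨b, g1.gr y, le_rfl, by simp, hy.stepR hy1, R.conjR y ⟨hy1, (hmem _ _ hy).2⟩⟩
  induction h with
  | start h => exact hS _ _ h
  | stepL h hx ih =>
    rcases ih with ⟨j, y, hj, -, hy, rfl⟩ | ⟨i, y, hi, -, hy, rfl⟩
    · cases j with
      | zero => exact hL _ _ hy hx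
      | succ j =>
        refine Or.inl ⟨j, y, by omega, ?_, hy, (R.ell_c hα j (R.h_mem (hmem _ _ hy))).2⟩
        simp; omega
    · cases i with
      | zero => exact hL _ _ hy hx
      | succ i => exact absurd hx (not_lt.2 (R.rr_c hα i (R.h_mem (hmem _ _ hy))).1.1)
  | stepR h hx ih =>
    rcases ih with ⟨j, y, hj, -, hy, rfl⟩ | ⟨i, y, hi, -, hy, rfl⟩
    · cases j with
      | zero => exact hR _ _ hy hx
      | succ j => exact absurd (R.ell_c hα j (R.h_mem (hmem _ _ hy))).1.2 (not_lt.2 hx)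
    · cases i with
      | zero => exact hR _ _ hy hx
      | succ i =>
        refine Or.inr ⟨i, y, by omega, ?_, hy, (R.rr_c hα i (R.h_mem (hmem _ _ hy))).2⟩
        simp; omega

theorem Orb.down_rr (hα : 1 < α) (R : RD g g1 a b p q) {St : Bool → ℝ → Prop} {x : ℝ}
    (hx : x ∈ Icc p q) (h : Orb g St false (g.rr^[a] x)) :
    ∀ i ≤ a, Orb g St (!decide (i = a)) (g.rr^[i] x) := by
  intro i hi
  induction hi using Nat.decreasingInduction with
  | self => simpa using h
  | of_succ k hk ih =>
    have h1 := R.rr_c hα k hx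
    have := ih.stepR h1.1.1
    rw [h1.2] at this
    rw [show (!decide (k = a)) = true by simp; omega]
    exact this

theorem Orb.down_ell (hα : 1 < α) (R : RD g g1 a b p q) {St : Bool → ℝ → Prop} {x : ℝ}
    (hx : x ∈ Icc p q) (h : Orb g St true (g.ell^[b] x)) :
    ∀ i ≤ b, Orb g St (decide (i = b)) (g.ell^[i] x) := by
  intro i hi
  induction hi using Nat.decreasingInduction with
  | self => simpa using h
  | of_succ k hk ih =>
    have h1 := R.ell_c hα k hx
    have := ih.stepL h1.1.2
    rw [h1.2] at this
    rw [show (decide (k = b)) = false by simp; omega]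
    exact this

theorem Orb.lift (hα : 1 < α) (R : RD g g1 a b p q) {s y} (h : Orb g1 (CS g1) s y) :
    (s = false → ∀ i ≤ a, Orb g (CS g) (!decide (i = a)) (g.rr^[i] (p + (q - p) * y))) ∧
    (s = true → ∀ j ≤ b, Orb g (CS g) (decide (j = b)) (g.ell^[j] (p + (q - p) * y))) := by
  have hmem : ∀ s y, Orb g1 (CS g1) s y → y ∈ Icc (0:ℝ) 1 := fun s y hy =>
    hy.mem hα R.nt1 fun s x hx => CS.mem hx R.nt1
  have hC := R.hC
  have hcc := R.hcc
  have h0 : ∀ s y, ((s = false → ∀ i ≤ a, Orb g (CS g) (!decide (i = a))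
        (g.rr^[i] (p + (q - p) * y))) ∧
      (s = true → ∀ j ≤ b, Orb g (CS g) (decide (j = b)) (g.ell^[j] (p + (q - p) * y)))) →
      ∃ s', Orb g (CS g) s' (p + (q - p) * y) := by
    rintro s y ⟨h1, h2⟩
    cases s
    · exact ⟨_, h1 rfl 0 (by omega)⟩
    · exact ⟨_, h2 rfl 0 (by omega)⟩
  induction h with
  | @start s x h =>
    have hx := R.h_mem (CS.mem h R.nt1)
    refine ⟨?_, ?_⟩ <;> rintro rfl
    · refine Orb.down_rr hα R hx (Orb.start ?_)
      rw [CS] at h ⊢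
      simp only [Bool.false_eq_true, if_false] at h ⊢
      rw [h, ← R.cv1_eq hα]
    · refine Orb.down_ell hα R hx (Orb.start ?_)
      rw [CS] at h ⊢
      simp only [if_true] at h ⊢
      rw [h, ← R.cv0_eq hα]
  | @stepL s x h hx ih =>
    refine ⟨fun _ => ?_, fun h => by simp at h⟩
    refine Orb.down_rr hα R (R.h_mem (hmem _ _ (h.stepL hx))) ?_
    obtain ⟨s', hs'⟩ := h0 _ _ ih
    rw [← R.conjL x ⟨(hmem _ _ h).1, hx.le⟩]
    exact hs'.stepL (by nlinarith)
  | @stepR s x h hx ih =>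
    refine ⟨fun h => by simp at h, fun _ => ?_⟩
    refine Orb.down_ell hα R (R.h_mem (hmem _ _ (h.stepR hx))) ?_
    obtain ⟨s', hs'⟩ := h0 _ _ ih
    rw [← R.conjR x ⟨hx, (hmem _ _ h).2⟩]
    exact hs'.stepR (by nlinarith)

theorem CS.form (hα : 1 < α) (R : RD g g1 a b p q) {s x} (h : CS g s x) :
    Form g a b p q (Orb g1 (CS g1)) s x := by
  rw [CS] at h
  subst h
  cases s
  · exact Or.inr ⟨a, g1.cv1, le_rfl, by simp, Orb.start (by simp [CS]), by simp [← R.cv1_eq hα]⟩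
  · exact Or.inl ⟨b, g1.cv0, le_rfl, by simp, Orb.start (by simp [CS]), by simp [← R.cv0_eq hα]⟩

theorem PT.form (hα : 1 < α) (R : RD g g1 a b p q) {s x y} (hy : y ∈ Icc (0:ℝ) 1)
    (h : PT g (p + (q - p) * y) s x) :
    Form g a b p q (Orb g1 (PT g1 y)) s x := by
  have hC := R.hC
  have hcc := R.hcc
  rcases h with ⟨rfl, h1, rfl⟩ | ⟨rfl, h1, rfl⟩
  · have hy1 : y < g1.c := by nlinarith
    exact Or.inr ⟨a, g1.gl y, le_rfl, by simp, Orb.start (Or.inl ⟨rfl, hy1, rfl⟩),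
      R.conjL y ⟨hy.1, hy1.le⟩⟩
  · have hy1 : g1.c ≤ y := by nlinarith
    exact Or.inl ⟨b, g1.gr y, le_rfl, by simp, Orb.start (Or.inr ⟨rfl, hy1, rfl⟩),
      R.conjR y ⟨hy1, hy.2⟩⟩

theorem orb_range (St : Bool → ℝ → Prop) :
    {x | Orb g St true x} ∪ {x | Orb g St false x} =
      {x | ∃ s y k, St s y ∧ x = g.toFun^[k] y} := by
  ext x
  simp only [mem_union, mem_ofPred_eq]
  constructor
  · have : ∀ s, Orb g St s x → ∃ s y k, St s y ∧ x = g.toFun^[k] y := by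
      intro s h
      induction h with
      | start h => exact ⟨_, _, 0, h, rfl⟩
      | stepL h hx ih =>
        obtain ⟨s, y, k, h1, rfl⟩ := ih
        exact ⟨s, y, k + 1, h1, by rw [Function.iterate_succ_apply', toFun_left hx]⟩
      | stepR h hx ih =>
        obtain ⟨s, y, k, h1, rfl⟩ := ih
        exact ⟨s, y, k + 1, h1, by rw [Function.iterate_succ_apply', toFun_right hx]⟩
    rintro (h | h) <;> exact this _ h
  · rintro ⟨s, y, k, h, rfl⟩
    have : ∃ s, Orb g St s (g.toFun^[k] y) := by
      induction k with
      | zero => exact ⟨s, Orb.start h⟩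
      | succ k ih =>
        obtain ⟨s, hs⟩ := ih
        rw [Function.iterate_succ_apply']
        rcases lt_or_ge (g.toFun^[k] y) g.c with h1 | h1
        · rw [toFun_left h1]; exact ⟨_, hs.stepL h1⟩
        · rw [toFun_right h1]; exact ⟨_, hs.stepR h1⟩
    obtain ⟨s, hs⟩ := this
    cases s
    · exact Or.inr hs
    · exact Or.inl hs
end orb

theorem abs_lip {k : ℝ → ℝ} {p q L : ℝ} (hC : 0 < q - p)
    (hm : ∀ x y, p ≤ x → x ≤ y → y ≤ q → k x ≤ k y)
    (hL : ∀ x y, p ≤ x → x ≤ y → y ≤ q → k y - k x ≤ L * (y - x)) {x y : ℝ}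
    (hx : x ∈ Icc (0:ℝ) 1) (hy : y ∈ Icc (0:ℝ) 1) :
    |k (p + (q - p) * x) - k (p + (q - p) * y)| ≤ L * (q - p) * |x - y| := by
  wlog hxy : y ≤ x generalizing x y
  · rw [abs_sub_comm, abs_sub_comm x]
    exact this hy hx (le_of_not_ge hxy)
  have h1 : p ≤ p + (q - p) * y := by nlinarith [hy.1]
  have h2 : p + (q - p) * y ≤ p + (q - p) * x := by nlinarith
  have h3 : p + (q - p) * x ≤ q := by nlinarith [hx.2]
  rw [abs_of_nonneg (sub_nonneg.2 (hm _ _ h1 h2 h3)), abs_of_nonneg (sub_nonneg.2 hxy)]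
  refine (hL _ _ h1 h2 h3).trans (le_of_eq (by ring))

theorem abs_colip {k : ℝ → ℝ} {p q L : ℝ} (hC : 0 < q - p)
    (hL : ∀ x y, p ≤ x → x ≤ y → y ≤ q → L * (y - x) ≤ k y - k x) {x y : ℝ}
    (hx : x ∈ Icc (0:ℝ) 1) (hy : y ∈ Icc (0:ℝ) 1) :
    L * (q - p) * |x - y| ≤ |k (p + (q - p) * x) - k (p + (q - p) * y)| := by
  wlog hxy : y ≤ x generalizing x y
  · rw [abs_sub_comm, abs_sub_comm (k _)]
    exact this hy hx (le_of_not_ge hxy)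
  have h1 : p ≤ p + (q - p) * y := by nlinarith [hy.1]
  have h2 : p + (q - p) * y ≤ p + (q - p) * x := by nlinarith
  have h3 : p + (q - p) * x ≤ q := by nlinarith [hx.2]
  rw [abs_of_nonneg (sub_nonneg.2 hxy)]
  refine le_trans (le_of_eq (by ring)) ((hL _ _ h1 h2 h3).trans (le_abs_self _))

section lvl
variable {α σ β θ m : ℝ} {bb : ℕ} {g g1 : LorenzMap α} {a b : ℕ} {p q : ℝ}
open LorenzMap

theorem LV.rr_mono (hα : 1 < α) (V : LV σ β θ m bb g g1 a b p q) (i : ℕ) :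
    ∀ x y, p ≤ x → x ≤ y → y ≤ q → g.rr^[i] x ≤ g.rr^[i] y := fun x y h1 h2 h3 =>
  have := V.R.cp
  have := V.R.q1
  (iterate_mono (S := Icc g.cv0 1) (g.gr_br hα V.R.nt).inv_mono (g.rr_maps hα V.R.nt) i).monotoneOn
    ⟨by linarith, by linarith⟩ ⟨by linarith, by linarith⟩ h2

theorem LV.ell_mono (hα : 1 < α) (V : LV σ β θ m bb g g1 a b p q) (i : ℕ) :
    ∀ x y, p ≤ x → x ≤ y → y ≤ q → g.ell^[i] x ≤ g.ell^[i] y := fun x y h1 h2 h3 =>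
  ell_iter_le hα V.R.nt i (V.R.p0.le.trans h1) h2 (h3.trans V.R.qc.le)

theorem LV.rr_lip (hα : 1 < α) (N : NumB α σ β θ m (nK bb) bb)
    (V : LV σ β θ m bb g g1 a b p q) (i : ℕ) {x y : ℝ} (hx : x ∈ Icc (0:ℝ) 1)
    (hy : y ∈ Icc (0:ℝ) 1) :
    |g.rr^[i] (p + (q - p) * x) - g.rr^[i] (p + (q - p) * y)| ≤ ((bb:ℝ) ^ 4)⁻¹ * |x - y| := by
  have hC := V.R.hC
  have bb3 : (3:ℝ) ≤ bb := by exact_mod_cast N.bb3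
  have b4 : 0 < (bb:ℝ) ^ 4 := by positivity
  have o1 := V.out.o1
  have hc := g.hc
  have m0 := N.m0
  have E := N.he _ V.lo V.hi
  have hε : 0 < 1 - g.c := by linarith [hc.2]
  refine (abs_lip (L := 1) hC (V.rr_mono hα i) ?_ hx hy).trans ?_
  · intro u v h1 h2 h3
    refine (V.H.rr_upper_iter hα V.R.nt N.K1 N.K2 m0 V.hm (by linarith [V.out.o3]) i (w := u)
      (w' := v) (by linarith [V.out.o2]) h2 (by linarith [V.R.q1])).trans ?_
    refine mlR (pow_le_one₀ (by positivity) (by linarith [E.e4]))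
      (by linarith)
  · refine mlR ?_ (abs_nonneg _)
    rw [← one_div, le_div_iff₀ b4]
    nlinarith [hc.1]

theorem LV.ell_lip (hα : 1 < α) (N : NumB α σ β θ m (nK bb) bb)
    (V : LV σ β θ m bb g g1 a b p q) {j : ℕ} (hj : j ≤ b) {x y : ℝ} (hx : x ∈ Icc (0:ℝ) 1)
    (hy : y ∈ Icc (0:ℝ) 1) :
    |g.ell^[j] (p + (q - p) * x) - g.ell^[j] (p + (q - p) * y)| ≤ ((bb:ℝ) ^ 4)⁻¹ * |x - y| := by
  have hC := V.R.hC
  have bb3 : (3:ℝ) ≤ bb := by exact_mod_cast N.bb3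
  have b4 : 0 < (bb:ℝ) ^ 4 := by positivity
  have o1 := V.out.o1
  have hε : 0 < 1 - g.c := by linarith [g.hc.2]
  refine (abs_lip hC (V.ell_mono hα j) (fun u v => V.out.up j u v hj) hx hy).trans ?_
  refine mlR ?_ (abs_nonneg _)
  rw [← one_div, le_div_iff₀ b4, div_mul_eq_mul_div, div_mul_eq_mul_div, div_le_one hε]
  linarith

theorem LV.pge (N : NumB α σ β θ m (nK bb) bb) (V : LV σ β θ m bb g g1 a b p q) :
    g.gr q + 1 / 4 ≤ p := by
  have E := N.he _ V.lo V.hi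
  linarith [E.e1, V.out.o6, V.out.o7]

theorem LV.rr_gap (hα : 1 < α) (N : NumB α σ β θ m (nK bb) bb)
    (V : LV σ β θ m bb g g1 a b p q) (n : ℕ) :
    (1 - g.c) / (8 * α) ≤ g.rr^[n + 1] p - q := by
  have h1 := V.H.rr_lower_iter hα V.R.nt N.K1 N.K2 1 (w := g.gr q) (w' := p)
    ((g.gr_br hα V.R.nt).maps ⟨V.R.cq.le, V.R.q1.le⟩).1 V.R.grq
    (by linarith [V.R.pc, g.hc.2])
  have hq : g.rr (g.gr q) = q := (g.gr_br hα V.R.nt).inv_k ⟨V.R.cq.le, V.R.q1.le⟩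
  rw [Function.iterate_one, hq, pow_one] at h1
  have hε : 0 < 1 - g.c := by linarith [g.hc.2]
  have h2 : g.rr p ≤ g.rr^[n + 1] p := by
    have hp : p ∈ Icc g.cv0 1 := ⟨V.R.cp.le, by linarith [V.R.pc, g.hc.2]⟩
    rw [Function.iterate_succ_apply']
    refine (g.gr_br hα V.R.nt).inv_mono.monotoneOn hp
      (iterate_maps (g.rr_maps hα V.R.nt) n hp) ?_
    cases n with
    | zero => exact le_rfl
    | succ n =>
      exact V.R.pc.le.trans (V.R.rr_c hα n ⟨le_rfl, (V.R.pc.trans V.R.cq).le⟩).1.1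
  have h3 := V.pge N
  have h4 : (1 - g.c) / (2 * α) * (1 / 4) ≤ (1 - g.c) / (2 * α) * (p - g.gr q) :=
    mlL (by linarith) (by positivity)
  have h5 : (1 - g.c) / (2 * α) * (1 / 4) = (1 - g.c) / (8 * α) := by field_simp; ring
  linarith

theorem LV.b_le (hα : 1 < α) (hσ : σ ∈ Ioo (0:ℝ) 1) (hβ : β ∈ Ioo (0 : ℝ) ((σ / α) ^ 2))
    (V : LV σ β θ m bb g g1 a b p q) : b ≤ 2 * bb ∧ (a : ℝ) ≤ 2 * α := by
  have h1 := V.om.2.2.2.2.2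
  have h2 := V.om.2.2.2.1
  simp only at h1 h2
  have h3 : σ / α ≤ 1 := by rw [div_le_one (by linarith)]; linarith [hσ.2]
  have h4 : 0 ≤ σ / α := div_nonneg hσ.1.le (by linarith)
  constructor
  · have h5 : (b : ℝ) ≤ 2 * bb := by
      refine h1.trans (mlR ?_ (by positivity))
      nlinarith [hβ.1]
    exact_mod_cast h5
  · linarith [hσ.1]

theorem LV.C_ge (hα : 1 < α) (hσ : σ ∈ Ioo (0:ℝ) 1)
    (V : LV σ β θ m bb g g1 a b p q) : nlam α σ (nlo α bb) ^ (1 / (α - 1)) ≤ q - p := by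
  have lo0 : 0 < nlo α bb := rpp (by linarith) _
  have h1 := V.om.1
  have h2 := V.om.2.2.2.1
  simp only at h1 h2
  have h1' : (1:ℝ) ≤ a := by exact_mod_cast h1
  have h3 : nlam α σ (nlo α bb) ≤ (g.c - p) ^ (α - 1) := by
    refine le_trans ?_ V.out.llo
    rw [nlam, nlam]
    have := V.lo
    have : 0 ≤ 2 * α - 1 - σ := by linarith
    gcongr
  have h4 : 0 ≤ nlam α σ (nlo α bb) := by rw [nlam]; positivity
  have h5 : 0 ≤ g.c - p := by linarith [V.R.pc]
  have h6 := rlr h4 h3 (z := 1 / (α - 1)) (one_div_nonneg.2 (by linarith))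
  rw [← Real.rpow_mul h5, mul_one_div_cancel (by linarith), Real.rpow_one] at h6
  linarith [V.R.cq]

def nkap (α σ : ℝ) (bb : ℕ) : ℝ :=
  nlam α σ (nlo α bb) ^ (1 / (α - 1)) * (nlo α bb / (8 * α)) ^ (⌊2 * α⌋₊ + 1) / (32 * α ^ (2 * bb))

theorem nkap_pos (hα : 1 < α) : 0 < nkap α σ bb := by
  have lo0 : 0 < nlo α bb := rpp (by linarith) _
  rw [nkap, nlam]
  positivity

theorem LV.kap (hα : 1 < α) (hσ : σ ∈ Ioo (0:ℝ) 1) (hβ : β ∈ Ioo (0 : ℝ) ((σ / α) ^ 2))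
    (N : NumB α σ β θ m (nK bb) bb) (V : LV σ β θ m bb g g1 a b p q) :
    nkap α σ bb ≤ q - p ∧ nkap α σ bb ≤ ((1 - g.c) / (2 * α)) ^ a * (q - p) ∧
    nkap α σ bb ≤ (32 * (1 - g.c) * α ^ b)⁻¹ * (q - p) ∧ nkap α σ bb ≤ (1 - g.c) / (8 * α) ∧
    nkap α σ bb ≤ 1 / 4 := by
  have lo0 : 0 < nlo α bb := rpp (by linarith) _
  have hC := V.C_ge hα hσ
  obtain ⟨hb, ha⟩ := V.b_le hα hσ hβ
  have ha' : a ≤ ⌊2 * α⌋₊ := Nat.le_floor ha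
  have E := N.he _ V.lo V.hi
  have hε : 0 < 1 - g.c := by linarith [g.hc.2]
  have lo := V.lo
  set C0 := nlam α σ (nlo α bb) ^ (1 / (α - 1)) with hC0
  set r := nlo α bb / (8 * α) with hr
  have C00 : 0 ≤ C0 := by rw [hC0, nlam]; positivity
  have r0 : 0 < r := by positivity
  have r1 : r ≤ (1 - g.c) / (8 * α) := by rw [hr]; gcongr
  have r1' : r ≤ 1 := by
    refine r1.trans ((div_le_one (by positivity)).2 ?_)
    linarith [g.hc.1]
  have r4 : r ≤ 1 / 4 := by
    refine r1.trans ((div_le_div_iff₀ (by positivity) (by positivity)).2 ?_)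
    linarith [g.hc.1]
  have r2 : r ≤ (1 - g.c) / (2 * α) := by
    refine r1.trans ?_
    gcongr; norm_num
  have hα2 : 1 ≤ α ^ (2 * bb) := one_le_pow₀ hα.le
  have C1 : C0 ≤ 1 := hC.trans (by linarith [V.R.p0, V.R.q1])
  have k0 : nkap α σ bb ≤ C0 * r ^ (⌊2 * α⌋₊ + 1) := by
    rw [nkap, ← hC0, ← hr]
    refine div_le_self (by positivity) (by linarith)
  have rp : r ^ (⌊2 * α⌋₊ + 1) ≤ r ^ a := pow_le_pow_of_le_one r0.le r1' (by omega)
  have rp1 : r ^ (⌊2 * α⌋₊ + 1) ≤ r := by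
    simpa using pow_le_pow_of_le_one r0.le r1' (show 1 ≤ ⌊2 * α⌋₊ + 1 by omega)
  have hp0 : 0 ≤ r ^ (⌊2 * α⌋₊ + 1) := by positivity
  have kr : nkap α σ bb ≤ r := by nlinarith
  refine ⟨by nlinarith, ?_, ?_, kr.trans r1, kr.trans r4⟩
  · refine k0.trans ?_
    rw [mul_comm]
    refine mul_le_mul (rp.trans ?_) hC C00 (by positivity)
    gcongr
  · rw [nkap, ← hC0, ← hr, div_eq_inv_mul]
    have h1 : C0 * r ^ (⌊2 * α⌋₊ + 1) ≤ q - p := by nlinarith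
    refine mul_le_mul ?_ h1 (by positivity) (by positivity)
    have h2 : α ^ b ≤ α ^ (2 * bb) := pow_le_pow_right₀ hα.le hb
    refine inv_anti₀ (by positivity) ?_
    have h3 : 32 * (1 - g.c) ≤ 32 := by linarith [g.hc.1]
    exact mul_le_mul h3 h2 (by positivity) (by norm_num)

theorem frac_of (hα : 1 < α) (hσ : σ ∈ Ioo (0:ℝ) 1) (hβ : β ∈ Ioo (0 : ℝ) ((σ / α) ^ 2))
    (N : NumB α σ β θ m (nK bb) bb) {G : ℕ → LorenzMap α} {ω : ℕ → ℕ × ℕ} {p q : ℕ → ℝ}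
    (V : ∀ n, LV σ β θ m bb (G n) (G (n + 1)) (ω n).1 (ω n).2 (p n) (q n)) :
    Frac (fun n s => {x | Orb (G n) (CS (G n)) s x}) (bb ^ 2) ((bb:ℝ) ^ 4)⁻¹ (nkap α σ bb) := by
  have bb3 : (3:ℝ) ≤ bb := by exact_mod_cast N.bb3
  have hmem : ∀ n s x, Orb (G n) (CS (G n)) s x → x ∈ Icc (0:ℝ) 1 := fun n s x hx =>
    hx.mem hα (V n).R.nt fun s x hx => CS.mem hx (V n).R.nt
  refine ⟨fun n s x hx => hmem n s x hx, fun n s => ⟨_, Orb.start rfl⟩,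
    Nat.one_le_pow _ _ (by linarith [N.bb3]), by positivity, ?_, nkap_pos hα, ?_, ?_, ?_, ?_⟩
  · refine inv_lt_one_of_one_lt₀ (one_lt_pow₀ (by linarith) (by norm_num))
  · linarith [((V 0).kap hα hσ hβ N).2.2.2.2]
  · push_cast
    rw [← pow_mul, inv_mul_cancel₀ (by positivity)]
  · intro n s
    have R := (V n).R
    obtain ⟨hb, ha⟩ := (V n).b_le hα hσ hβ
    set a := (ω n).1
    set b := (ω n).2
    have hbN : b + 1 ≤ bb ^ 2 := by
      have : ((b + 1 : ℕ) : ℝ) ≤ ((bb ^ 2 : ℕ) : ℝ) := by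
        have hb' : (b:ℝ) ≤ 2 * bb := by exact_mod_cast hb
        push_cast; linarith [N.bbN]
      exact_mod_cast this
    have haN : a + 1 ≤ bb ^ 2 := by
      have : ((a + 1 : ℕ) : ℝ) ≤ ((bb ^ 2 : ℕ) : ℝ) := by
        push_cast; linarith [N.bbN]
      exact_mod_cast this
    have injr : ∀ i, InjOn (fun y => (G n).rr^[i] (p n + (q n - p n) * y)) (Icc 0 1) := by
      intro i x hx y hy he
      have hC := R.hC
      have h1 := (iterate_mono (S := Icc (G n).cv0 1) ((G n).gr_br hα R.nt).inv_mono
        ((G n).rr_maps hα R.nt) i).injOn ⟨R.cp.le.trans (R.h_mem hx).1, (R.h_mem hx).2.trans R.q1.le⟩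
        ⟨R.cp.le.trans (R.h_mem hy).1, (R.h_mem hy).2.trans R.q1.le⟩ he
      simpa [hC.ne'] using h1
    have inje : ∀ i, InjOn (fun y => (G n).ell^[i] (p n + (q n - p n) * y)) (Icc 0 1) := by
      intro i x hx y hy he
      have hC := R.hC
      have h1 := (iterate_mono (S := Icc 0 (G n).cv1) ((G n).gl_br hα R.nt).inv_mono
        ((G n).ell_maps hα R.nt) i).injOn ⟨R.p0.le.trans (R.h_mem hx).1, (R.h_mem hx).2.trans R.qc.le⟩
        ⟨R.p0.le.trans (R.h_mem hy).1, (R.h_mem hy).2.trans R.qc.le⟩ he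
      simpa [hC.ne'] using h1
    cases s
    · refine ⟨fun i y => if i < b then (G n).ell^[i] (p n + (q n - p n) * y) else
        (G n).rr^[a] (p n + (q n - p n) * y), fun i => decide (i < b), ?_, ?_, ?_, ?_⟩
      · intro i _ x hx
        by_cases hi : i < b
        · simp only [hi, decide_true, if_true, mem_ofPred_eq] at hx ⊢
          have := (hx.lift hα R).2 rfl i hi.le
          simpa [hi.ne] using this
        · simp only [hi, decide_false, if_false, mem_ofPred_eq] at hx ⊢
          have := (hx.lift hα R).1 rfl a le_rfl
          simpa using this
      · intro i _ x hx y hy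
        by_cases hi : i < b
        · simp only [hi, if_true]
          exact (V n).ell_lip hα N hi.le (hmem _ _ _ hx) (hmem _ _ _ hy)
        · simp only [hi, if_false]
          exact (V n).rr_lip hα N a (hmem _ _ _ hx) (hmem _ _ _ hy)
      · intro i _ x hx y hy he
        by_cases hi : i < b
        · simp only [hi, if_true] at he
          exact inje i (hmem _ _ _ hx) (hmem _ _ _ hy) he
        · simp only [hi, if_false] at he
          exact injr a (hmem _ _ _ hx) (hmem _ _ _ hy) he
      · intro x hx
        rcases Orb.form hα R (fun s x hx => CS.mem hx R.nt1) (fun s x h => CS.form hα R h) hx with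
          ⟨j, y, hj, hs, hy, rfl⟩ | ⟨j, y, hj, hs, hy, rfl⟩
        · have hs' : j ≠ b := by simpa using hs
          have hj' : j < b := by omega
          exact ⟨j, by omega, y, by simpa [hj'] using hy, by simp [hj']⟩
        · have hs' : j = a := by simpa using hs
          exact ⟨b, by omega, y, by simpa using hy, by simp [hs']⟩
    · refine ⟨fun i y => if i < a then (G n).rr^[i] (p n + (q n - p n) * y) else
        (G n).ell^[b] (p n + (q n - p n) * y), fun i => !decide (i < a), ?_, ?_, ?_, ?_⟩
      · intro i _ x hx
        by_cases hi : i < a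
        · simp only [hi, decide_true, if_true, mem_ofPred_eq, Bool.not_true] at hx ⊢
          have := (hx.lift hα R).1 rfl i hi.le
          simpa [hi.ne] using this
        · simp only [hi, decide_false, if_false, mem_ofPred_eq, Bool.not_false] at hx ⊢
          have := (hx.lift hα R).2 rfl b le_rfl
          simpa using this
      · intro i _ x hx y hy
        by_cases hi : i < a
        · simp only [hi, if_true]
          exact (V n).rr_lip hα N i (hmem _ _ _ hx) (hmem _ _ _ hy)
        · simp only [hi, if_false]
          exact (V n).ell_lip hα N le_rfl (hmem _ _ _ hx) (hmem _ _ _ hy)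
      · intro i _ x hx y hy he
        by_cases hi : i < a
        · simp only [hi, if_true] at he
          exact injr i (hmem _ _ _ hx) (hmem _ _ _ hy) he
        · simp only [hi, if_false] at he
          exact inje b (hmem _ _ _ hx) (hmem _ _ _ hy) he
      · intro x hx
        rcases Orb.form hα R (fun s x hx => CS.mem hx R.nt1) (fun s x h => CS.form hα R h) hx with
          ⟨j, y, hj, hs, hy, rfl⟩ | ⟨j, y, hj, hs, hy, rfl⟩
        · have hs' : j = b := by simpa using hs
          exact ⟨a, by omega, y, by simpa using hy, by simp [hs']⟩
        · have hs' : j ≠ a := by simpa using hs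
          have hj' : j < a := by omega
          exact ⟨j, by omega, y, by simpa [hj'] using hy, by simp [hj']⟩
  · intro n s
    have R := (V n).R
    have hC := R.hC
    obtain ⟨k1, k2, k3, k4, k5⟩ := (V n).kap hα hσ hβ N
    have cr : ∀ x ∈ Icc (0:ℝ) 1, ∀ y ∈ Icc (0:ℝ) 1, nkap α σ bb * |x - y| ≤
        |(G n).rr^[(ω n).1] (p n + (q n - p n) * x) - (G n).rr^[(ω n).1] (p n + (q n - p n) * y)| := by
      intro x hx y hy
      refine le_trans (mlR k2 (abs_nonneg _)) (abs_colip hC ?_ hx hy)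
      intro u v h1 h2 h3
      exact (V n).H.rr_lower_iter hα R.nt N.K1 N.K2 _ (R.cp.le.trans h1) h2 (h3.trans R.q1.le)
    have ce : ∀ x ∈ Icc (0:ℝ) 1, ∀ y ∈ Icc (0:ℝ) 1, nkap α σ bb * |x - y| ≤
        |(G n).ell^[(ω n).2] (p n + (q n - p n) * x) - (G n).ell^[(ω n).2] (p n + (q n - p n) * y)| := by
      intro x hx y hy
      refine le_trans (mlR k3 (abs_nonneg _)) (abs_colip hC ?_ hx hy)
      intro u v h1 h2 h3
      rw [← div_eq_inv_mul]
      exact (V n).out.dn u v h1 h2 h3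
    have ch : ∀ x ∈ Icc (0:ℝ) 1, ∀ y ∈ Icc (0:ℝ) 1, nkap α σ bb * |x - y| ≤
        |(p n + (q n - p n) * x) - (p n + (q n - p n) * y)| := by
      intro x hx y hy
      refine le_trans (mlR k1 (abs_nonneg _)) ?_
      rw [add_sub_add_left_eq_sub, ← mul_sub, abs_mul, abs_of_pos hC]
    cases s
    · refine ⟨fun d y => if d then p n + (q n - p n) * y else
        (G n).rr^[(ω n).1] (p n + (q n - p n) * y), ?_, ?_, ?_, ?_⟩
      · intro d x hx
        cases d
        · simpa using (hx.lift hα R).1 rfl _ le_rfl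
        · have := (hx.lift hα R).2 rfl 0 (by omega)
          have hb := R.hb
          simpa [show ¬ 0 = (ω n).2 by omega] using this
      · intro d x hx y hy
        cases d
        · exact (V n).rr_lip hα N _ (hmem _ _ _ hx) (hmem _ _ _ hy)
        · exact (V n).rr_lip hα N 0 (hmem _ _ _ hx) (hmem _ _ _ hy)
      · intro d x hx y hy
        cases d
        · exact cr x (hmem _ _ _ hx) y (hmem _ _ _ hy)
        · exact ch x (hmem _ _ _ hx) y (hmem _ _ _ hy)
      · intro x hx y hy
        obtain ⟨j, hj⟩ : ∃ j, (ω n).1 = j + 1 := ⟨(ω n).1 - 1, by have := R.ha; omega⟩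
        have h1 := (V n).rr_gap hα N j
        have h2 := R.h_mem (hmem _ _ _ hx)
        have h3 := R.h_mem (hmem _ _ _ hy)
        have h4 := (V n).rr_mono hα (j + 1) _ _ le_rfl h2.1 h2.2
        simp only [hj, Bool.false_eq_true, if_false, if_true]
        refine le_trans ?_ (le_abs_self _)
        linarith [h3.2]
    · refine ⟨fun d y => if d then (G n).ell^[(ω n).2] (p n + (q n - p n) * y) else
        p n + (q n - p n) * y, ?_, ?_, ?_, ?_⟩
      · intro d x hx
        cases d
        · have := (hx.lift hα R).1 rfl 0 (by omega)
          have ha := R.ha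
          simpa [show ¬ 0 = (ω n).1 by omega] using this
        · simpa using (hx.lift hα R).2 rfl _ le_rfl
      · intro d x hx y hy
        cases d
        · exact (V n).rr_lip hα N 0 (hmem _ _ _ hx) (hmem _ _ _ hy)
        · exact (V n).ell_lip hα N le_rfl (hmem _ _ _ hx) (hmem _ _ _ hy)
      · intro d x hx y hy
        cases d
        · exact ch x (hmem _ _ _ hx) y (hmem _ _ _ hy)
        · exact ce x (hmem _ _ _ hx) y (hmem _ _ _ hy)
      · intro x hx y hy
        have h1 := (V n).pge N
        have h2 := R.h_mem (hmem _ _ _ hx)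
        have h3 := R.h_mem (hmem _ _ _ hy)
        have h4 := (V n).ell_mono hα (ω n).2 _ _ h3.1 h3.2 le_rfl
        rw [← R.gr_q hα] at h4
        simp only [Bool.false_eq_true, if_false, if_true]
        refine le_trans ?_ (le_abs_self _)
        linarith [h2.1]
end lvl

inductive Wd {ι : Type} (s : ι → ℝ → ℝ) : ℕ → (ℝ → ℝ) → Prop
  | nil : Wd s 0 (fun x => x)
  | snoc {n k} (i : ι) (h : Wd s n k) : Wd s (n + 1) (k ∘ s i)

theorem null_of_ifs {ι : Type} {A l r B u v : ℝ} (hA : A < l) (hlr : l < r) (hB : r < B)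
    {s : ι → ℝ → ℝ} (ps : ∀ i, PS (s i) (Ioo A B))
    (mJ : ∀ i, ∀ x ∈ Ioo A B, s i x ∈ Ioo A B) (mI : ∀ i, ∀ x ∈ Icc l r, s i x ∈ Icc l r)
    {X : Set ℝ} (hX : X ⊆ Icc l r) (cov : ∀ x ∈ X, ∃ i, ∃ y ∈ X, s i y = x)
    (inv : ∀ i, ∀ z ∈ Icc l r, s i z ∈ X → z ∈ X)
    (hu : l ≤ u) (huv : u < v) (hv : v ≤ r) (dis : ∀ i, s i r ≤ u ∨ v ≤ s i l)
    (hole : ∀ z ∈ Ioo u v, z ∉ X) : volume X = 0 := by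
  have hIJ : ∀ x ∈ Icc l r, x ∈ Ioo A B := fun x hx => ⟨by linarith [hx.1], by linarith [hx.2]⟩
  have hl : l ∈ Icc l r := ⟨le_refl _, hlr.le⟩
  have hr : r ∈ Icc l r := ⟨hlr.le, le_refl _⟩
  have hu' : u ∈ Icc l r := ⟨hu, by linarith⟩
  have hv' : v ∈ Icc l r := ⟨by linarith, hv⟩
  set D := max (((r - A) / (l - A)) ^ 2) (((B - l) / (B - r)) ^ 2) with hD
  have D1 : 1 ≤ D := by
    refine le_trans ?_ (le_max_left _ _)
    apply one_le_pow₀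
    rw [one_le_div (by linarith)]; linarith
  set η := (v - u) / (D * (r - l)) with hη
  have hDr : 0 < D * (r - l) := mul_pos (by linarith) (by linarith)
  have η0 : 0 < η := div_pos (by linarith) hDr
  have η1 : η ≤ 1 := by
    rw [hη, div_le_one hDr]; nlinarith
  have W : ∀ n k, Wd s n k → PS k (Ioo A B) ∧ (∀ x ∈ Ioo A B, k x ∈ Ioo A B) ∧
      (∀ x ∈ Icc l r, k x ∈ X → x ∈ X) := by
    intro n k h
    induction h with
    | nil => exact ⟨PS.id _, fun x hx => hx, fun x _ h => h⟩
    | @snoc n k i h ih =>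
      obtain ⟨h1, h2, h3⟩ := ih
      exact ⟨h1.comp (ps i) (mJ i), fun x hx => h2 _ (mJ i x hx),
        fun x hx h => inv i x hx (h3 _ (mI i x hx) h)⟩
  have hole2 : ∀ n k, Wd s n k → η * (k r - k l) ≤ k v - k u := by
    intro n k h
    obtain ⟨h1, -, -⟩ := W n k h
    have := h1.distort hA hB hlr (le_max_left _ _) (le_max_right _ _) le_rfl hlr le_rfl hu huv hv
    rw [hη, div_mul_eq_mul_div, div_le_iff₀ hDr]
    nlinarith [this]
  have len : ∀ n k, Wd s n k → k r - k l ≤ (1 - η) ^ n * (r - l) := by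
    intro n k h
    induction h with
    | nil => simp
    | @snoc n k i h ih =>
      have mo := (W n k h).1.strictMonoOn.monotoneOn
      have h4 := hole2 n k h
      have a1 := mI i l hl
      have a2 := mI i r hr
      have b1 := mo (hIJ _ hl) (hIJ _ a1) a1.1
      have b2 := mo (hIJ _ a2) (hIJ _ hr) a2.2
      have b3 := mo (hIJ _ hl) (hIJ _ hu') hu
      have b4 := mo (hIJ _ hv') (hIJ _ hr) hv
      have key : k (s i r) - k (s i l) ≤ (1 - η) * (k r - k l) := by
        rcases dis i with d | d
        · have := mo (hIJ _ a2) (hIJ _ hu') d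
          linarith
        · have := mo (hIJ _ hv') (hIJ _ a1) d
          linarith
      simp only [Function.comp]
      calc _ ≤ _ := key
        _ ≤ (1 - η) * ((1 - η) ^ n * (r - l)) := mlL ih (by linarith)
        _ = _ := by ring
  have pt : ∀ n, ∀ x ∈ X, ∃ k, Wd s n k ∧ ∃ y ∈ X, k y = x := by
    intro n
    induction n with
    | zero => exact fun x hx => ⟨_, Wd.nil, x, hx, rfl⟩
    | succ n ih =>
      intro x hx
      obtain ⟨k, hk, y, hy, e⟩ := ih x hx
      obtain ⟨i, z, hz, e2⟩ := cov y hy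
      exact ⟨_, Wd.snoc i hk, z, hz, by simp [e2, e]⟩
  have meas : ∀ n k, Wd s n k → volume (X ∩ Icc (k l) (k r)) ≤ ENNReal.ofReal ((1 - η) * (k r - k l)) := by
    intro n k h
    obtain ⟨h1, h2, h3⟩ := W n k h
    have mo := h1.strictMonoOn.monotoneOn
    have b3 := mo (hIJ _ hl) (hIJ _ hu') hu
    have b4 := mo (hIJ _ hv') (hIJ _ hr) hv
    have sub : X ∩ Icc (k l) (k r) ⊆ Icc (k l) (k u) ∪ Icc (k v) (k r) := by
      rintro x ⟨hx, hx1, hx2⟩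
      by_contra hc
      simp only [mem_union, mem_Icc, not_or, not_and, not_le] at hc
      have c1 := hc.1 hx1
      have c2 : x < k v := by by_contra h; exact absurd hx2 (not_le.2 (hc.2 (not_lt.1 h)))
      have ct : ContinuousOn k (Icc u v) := fun z hz =>
        (h1.hasDeriv (hIJ z ⟨by linarith [hz.1], by linarith [hz.2]⟩)).continuousAt.continuousWithinAt
      obtain ⟨z, hz, e⟩ := intermediate_value_Ioo huv.le ct ⟨c1, c2⟩
      exact hole z hz (h3 z ⟨by linarith [hz.1], by linarith [hz.2]⟩ (e ▸ hx))
    calc _ ≤ volume (Icc (k l) (k u) ∪ Icc (k v) (k r)) := measure_mono sub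
      _ ≤ _ := measure_union_le _ _
      _ = ENNReal.ofReal ((k u - k l) + (k r - k v)) := by
        rw [Real.volume_Icc, Real.volume_Icc, ENNReal.ofReal_add (by linarith) (by linarith)]
      _ ≤ _ := ENNReal.ofReal_le_ofReal (by linarith [hole2 n k h])
  have hden := IsUnifLocDoublingMeasure.ae_tendsto_measure_inter_div.{0, 0} (volume : Measure ℝ) X 1
  rw [ae_iff] at hden
  refine measure_mono_null ?_ (le_antisymm ((Measure.le_restrict_apply X _).trans hden.le) zero_le)
  intro x hx
  refine ⟨?_, hx⟩
  intro hc
  choose k hk y hy e using fun n => pt n x hx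
  have pos : ∀ n, 0 < k n r - k n l := fun n => by
    linarith [(W n _ (hk n)).1.strictMonoOn (hIJ _ hl) (hIJ _ hr) hlr]
  have T := hc (ι := ℕ) (l := atTop) (fun n => (k n l + k n r) / 2) (fun n => (k n r - k n l) / 2) ?_ ?_
  · have hlt : ENNReal.ofReal (1 - η) < 1 := by
      rw [← ENNReal.ofReal_one]; exact (ENNReal.ofReal_lt_ofReal_iff one_pos).2 (by linarith)
    obtain ⟨n, hn⟩ := (T.eventually (lt_mem_nhds hlt)).exists
    refine absurd hn (not_lt.2 ?_)
    rw [Real.closedBall_eq_Icc]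
    have e1 : (k n l + k n r) / 2 - (k n r - k n l) / 2 = k n l := by ring
    have e2 : (k n l + k n r) / 2 + (k n r - k n l) / 2 = k n r := by ring
    rw [e1, e2, Real.volume_Icc]
    apply ENNReal.div_le_of_le_mul
    rw [← ENNReal.ofReal_mul (by linarith)]
    exact meas n _ (hk n)
  · rw [tendsto_nhdsWithin_iff]
    constructor
    · have t1 : Tendsto (fun n : ℕ => (1 - η) ^ n * (r - l)) atTop (𝓝 (0 * (r - l))) :=
        (tendsto_pow_atTop_nhds_zero_of_lt_one (by linarith) (by linarith)).mul_const _
      rw [zero_mul] at t1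
      refine squeeze_zero (fun n => by linarith [pos n]) (fun n => ?_) t1
      linarith [len n _ (hk n), pos n]
    · exact Eventually.of_forall fun n => by
        simp only [mem_Ioi]; linarith [pos n]
  · refine Eventually.of_forall fun n => ?_
    rw [Real.closedBall_eq_Icc, ← e n]
    have mo := (W n _ (hk n)).1.strictMonoOn.monotoneOn
    have hy' := hX (hy n)
    have b1 := mo (hIJ _ hl) (hIJ _ hy') hy'.1
    have b2 := mo (hIJ _ hy') (hIJ _ hr) hy'.2
    constructor <;> linarith

section entry
variable {α σ β θ m : ℝ} {bb : ℕ} {g g1 : LorenzMap α} {a b : ℕ} {p q : ℝ}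

theorem LorenzMap.toFun_mem (hα : 1 < α) (nt : g.IsNontrivial) {x : ℝ} (hx : x ∈ Icc (0:ℝ) 1) :
    g.toFun x ∈ Icc (0:ℝ) 1 := by
  rcases lt_or_ge x g.c with h | h
  · rw [g.toFun_left h]
    have := (g.gl_br hα nt).maps ⟨hx.1, h.le⟩
    exact ⟨this.1, this.2.trans g.cv1_le_one⟩
  · rw [g.toFun_right h]
    have := (g.gr_br hα nt).maps ⟨h, hx.2⟩
    exact ⟨g.cv0_nonneg.trans this.1, this.2⟩

theorem LorenzMap.iter_mem (hα : 1 < α) (nt : g.IsNontrivial) {x : ℝ} (hx : x ∈ Icc (0:ℝ) 1) (n : ℕ) :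
    g.toFun^[n] x ∈ Icc (0:ℝ) 1 :=
  iterate_maps (fun _ h => LorenzMap.toFun_mem hα nt h) n hx

theorem LorenzMap.g_ell (hα : 1 < α) (nt : g.IsNontrivial) {y : ℝ} (h0 : 0 ≤ y) (h1 : y < g.cv1) :
    g.toFun (g.ell y) = y := by
  have h := g.ell_mem hα nt h0 h1.le
  have h2 := (ell_iter_mem hα nt 0 h0 h1).2
  rw [Function.iterate_one] at h2
  rw [g.toFun_left h2, h.2.2]

theorem LorenzMap.g_rr (hα : 1 < α) (nt : g.IsNontrivial) {y : ℝ} (h0 : g.cv0 ≤ y) (h1 : y ≤ 1) :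
    g.toFun (g.rr y) = y := by
  have h := g.rr_mem hα nt h0 h1
  rw [g.toFun_right h.1, h.2.2]

theorem LorenzMap.g_ell_iter (hα : 1 < α) (nt : g.IsNontrivial) (j : ℕ) {y : ℝ} (h0 : 0 ≤ y)
    (h1 : y < g.cv1) : g.toFun^[j] (g.ell^[j] y) = y := by
  induction j with
  | zero => rfl
  | succ j ih =>
    have : 0 ≤ g.ell^[j] y ∧ g.ell^[j] y < g.cv1 := by
      cases j with
      | zero => exact ⟨h0, h1⟩
      | succ j => exact ⟨(ell_iter_mem hα nt j h0 h1).1, (ell_iter_mem hα nt j h0 h1).2.trans nt.2⟩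
    rw [Function.iterate_succ_apply, Function.iterate_succ_apply' g.ell,
      LorenzMap.g_ell hα nt this.1 this.2, ih]

theorem LorenzMap.g_rr_iter (hα : 1 < α) (nt : g.IsNontrivial) (j : ℕ) {y : ℝ} (h0 : g.cv0 ≤ y)
    (h1 : y ≤ 1) : g.toFun^[j] (g.rr^[j] y) = y := by
  induction j with
  | zero => rfl
  | succ j ih =>
    have := iterate_maps (g.rr_maps hα nt) j ⟨h0, h1⟩
    rw [Function.iterate_succ_apply, Function.iterate_succ_apply' g.rr,
      LorenzMap.g_rr hα nt this.1 this.2, ih]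

theorem LorenzMap.null_pre (hα : 1 < α) (nt : g.IsNontrivial) (pe : PS g.ell (Ioo 0 g.cv1))
    (pr : PS g.rr (Ioo g.cv0 1)) {Z : Set ℝ} (hZ : volume Z = 0) :
    volume {x | x ∈ Icc (0:ℝ) 1 ∧ g.toFun x ∈ Z} = 0 := by
  have n1 : volume (g.ell '' (Z ∩ Ioo 0 g.cv1)) = 0 :=
    addHaar_image_eq_zero_of_differentiableOn_of_addHaar_eq_zero volume
      (fun x hx => (pe.hasDeriv hx.2).differentiableAt.differentiableWithinAt)
      (measure_mono_null inter_subset_left hZ)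
  have n2 : volume (g.rr '' (Z ∩ Ioo g.cv0 1)) = 0 :=
    addHaar_image_eq_zero_of_differentiableOn_of_addHaar_eq_zero volume
      (fun x hx => (pr.hasDeriv hx.2).differentiableAt.differentiableWithinAt)
      (measure_mono_null inter_subset_left hZ)
  have n3 : volume ({0, g.c, 1} : Set ℝ) = 0 := (Set.toFinite _).measure_zero _
  refine measure_mono_null ?_ (measure_union_null (measure_union_null n1 n2) n3)
  rintro x ⟨hx, hz⟩
  by_cases h0 : x = 0
  · right; simp [h0]
  by_cases h1 : x = 1
  · right; simp [h1]
  by_cases h2 : x = g.c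
  · right; simp [h2]
  have hx0 : 0 < x := lt_of_le_of_ne hx.1 (Ne.symm h0)
  have hx1 : x < 1 := lt_of_le_of_ne hx.2 h1
  left
  rcases lt_trichotomy x g.c with h | h | h
  · left
    rw [g.toFun_left h] at hz
    exact ⟨g.gl x, ⟨hz, (g.gl_br hα nt).maps_Ioo ⟨hx0, h⟩⟩, (g.gl_br hα nt).inv_k ⟨hx0.le, h.le⟩⟩
  · exact absurd h h2
  · right
    rw [g.toFun_right h.le] at hz
    exact ⟨g.gr x, ⟨hz, (g.gr_br hα nt).maps_Ioo ⟨h, hx1⟩⟩, (g.gr_br hα nt).inv_k ⟨h.le, hx1.le⟩⟩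

theorem LorenzMap.null_pre_iter (hα : 1 < α) (nt : g.IsNontrivial) (pe : PS g.ell (Ioo 0 g.cv1))
    (pr : PS g.rr (Ioo g.cv0 1)) {Z : Set ℝ} (hZ : volume Z = 0) (n : ℕ) :
    volume {x | x ∈ Icc (0:ℝ) 1 ∧ g.toFun^[n] x ∈ Z} = 0 := by
  induction n with
  | zero => exact measure_mono_null (fun x hx => hx.2) hZ
  | succ n ih =>
    refine measure_mono_null ?_ (LorenzMap.null_pre hα nt pe pr ih)
    rintro x ⟨hx, hz⟩
    exact ⟨hx, LorenzMap.toFun_mem hα nt hx, hz⟩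
end entry

section entry2
variable {α σ β θ m : ℝ} {bb : ℕ} {g g1 : LorenzMap α} {a b : ℕ} {p q : ℝ}

def BadS (g : LorenzMap α) (p q : ℝ) : Set ℝ :=
  {x | x ∈ Icc (0:ℝ) 1 ∧ ∀ k, g.toFun^[k] x ∉ Icc p q}

theorem BadS.fwd (hα : 1 < α) (nt : g.IsNontrivial) {x : ℝ} (h : x ∈ BadS g p q) (n : ℕ) :
    g.toFun^[n] x ∈ BadS g p q :=
  ⟨LorenzMap.iter_mem hα nt h.1 n, fun k => by
    rw [← Function.iterate_add_apply]; exact h.2 _⟩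

theorem BadS.fwd1 (hα : 1 < α) (nt : g.IsNontrivial) {x : ℝ} (h : x ∈ BadS g p q) :
    g.toFun x ∈ BadS g p q := BadS.fwd hα nt h 1

theorem bad_rr (hα : 1 < α) (R : RD g g1 a b p q) : ∀ i : ℕ, ∀ y ∈ BadS g p q, q < y →
    y < g.rr^[i] p → ∃ i', 1 ≤ i' ∧ i' ≤ i ∧ ∃ w ∈ BadS g p q, g.gr q < w ∧ w < p ∧ g.rr^[i'] w = y := by
  have pq : p ∈ Icc p q := ⟨le_rfl, by linarith [R.hC]⟩
  have hB := g.gr_br hα R.nt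
  intro i
  induction i with
  | zero => intro y hy h1 h2; simp only [Function.iterate_zero, id] at h2; linarith [R.hC]
  | succ i ih =>
    intro y hy h1 h2
    obtain ⟨m1, m2⟩ := R.rr_c hα i pq
    have yc : y ∈ Icc g.c 1 := ⟨(R.cq.trans h1).le, hy.1.2⟩
    have hw := BadS.fwd1 hα R.nt hy
    rw [g.toFun_right yc.1] at hw
    have l1 := hB.mono ⟨R.cq.le, R.q1.le⟩ yc h1
    have l2 := hB.mono yc m1 h2
    rw [m2] at l2
    have e : g.rr (g.gr y) = y := hB.inv_k yc
    have hn := hw.2 0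
    simp only [Function.iterate_zero, id, mem_Icc, not_and, not_le] at hn
    rcases lt_or_ge (g.gr y) p with h | h
    · exact ⟨1, le_rfl, by omega, _, hw, l1, h, e⟩
    · obtain ⟨i', h1, h2, w, hw', h3, h4, h5⟩ := ih _ hw (hn h) l2
      exact ⟨i' + 1, by omega, by omega, w, hw', h3, h4, by
        rw [Function.iterate_succ_apply', h5, e]⟩

theorem bad_ell (hα : 1 < α) (R : RD g g1 a b p q) : ∀ j : ℕ, ∀ w ∈ BadS g p q,
    g.ell^[j + 1] q < w → w < p → ∃ j', j' ≤ j ∧ ∃ z ∈ BadS g p q, g.ell q < z ∧ z < p ∧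
      g.ell^[j'] z = w := by
  have pq : q ∈ Icc p q := ⟨by linarith [R.hC], le_rfl⟩
  have hB := g.gl_br hα R.nt
  intro j
  induction j with
  | zero => exact fun w hw h1 h2 => ⟨0, le_rfl, w, hw, h1, h2, rfl⟩
  | succ j ih =>
    intro w hw h1 h2
    obtain ⟨m1, m2⟩ := R.ell_c hα (j + 1) pq
    have wc : w ∈ Icc 0 g.c := ⟨hw.1.1, (h2.trans R.pc).le⟩
    rcases lt_trichotomy (g.ell q) w with h | h | h
    · exact ⟨0, by omega, w, hw, h, h2, rfl⟩
    · have := hw.2 1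
      rw [Function.iterate_one, ← h, LorenzMap.g_ell hα R.nt (by linarith [R.p0, R.hC]) R.qc] at this
      exact absurd pq this
    · have hz := BadS.fwd1 hα R.nt hw
      rw [g.toFun_left (h2.trans R.pc)] at hz
      have l1 := hB.mono ⟨m1.1, m1.2.le⟩ wc h1
      rw [m2] at l1
      have k1 := g.ell_mem hα R.nt (w := q) (by linarith [R.p0, R.hC]) R.qc.le
      have l2 := hB.mono wc ⟨k1.1, k1.2.1⟩ h
      rw [k1.2.2] at l2
      have e : g.ell (g.gl w) = w := hB.inv_k wc
      have hn := hz.2 0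
      simp only [Function.iterate_zero, id, mem_Icc, not_and, not_le] at hn
      have h3 : g.gl w < p := by
        by_contra hc
        exact absurd (hn (not_lt.1 hc)) (not_lt.2 l2.le)
      obtain ⟨j', h4, z, hz', h5, h6, h7⟩ := ih _ hz l1 h3
      exact ⟨j' + 1, by omega, z, hz', h5, h6, by rw [Function.iterate_succ_apply', h7, e]⟩

theorem LV.ell_lim (hα : 1 < α) (N : NumB α σ β θ m (nK bb) bb)
    (V : LV σ β θ m bb g g1 a b p q) {x : ℝ} (hx : 0 < x) : ∃ j, g.ell^[j + 1] q < x := by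
  have R := V.R
  have q0 : 0 ≤ q := by linarith [R.p0, R.hC]
  have e0 : ∀ n, g.ell^[n] 0 = 0 := fun n => Function.iterate_fixed (g.gl_br hα R.nt).inv_A n
  have hr : nK bb ^ 2 / α < 1 := by rw [div_lt_one (by linarith)]; exact N.K3
  have hr0 : 0 ≤ nK bb ^ 2 / α := by have := hα; positivity
  have hd : 0 < g.cv1 - q := by linarith [R.qc]
  obtain ⟨n, hn⟩ := exists_pow_lt_of_lt_one (mul_pos hx hd) hr
  refine ⟨n, ?_⟩
  have h1 := V.H.ell_up hα R.nt N.K1 le_rfl q0 R.qc n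
  have hm := ell_iter_mem hα R.nt n q0 R.qc
  rw [e0, sub_zero, sub_zero] at h1
  have hz : q * g.Z (g.ell^[n + 1] q) ≤ 1 :=
    mul_le_one₀ R.q1.le (LorenzMap.Z_nonneg hm.2.le) (LorenzMap.Z_le_one hm.1)
  have h2 : (nK bb ^ 2 / α) ^ (n + 1) ≤ (nK bb ^ 2 / α) ^ n :=
    pow_le_pow_of_le_one hr0 hr.le (by omega)
  have h3 : (nK bb ^ 2 / α) ^ (n + 1) * (q * g.Z (g.ell^[n + 1] q)) ≤ (nK bb ^ 2 / α) ^ (n + 1) :=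
    mul_le_of_le_one_right (by positivity) hz
  exact lt_of_mul_lt_mul_right (by linarith) hd.le

theorem LV.rr_lim (hα : 1 < α) (N : NumB α σ β θ m (nK bb) bb)
    (V : LV σ β θ m bb g g1 a b p q) {x : ℝ} (hx : x < 1) : ∃ j, x < g.rr^[j] p := by
  have R := V.R
  have E := N.he _ V.lo V.hi
  have m0 := N.m0
  have e0 : ∀ n, g.rr^[n] 1 = 1 := fun n => Function.iterate_fixed (g.gr_br hα R.nt).inv_B n
  obtain ⟨n, hn⟩ := exists_pow_lt_of_lt_one (show 0 < 1 - x by linarith) (show (1/2:ℝ) < 1 by norm_num)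
  refine ⟨n, ?_⟩
  have hε : 0 ≤ 1 - g.c := by linarith [g.hc.2]
  have h := V.H.rr_upper_iter hα V.R.nt N.K1 N.K2 m0 V.hm (by linarith [V.out.o3]) n (w := p)
      (w' := 1) (by linarith [V.out.o2]) (by linarith [R.pc, g.hc.2]) le_rfl
  rw [e0] at h
  have h2 : (16 / m ^ 2 * (1 - g.c)) ^ n ≤ (1 / 2) ^ n := pow_le_pow_left₀ (by positivity) E.e4 n
  have h3 : (16 / m ^ 2 * (1 - g.c)) ^ n * (1 - p) ≤ (16 / m ^ 2 * (1 - g.c)) ^ n :=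
    mul_le_of_le_one_right (by positivity) (by linarith [R.p0])
  linarith

theorem LV.bad_null (hα : 1 < α) (N : NumB α σ β θ m (nK bb) bb)
    (V : LV σ β θ m bb g g1 a b p q)
    (hX : volume (BadS g p q ∩ Icc (g.ell q) p) = 0) : volume (BadS g p q) = 0 := by
  have R := V.R
  have nt := R.nt
  set X := BadS g p q ∩ Icc (g.ell q) p with hXd
  have hZ : volume (X ∪ {0, 1}) = 0 := measure_union_null hX ((Set.toFinite _).measure_zero _)
  have hn := fun n => LorenzMap.null_pre_iter hα nt V.lev.1 V.lev.2.1 hZ n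
  refine measure_mono_null ?_ (measure_iUnion_null hn)
  intro x hx
  have hx1 := hx.1
  have q0 : 0 ≤ q := by linarith [R.p0, R.hC]
  have low : ∀ w ∈ BadS g p q, 0 < w → w < p → ∃ n, g.toFun^[n] w ∈ X := by
    intro w hw h0 h1
    obtain ⟨j, hj⟩ := V.ell_lim hα N h0
    obtain ⟨j', -, z, hz, h2, h3, h4⟩ := bad_ell hα R j w hw hj h1
    refine ⟨j', ?_⟩
    rw [← h4, LorenzMap.g_ell_iter hα nt j' hz.1.1 (by linarith [R.pc, nt.2])]
    exact ⟨hz, h2.le, h3.le⟩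
  have h0 := hx.2 0
  simp only [Function.iterate_zero, id, mem_Icc, not_and, not_le] at h0
  rw [mem_iUnion]
  by_cases e0 : x = 0
  · exact ⟨0, hx1, Or.inr (by simp [e0])⟩
  by_cases e1 : x = 1
  · exact ⟨0, hx1, Or.inr (by simp [e1])⟩
  have x0 : 0 < x := lt_of_le_of_ne hx1.1 (Ne.symm e0)
  have x1 : x < 1 := lt_of_le_of_ne hx1.2 e1
  rcases lt_or_ge x p with h | h
  · obtain ⟨n, hn⟩ := low x hx x0 h
    exact ⟨n, hx1, Or.inl hn⟩
  · obtain ⟨i, hi⟩ := V.rr_lim hα N x1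
    obtain ⟨i', -, -, w, hw, h2, h3, h4⟩ := bad_rr hα R i x hx (h0 h) hi
    have gq : g.cv0 ≤ g.gr q := ((g.gr_br hα nt).maps ⟨R.cq.le, R.q1.le⟩).1
    have := g.cv0_nonneg
    obtain ⟨n, hn⟩ := low w hw (by linarith) h3
    refine ⟨n + i', hx1, Or.inl ?_⟩
    rw [Function.iterate_add_apply, ← h4, LorenzMap.g_rr_iter hα nt i' (by linarith) hw.1.2]
    exact hn
end entry2

section entry3
variable {α σ β θ m : ℝ} {bb : ℕ} {g g1 : LorenzMap α} {a b : ℕ} {p q : ℝ}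

theorem LV.X_null (hα : 1 < α) (N : NumB α σ β θ m (nK bb) bb)
    (V : LV σ β θ m bb g g1 a b p q) : volume (BadS g p q ∩ Icc (g.ell q) p) = 0 := by
  have R := V.R
  have nt := R.nt
  have hL := g.gl_br hα nt
  have hR := g.gr_br hα nt
  have p0 := R.p0
  have pc := R.pc
  have cq := R.cq
  have q1 := R.q1
  have cp := R.cp
  have qc := R.qc
  have c0 := g.cv0_nonneg
  have c1 := g.cv1_le_one
  have ha := R.ha
  have hb2 : 2 ≤ b := by
    have h1 : (bb:ℝ) ≤ (b:ℝ) := V.om.2.2.2.2.1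
    have h2 : bb ≤ b := by exact_mod_cast h1
    have := N.bb3
    omega
  have pI : p ∈ Icc p q := ⟨le_rfl, by linarith⟩
  have qI : q ∈ Icc p q := ⟨by linarith, le_rfl⟩
  have eM : ∀ n, StrictMonoOn g.ell^[n] (Icc 0 g.cv1) := fun n =>
    iterate_mono hL.inv_mono (g.ell_maps hα nt) n
  have rM : ∀ n, StrictMonoOn g.rr^[n] (Icc g.cv0 1) := fun n =>
    iterate_mono hR.inv_mono (g.rr_maps hα nt) n
  have eI : ∀ n, ∀ x ∈ Icc 0 g.cv1, g.ell^[n] x ∈ Icc 0 g.cv1 := fun n x hx =>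
    iterate_maps (g.ell_maps hα nt) n hx
  have rI : ∀ n, ∀ x ∈ Icc g.cv0 1, g.rr^[n] x ∈ Icc g.cv0 1 := fun n x hx =>
    iterate_maps (g.rr_maps hα nt) n hx
  have eD : ∀ x ∈ Icc 0 g.cv1, g.ell x ≤ x → ∀ j k, j ≤ k → g.ell^[k] x ≤ g.ell^[j] x := by
    intro x hx h j k hjk
    induction k, hjk using Nat.le_induction with
    | base => exact le_rfl
    | succ k hk ih =>
      refine le_trans ?_ ih
      rw [Function.iterate_succ_apply]
      exact (eM k).monotoneOn (eI 1 x hx) hx h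
  have rU : ∀ x ∈ Icc g.cv0 1, x ≤ g.rr x → ∀ j k, j ≤ k → g.rr^[j] x ≤ g.rr^[k] x := by
    intro x hx h j k hjk
    induction k, hjk using Nat.le_induction with
    | base => exact le_rfl
    | succ k hk ih =>
      refine le_trans ih ?_
      rw [Function.iterate_succ_apply]
      exact (rM k).monotoneOn hx (rI 1 x hx) h
  have pE : p ∈ Icc 0 g.cv1 := ⟨p0.le, by linarith⟩
  have qE : q ∈ Icc 0 g.cv1 := ⟨by linarith, qc.le⟩
  have pR : p ∈ Icc g.cv0 1 := ⟨cp.le, by linarith⟩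
  have qR : q ∈ Icc g.cv0 1 := ⟨by linarith, q1.le⟩
  have cR : g.c ∈ Icc g.cv0 1 := ⟨nt.1.le, g.hc.2.le⟩
  have cE : g.c ∈ Icc 0 g.cv1 := ⟨g.hc.1.le, nt.2.le⟩
  have hε : 0 < 1 - g.c := by linarith [g.hc.2]
  have gap : ∀ n, q < g.rr^[n + 1] p := fun n => by
    have := V.rr_gap hα N n
    have : 0 < (1 - g.c) / (8 * α) := by positivity
    linarith
  have qrap : q < g.rr^[a] p := by
    have := gap (a - 1); rwa [show a - 1 + 1 = a by omega] at this
  have glp := R.gl_p hα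
  have e_glp : g.ell (g.rr^[a] p) = p := by
    rw [← glp]; exact hL.inv_k ⟨p0.le, pc.le⟩
  have rapE : g.rr^[a] p ∈ Icc 0 g.cv1 := by
    rw [← glp]; exact hL.maps ⟨p0.le, pc.le⟩
  have eqp : g.ell q < p := by
    rw [← e_glp]; exact hL.inv_mono qE rapE qrap
  have epp : g.ell p ≤ p := by
    have := hL.inv_mono.monotoneOn pE qE (by linarith)
    exact this.trans eqp.le
  have eqq : g.ell q ≤ q := by linarith
  have prp : p ≤ g.rr p := by have := gap 0; rw [Function.iterate_one] at this; linarith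
  have gq := R.gr_q hα
  have gqm := hR.maps ⟨cq.le, q1.le⟩
  have rgq : g.rr (g.gr q) = q := hR.inv_k ⟨cq.le, q1.le⟩
  have gqp := R.grq
  have gqR : g.gr q ∈ Icc g.cv0 1 := gqm
  have qrq : q ≤ g.rr q := by
    have := hR.inv_mono.monotoneOn gqR qR (by linarith)
    rwa [show binv g.gr g.c 1 (g.gr q) = q from rgq] at this
  have crc : g.c ≤ g.rr g.c := (hR.inv_mem cR).1
  set t := p + (q - p) * g1.cv0 with ht
  have tm := R.t_mem
  rw [← ht] at tm
  have tE : t ∈ Icc 0 g.cv1 := ⟨by linarith [tm.1], by linarith [tm.2, nt.2]⟩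
  have ett : g.ell t ≤ t := by
    have := hL.inv_mono.monotoneOn tE qE (by linarith [tm.2])
    have h2 : g.ell t ≤ g.ell q := this
    linarith [tm.1]
  have cv0t := R.cv0_eq hα
  rw [← ht] at cv0t
  have et0 : 0 ≤ g.ell t := (eI 1 t tE).1
  set s := p + (q - p) * g1.cv1 with hs
  have sm := R.s_mem
  rw [← hs] at sm
  have rac : g.rr^[a] g.c < g.cv1 := by
    rw [R.cv1_eq hα]; exact (rM a) cR ⟨by linarith [sm.1, nt.1], by linarith [sm.2]⟩ sm.1
  have J1 : ∀ x ∈ Ioo (g.ell t) g.c, ∀ j < b, g.ell^[j] x ∈ Ioo g.cv0 g.c := by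
    intro x hx j hj
    have xE : x ∈ Icc 0 g.cv1 := ⟨by linarith [hx.1], by linarith [hx.2, nt.2]⟩
    constructor
    · have h1 := eM j (eI 1 t tE) xE hx.1
      rw [Function.iterate_one, ← Function.iterate_succ_apply] at h1
      have := eD t tE ett (j + 1) b (by omega)
      linarith
    · have h1 := eM j xE cE hx.2
      exact h1.trans_le (RD.ell_le hα nt j ⟨g.hc.1.le, le_rfl⟩).2
  have J2 : ∀ w ∈ Ioo g.cv0 g.c, ∀ i, 1 ≤ i → i ≤ a → g.rr^[i] w ∈ Ico g.c g.cv1 := by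
    intro w hw i h1 h2
    have wR : w ∈ Icc g.cv0 1 := ⟨hw.1.le, by linarith [hw.2, g.hc.2]⟩
    constructor
    · obtain ⟨k, rfl⟩ : ∃ k, i = k + 1 := ⟨i - 1, by omega⟩
      rw [Function.iterate_succ_apply']
      exact (hR.inv_mem (rI k w wR)).1
    · exact ((rM i).monotoneOn wR cR hw.2.le).trans_lt ((rU g.c cR crc i a h2).trans_lt rac)
  have I1 : ∀ x ∈ Icc (g.ell q) p, ∀ j < b, g.ell^[j] x ∈ Icc (g.gr q) p := by
    intro x hx j hj
    have xE : x ∈ Icc 0 g.cv1 := ⟨(eI 1 q qE).1.trans hx.1, hx.2.trans pE.2⟩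
    constructor
    · have h1 := (eM j).monotoneOn (eI 1 q qE) xE hx.1
      rw [Function.iterate_one, ← Function.iterate_succ_apply] at h1
      have := eD q qE eqq (j + 1) b (by omega)
      rw [gq]; linarith
    · exact ((eM j).monotoneOn xE pE hx.2).trans (eD p pE epp 0 j (by omega))
  have I2 : ∀ w ∈ Icc (g.gr q) p, ∀ i, 1 ≤ i → i ≤ a → g.rr^[i] w ∈ Icc q (g.rr^[a] p) := by
    intro w hw i h1 h2
    have wR : w ∈ Icc g.cv0 1 := ⟨gqR.1.trans hw.1, hw.2.trans pR.2⟩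
    constructor
    · obtain ⟨k, rfl⟩ : ∃ k, i = k + 1 := ⟨i - 1, by omega⟩
      rw [Function.iterate_succ_apply]
      have h3 := hR.inv_mono.monotoneOn gqR wR hw.1
      rw [show binv g.gr g.c 1 (g.gr q) = q from rgq] at h3
      have h4 := (rM k).monotoneOn qR (rI 1 w wR) h3
      exact (rU q qR qrq 0 k (by omega)).trans h4
    · exact ((rM i).monotoneOn wR pR hw.2).trans (rU p pR prp i a h2)
  let ι := {ij : ℕ × ℕ // 1 ≤ ij.1 ∧ ij.1 ≤ a ∧ ij.2 < b}
  let S : ι → ℝ → ℝ := fun ij => g.ell ∘ (g.rr^[ij.1.1] ∘ g.ell^[ij.1.2])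
  have IE : ∀ x ∈ Icc q (g.rr^[a] p), g.ell x ∈ Icc (g.ell q) p := by
    intro x hx
    have xE : x ∈ Icc 0 g.cv1 := ⟨by linarith [hx.1], hx.2.trans rapE.2⟩
    refine ⟨hL.inv_mono.monotoneOn qE xE hx.1, ?_⟩
    have h := hL.inv_mono.monotoneOn xE rapE hx.2
    exact h.trans_eq e_glp
  have mI : ∀ ij : ι, ∀ x ∈ Icc (g.ell q) p, S ij x ∈ Icc (g.ell q) p := fun ij x hx =>
    IE _ (I2 _ (I1 x hx _ ij.2.2.2) _ ij.2.1 ij.2.2.1)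
  have epq : g.ell p < g.ell q := hL.inv_mono pE qE (by linarith)
  have qX : g.ell q ∈ Icc (g.ell q) p := ⟨le_rfl, eqp.le⟩
  have pX : p ∈ Icc (g.ell q) p := ⟨eqp.le, le_rfl⟩
  have mep : g.ell p ∈ Icc (g.gr q) p := I1 p pX 1 (by omega)
  have meq : g.ell q ∈ Icc (g.gr q) p := I1 _ qX 0 (by omega)
  have sR : ∀ x ∈ Icc (g.gr q) p, x ∈ Icc g.cv0 1 := fun x hx =>
    ⟨gqR.1.trans hx.1, hx.2.trans pR.2⟩
  have sE : ∀ x ∈ Icc q (g.rr^[a] p), x ∈ Icc 0 g.cv1 := fun x hx =>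
    ⟨by linarith [hx.1], hx.2.trans rapE.2⟩
  have m1 : g.rr (g.ell p) ∈ Icc q (g.rr^[a] p) := I2 _ mep 1 le_rfl ha
  have m2 : g.rr (g.ell q) ∈ Icc q (g.rr^[a] p) := I2 _ meq 1 le_rfl ha
  have m12 : g.rr (g.ell p) < g.rr (g.ell q) := hR.inv_mono (sR _ mep) (sR _ meq) epq
  have m3 := IE _ m1
  have m4 := IE _ m2
  have tq : g.ell t < g.ell q := hL.inv_mono tE qE (by linarith [tm.2])
  have toJ : ∀ x ∈ Icc (g.ell q) p, x ∈ Ioo (g.ell t) g.c := fun x hx =>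
    ⟨by linarith [hx.1], by linarith [hx.2]⟩
  refine null_of_ifs (A := g.ell t) (l := g.ell q) (r := p) (B := g.c)
    (u := g.ell (g.rr (g.ell p))) (v := g.ell (g.rr (g.ell q))) tq eqp pc (s := S) ?_ ?_ mI
    inter_subset_right ?_ ?_ m3.1 (hL.inv_mono (sE _ m1) (sE _ m2) m12) m4.2 ?_ ?_
  · rintro ⟨⟨i, j⟩, h1, h2, h3⟩
    have P1 : PS (g.ell^[j]) (Ioo (g.ell t) g.c) := by
      refine (V.lev.1.iter (fun x hx => ?_) j).mono (fun x hx => ⟨by linarith [hx.1], by linarith [hx.2, nt.2]⟩)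
      have := hL.inv_Ioo hx
      exact ⟨this.1, this.2.trans nt.2⟩
    have P2 : PS (g.rr^[i]) (Ioo g.cv0 1) := by
      refine V.lev.2.1.iter (fun x hx => ?_) i
      have := hR.inv_Ioo hx
      exact ⟨nt.1.trans this.1, this.2⟩
    have P3 := P2.comp P1 (fun x hx => by
      have := J1 x hx j h3
      exact ⟨this.1, this.2.trans g.hc.2⟩)
    exact V.lev.1.comp P3 (fun x hx => by
      have := J2 _ (J1 x hx j h3) i h1 h2
      exact ⟨g.hc.1.trans_le this.1, this.2⟩)
  · rintro ⟨⟨i, j⟩, h1, h2, h3⟩ x hx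
    have := J2 _ (J1 x hx j h3) i h1 h2
    have yE : g.rr^[i] (g.ell^[j] x) ∈ Icc 0 g.cv1 := ⟨g.hc.1.le.trans this.1, this.2.le⟩
    constructor
    · exact hL.inv_mono tE yE (lt_of_lt_of_le tm.2 this.1)
    · have h5 := (ell_iter_mem hα nt 0 yE.1 this.2).2
      exact h5
  · rintro x ⟨hx, hx1, hx2⟩
    have x1 : x ≠ p := by
      rintro rfl
      exact hx.2 0 pI
    have x2 : x ≠ g.ell q := by
      rintro rfl
      apply hx.2 1
      rw [Function.iterate_one, LorenzMap.g_ell hα nt qE.1 qc]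
      exact qI
    have xp : x < p := lt_of_le_of_ne hx2 x1
    have xq : g.ell q < x := lt_of_le_of_ne hx1 (Ne.symm x2)
    have xc : x ∈ Icc 0 g.c := ⟨hx.1.1, (xp.trans pc).le⟩
    have hy := BadS.fwd1 hα nt hx
    rw [g.toFun_left (xp.trans pc)] at hy
    have k1 := g.ell_mem hα nt qE.1 qE.2
    have y1 := hL.mono ⟨k1.1, k1.2.1⟩ xc xq
    rw [k1.2.2] at y1
    have y2 := hL.mono xc ⟨p0.le, pc.le⟩ xp
    rw [glp] at y2
    obtain ⟨i, i1, i2, w, hw, w1, w2, w3⟩ := bad_rr hα R a _ hy y1 y2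
    rw [gq] at w1
    obtain ⟨j, j1, z, hz, z1, z2, z3⟩ := bad_ell hα R (b - 1) w hw
      (by rwa [show b - 1 + 1 = b by omega]) w2
    refine ⟨⟨(i, j), i1, i2, by omega⟩, z, ⟨hz, z1.le, z2.le⟩, ?_⟩
    change g.ell (g.rr^[i] (g.ell^[j] z)) = x
    rw [z3, w3]
    exact hL.inv_k xc
  · rintro ⟨⟨i, j⟩, h1, h2, h3⟩ z hz h
    refine ⟨?_, hz⟩
    have zJ := toJ z hz
    have w1 := J1 z zJ j h3
    have w2 := J2 _ w1 i h1 h2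
    have z0 : 0 ≤ z := by linarith [zJ.1]
    have e : g.toFun^[j + (i + 1)] (g.ell (g.rr^[i] (g.ell^[j] z))) = z := by
      rw [Function.iterate_add_apply, Function.iterate_succ_apply,
        LorenzMap.g_ell hα nt (g.hc.1.le.trans w2.1) w2.2,
        LorenzMap.g_rr_iter hα nt i w1.1.le (by linarith [w1.2]),
        LorenzMap.g_ell_iter hα nt j z0 (by linarith [zJ.2, nt.2])]
    have h5 := BadS.fwd hα nt h.1 (j + (i + 1))
    change g.toFun^[j + (i + 1)] (g.ell (g.rr^[i] (g.ell^[j] z))) ∈ _ at h5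
    rwa [e] at h5
  · rintro ⟨⟨i, j⟩, h1, h2, h3⟩
    have A1 := I1 p pX j h3
    have A2 := I1 _ qX j h3
    have B1 := I2 _ A1 i h1 h2
    have B2 := I2 _ A2 i h1 h2
    by_cases hi : i = 1
    · subst hi
      by_cases hj : j = 0
      · subst hj
        exact Or.inr le_rfl
      · left
        exact hL.inv_mono.monotoneOn (sE _ B1) (sE _ m1)
          (hR.inv_mono.monotoneOn (sR _ A1) (sR _ mep) (eD p pE epp 1 j (by omega)))
    · right
      obtain ⟨k, rfl⟩ : ∃ k, i = k + 2 := ⟨i - 2, by omega⟩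
      refine hL.inv_mono.monotoneOn (sE _ m2) (sE _ B2) ?_
      have B3 := I2 _ A2 (k + 1) (by omega) (by omega)
      change g.rr (g.ell q) ≤ g.rr^[(k + 1) + 1] (g.ell^[j] (g.ell q))
      rw [Function.iterate_succ_apply']
      exact hR.inv_mono.monotoneOn (sR _ meq) (rI _ _ (sR _ A2)) (by linarith [B3.1])
  · intro z hz h
    have zX := h.2
    apply h.1.2 3
    have zc : z ∈ Icc 0 g.c := ⟨h.1.1.1, by linarith [zX.2]⟩
    have k1 := g.ell_mem hα nt (sE _ m1).1 (sE _ m1).2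
    have k2 := g.ell_mem hα nt (sE _ m2).1 (sE _ m2).2
    have a1 := hL.mono ⟨k1.1, k1.2.1⟩ zc hz.1
    have a2 := hL.mono zc ⟨k2.1, k2.2.1⟩ hz.2
    rw [k1.2.2] at a1
    rw [k2.2.2] at a2
    have yc : g.c ≤ g.gl z := by linarith [m1.1]
    have k3 := g.rr_mem hα nt (sR _ mep).1 (sR _ mep).2
    have k4 := g.rr_mem hα nt (sR _ meq).1 (sR _ meq).2
    have yc1 : g.gl z ∈ Icc g.c 1 := ⟨yc, a2.le.trans k4.2.1⟩
    have b1 := hR.mono ⟨k3.1, k3.2.1⟩ yc1 a1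
    have b2 := hR.mono yc1 ⟨k4.1, k4.2.1⟩ a2
    rw [k3.2.2] at b1
    rw [k4.2.2] at b2
    have k5 := g.ell_mem hα nt pE.1 pE.2
    have k6 := g.ell_mem hα nt qE.1 qE.2
    have wc : g.gr (g.gl z) ∈ Icc 0 g.c := ⟨k5.1.trans b1.le, by linarith⟩
    have d1 := hL.mono ⟨k5.1, k5.2.1⟩ wc b1
    have d2 := hL.mono wc ⟨k6.1, k6.2.1⟩ b2
    rw [k5.2.2] at d1
    rw [k6.2.2] at d2
    rw [Function.iterate_succ_apply, Function.iterate_succ_apply, Function.iterate_one,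
      g.toFun_left (by linarith [zX.2] : z < g.c), g.toFun_right yc,
      g.toFun_left (by linarith : g.gr (g.gl z) < g.c)]
    exact ⟨d1.le, d2.le⟩

theorem LV.entry (hα : 1 < α) (N : NumB α σ β θ m (nK bb) bb)
    (V : LV σ β θ m bb g g1 a b p q) : volume (BadS g p q) = 0 :=
  V.bad_null hα N (V.X_null hα N)
end entry3

section attr
variable {α σ β θ m : ℝ} {bb : ℕ} {g g1 : LorenzMap α} {a b : ℕ} {p q : ℝ}

def Attr (g : LorenzMap α) (ρ : ℝ) (k : ℕ) (y : ℝ) : Prop :=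
  ∀ s x, Orb g (PT g y) s x → Metric.infDist x {z | Orb g (CS g) s z} ≤ ρ ^ k

theorem orb_start (g : LorenzMap α) (s : Bool) : (if s then g.cv0 else g.cv1) ∈ {z | Orb g (CS g) s z} :=
  Orb.start rfl

theorem Attr.zero (hα : 1 < α) (nt : g.IsNontrivial) (ρ : ℝ) {y : ℝ} (hy : y ∈ Icc (0:ℝ) 1) :
    Attr g ρ 0 y := by
  intro s x h
  have h1 := h.mem hα nt (fun s x h => PT.mem hα nt hy h)
  have h2 := CS.mem (g := g) (s := s) rfl nt
  refine (Metric.infDist_le_dist_of_mem (orb_start g s)).trans ?_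
  rw [Real.dist_eq, abs_le, pow_zero]
  constructor <;> linarith [h1.1, h1.2, h2.1, h2.2]

theorem Attr.step (hα : 1 < α) (N : NumB α σ β θ m (nK bb) bb)
    (V : LV σ β θ m bb g g1 a b p q) {k : ℕ} {y : ℝ} (hy : y ∈ Icc (0:ℝ) 1)
    (h : Attr g1 ((bb:ℝ) ^ 4)⁻¹ k y) : Attr g ((bb:ℝ) ^ 4)⁻¹ (k + 1) (p + (q - p) * y) := by
  intro s x hx
  have R := V.R
  have b3 : (3:ℝ) ≤ bb := by exact_mod_cast N.bb3
  set ρ := ((bb:ℝ) ^ 4)⁻¹ with hρ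
  have ρ0 : 0 ≤ ρ := by positivity
  have ρ1 : ρ ≤ 1 := inv_le_one_of_one_le₀ (one_le_pow₀ (by linarith))
  have m1 : ∀ s x, PT g1 y s x → x ∈ Icc (0:ℝ) 1 := fun s x h => PT.mem hα R.nt1 hy h
  have F := hx.form hα R m1 (fun s x h => PT.form hα R hy h)
  have mo : ∀ s x, Orb g1 (CS g1) s x → x ∈ Icc (0:ℝ) 1 := fun s x h =>
    h.mem hα R.nt1 (fun s x h => CS.mem h R.nt1)
  apply le_of_forall_pos_le_add
  intro ε hε
  have key : ∀ (s' : Bool) (y' : ℝ) (K : ℝ → ℝ), Orb g1 (PT g1 y) s' y' → x = K y' →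
      (∀ z, Orb g1 (CS g1) s' z → Orb g (CS g) s (K z) ∧ |K y' - K z| ≤ ρ * |y' - z|) →
      Metric.infDist x {z | Orb g (CS g) s z} ≤ ρ ^ (k + 1) + ε := by
    intro s' y' K ho e hK
    have h1 : Metric.infDist y' {z | Orb g1 (CS g1) s' z} < ρ ^ k + ε := by linarith [h s' y' ho]
    obtain ⟨z, hz, hd⟩ := (Metric.infDist_lt_iff ⟨_, orb_start g1 s'⟩).1 h1
    obtain ⟨k1, k2⟩ := hK z hz
    refine (Metric.infDist_le_dist_of_mem (show K z ∈ _ from k1)).trans ?_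
    rw [Real.dist_eq] at hd ⊢
    rw [e]
    have : ρ * |y' - z| ≤ ρ * (ρ ^ k + ε) := mlL hd.le ρ0
    have h3 : ρ * ε ≤ ε := mul_le_of_le_one_left hε.le ρ1
    rw [pow_succ]
    nlinarith
  rcases F with ⟨j, y', hj, hs, ho, e⟩ | ⟨i, y', hi, hs, ho, e⟩
  · refine key true y' (fun z => g.ell^[j] (p + (q - p) * z)) ho e (fun z hz => ⟨?_, ?_⟩)
    · rw [hs]; exact (hz.lift hα R).2 rfl j hj
    · exact V.ell_lip hα N hj (ho.mem hα R.nt1 m1) (mo _ _ hz)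
  · refine key false y' (fun z => g.rr^[i] (p + (q - p) * z)) ho e (fun z hz => ⟨?_, ?_⟩)
    · rw [hs]; exact (hz.lift hα R).1 rfl i hi
    · exact V.rr_lip hα N i (ho.mem hα R.nt1 m1) (mo _ _ hz)

theorem RD.semi (hα : 1 < α) (R : RD g g1 a b p q) {y : ℝ} (hy : y ∈ Icc (0:ℝ) 1) :
    ∃ n, g.toFun^[n] (p + (q - p) * y) = p + (q - p) * g1.toFun y := by
  have hm := R.h_mem (LorenzMap.toFun_mem hα R.nt1 hy)
  have hC := R.hC
  have hcc := R.hcc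
  rcases lt_or_ge y g1.c with h | h
  · refine ⟨a + 1, ?_⟩
    rw [g1.toFun_left h] at hm ⊢
    rw [Function.iterate_succ_apply, g.toFun_left (by rw [← hcc]; nlinarith), R.conjL y ⟨hy.1, h.le⟩,
      LorenzMap.g_rr_iter hα R.nt a (by linarith [hm.1, R.cp]) (by linarith [hm.2, R.q1])]
  · refine ⟨b + 1, ?_⟩
    rw [g1.toFun_right h] at hm ⊢
    rw [Function.iterate_succ_apply, g.toFun_right (by rw [← hcc]; nlinarith), R.conjR y ⟨h, hy.2⟩,
      LorenzMap.g_ell_iter hα R.nt b (by linarith [hm.1, R.p0]) (by linarith [hm.2, R.qc])]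

theorem RD.semi_iter (hα : 1 < α) (R : RD g g1 a b p q) {y : ℝ} (hy : y ∈ Icc (0:ℝ) 1) (i : ℕ) :
    ∃ n, g.toFun^[n] (p + (q - p) * y) = p + (q - p) * g1.toFun^[i] y := by
  induction i with
  | zero => exact ⟨0, rfl⟩
  | succ i ih =>
    obtain ⟨n, hn⟩ := ih
    obtain ⟨n', hn'⟩ := R.semi hα (LorenzMap.iter_mem hα R.nt1 hy i)
    exact ⟨n' + n, by rw [Function.iterate_add_apply, hn, hn', Function.iterate_succ_apply']⟩

def CC (p q : ℕ → ℝ) : ℕ → ℕ → Set ℝ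
  | _, 0 => Icc 0 1
  | k, n + 1 => (fun y => p k + (q k - p k) * y) '' CC p q (k + 1) n

variable {G : ℕ → LorenzMap α} {P Q : ℕ → ℝ} {ω : ℕ → ℕ × ℕ}

theorem CC.attr (hα : 1 < α) (N : NumB α σ β θ m (nK bb) bb)
    (V : ∀ n, LV σ β θ m bb (G n) (G (n + 1)) (ω n).1 (ω n).2 (P n) (Q n)) (n : ℕ) :
    ∀ k, ∀ z ∈ CC P Q k n, z ∈ Icc (0:ℝ) 1 ∧ Attr (G k) ((bb:ℝ) ^ 4)⁻¹ n z := by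
  induction n with
  | zero => exact fun k z hz => ⟨hz, Attr.zero hα (V k).R.nt _ hz⟩
  | succ n ih =>
    rintro k z ⟨y, hy, rfl⟩
    obtain ⟨h1, h2⟩ := ih (k + 1) y hy
    have R := (V k).R
    have := R.h_mem h1
    exact ⟨⟨by linarith [this.1, R.p0], by linarith [this.2, R.q1]⟩, h2.step hα N (V k) h1⟩

theorem CC.entry (hα : 1 < α) (N : NumB α σ β θ m (nK bb) bb)
    (V : ∀ n, LV σ β θ m bb (G n) (G (n + 1)) (ω n).1 (ω n).2 (P n) (Q n)) (n : ℕ) :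
    ∀ k, volume {x | x ∈ Icc (0:ℝ) 1 ∧ ∀ j, (G k).toFun^[j] x ∉ CC P Q k n} = 0 := by
  induction n with
  | zero =>
    intro k
    refine measure_mono_null (t := ∅) ?_ measure_empty
    rintro x ⟨hx, h⟩
    exact absurd hx (h 0)
  | succ n ih =>
    intro k
    have R := (V k).R
    have hC := R.hC
    set Bd := {x | x ∈ Icc (0:ℝ) 1 ∧ ∀ j, (G (k + 1)).toFun^[j] x ∉ CC P Q (k + 1) n} with hBd
    have n1 : volume ((fun y => P k + (Q k - P k) * y) '' Bd) = 0 :=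
      addHaar_image_eq_zero_of_differentiableOn_of_addHaar_eq_zero volume (by fun_prop) (ih (k + 1))
    refine measure_mono_null ?_ (measure_union_null ((V k).entry hα N)
      (measure_iUnion_null fun j => LorenzMap.null_pre_iter hα R.nt (V k).lev.1 (V k).lev.2.1 n1 j))
    rintro x ⟨hx, h⟩
    by_cases hb : x ∈ BadS (G k) (P k) (Q k)
    · exact Or.inl hb
    right
    simp only [BadS, mem_ofPred_eq, not_and, not_forall, not_not] at hb
    obtain ⟨j, hj⟩ := hb hx
    rw [mem_iUnion]
    refine ⟨j, hx, ((G k).toFun^[j] x - P k) / (Q k - P k), ?_, ?_⟩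
    · set y := ((G k).toFun^[j] x - P k) / (Q k - P k) with hy
      have e : P k + (Q k - P k) * y = (G k).toFun^[j] x := by
        rw [hy]; field_simp; ring
      have yI : y ∈ Icc (0:ℝ) 1 :=
        ⟨div_nonneg (by linarith [hj.1]) hC.le, by rw [hy, div_le_one hC]; linarith [hj.2]⟩
      refine ⟨yI, fun i hi => ?_⟩
      obtain ⟨n', hn'⟩ := R.semi_iter hα yI i
      apply h (n' + j)
      rw [Function.iterate_add_apply, ← e, hn']
      exact ⟨_, hi, rfl⟩
    · simp only; field_simp; ring

theorem attract (hα : 1 < α) (N : NumB α σ β θ m (nK bb) bb)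
    (V : ∀ n, LV σ β θ m bb (G n) (G (n + 1)) (ω n).1 (ω n).2 (P n) (Q n)) {Λ : Set ℝ}
    (hΛ : {x | Orb (G 0) (CS (G 0)) true x} ∪ {x | Orb (G 0) (CS (G 0)) false x} ⊆ Λ) :
    ∀ᵐ x ∂(volume : Measure ℝ), x ∈ Icc (0 : ℝ) 1 →
      Tendsto (fun k => Metric.infDist ((G 0).toFun^[k] x) Λ) atTop (𝓝 0) := by
  have H : ∀ᵐ x ∂(volume : Measure ℝ), ∀ n, ¬ (x ∈ Icc (0:ℝ) 1 ∧ ∀ j, (G 0).toFun^[j] x ∉ CC P Q 0 n) := by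
    rw [ae_all_iff]
    intro n
    rw [ae_iff]
    simp only [not_not]; exact CC.entry hα N V n 0
  filter_upwards [H] with x hx hx1
  have b3 : (3:ℝ) ≤ bb := by exact_mod_cast N.bb3
  set ρ := ((bb:ℝ) ^ 4)⁻¹ with hρ
  have ρ0 : 0 ≤ ρ := by positivity
  have ρ1 : ρ < 1 := inv_lt_one_of_one_lt₀ (one_lt_pow₀ (by linarith) (by norm_num))
  rw [Metric.tendsto_atTop]
  intro ε hε
  obtain ⟨n, hn⟩ := exists_pow_lt_of_lt_one hε ρ1
  have h1 := hx n
  push Not at h1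
  obtain ⟨j, hj⟩ := h1 hx1
  obtain ⟨-, hA⟩ := CC.attr hα N V n 0 _ hj
  refine ⟨j + 1, fun k hk => ?_⟩
  set z := (G 0).toFun^[j] x with hz
  have hs : ∃ s, PT (G 0) z s ((G 0).toFun z) := by
    rcases lt_or_ge z (G 0).c with h | h
    · exact ⟨false, Or.inl ⟨rfl, h, (G 0).toFun_left h⟩⟩
    · exact ⟨true, Or.inr ⟨rfl, h, (G 0).toFun_right h⟩⟩
  obtain ⟨s, hs⟩ := hs
  have hk' : (G 0).toFun^[k] x ∈ {x | Orb (G 0) (PT (G 0) z) true x} ∪ {x | Orb (G 0) (PT (G 0) z) false x} := by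
    rw [orb_range]
    refine ⟨s, _, k - (j + 1), hs, ?_⟩
    rw [hz, ← Function.iterate_succ_apply' (G 0).toFun j, ← Function.iterate_add_apply]
    congr 2; omega
  have : ∃ s', Orb (G 0) (PT (G 0) z) s' ((G 0).toFun^[k] x) ∧ {x | Orb (G 0) (CS (G 0)) s' x} ⊆ Λ := by
    rcases hk' with h | h
    · exact ⟨true, h, subset_union_left.trans hΛ⟩
    · exact ⟨false, h, subset_union_right.trans hΛ⟩
  obtain ⟨s', h2, h3⟩ := this
  have h4 := Metric.infDist_le_infDist_of_subset (x := (G 0).toFun^[k] x) h3 ⟨_, orb_start (G 0) s'⟩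
  rw [Real.dist_eq, sub_zero, abs_of_nonneg Metric.infDist_nonneg]
  linarith [hA s' _ h2]
end attr

theorem cantor_attractor (α σ β θ : ℝ) (hα : 1 < α) (hσ : σ ∈ Ioo (0 : ℝ) 1)
    (hσa : ∃ a : ℕ, 1 ≤ a ∧ α + σ ≤ (a : ℝ) + 1 ∧ (a : ℝ) + 1 ≤ 2 * α - σ)
    (hβ : β ∈ Ioo (0 : ℝ) ((σ / α) ^ 2)) (hθ : 1 < θ) :
    ∃ b0 : ℕ, ∀ bbar : ℕ, b0 ≤ bbar →
      ∀ f : LorenzMap α, f.IsCk 3 → f.NegSchwarzian → memK α σ θ bbar f →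
        ∀ ω : ℕ → ℕ × ℕ, (∀ n, memOmega α σ β bbar (ω n)) → InfRenormType α f ω →
          ∀ Λ : Set ℝ,
            Λ = closure ((Set.range fun k => f.toFun^[k] f.cv0) ∪
              (Set.range fun k => f.toFun^[k] f.cv1)) →
            (Λ.Nonempty ∧ IsCompact Λ ∧ Perfect Λ ∧ IsTotallyDisconnected Λ) ∧
            volume Λ = 0 ∧
            (0 < dimH Λ ∧ dimH Λ < 1) ∧
            (∀ᵐ x ∂(volume : Measure ℝ), x ∈ Icc (0 : ℝ) 1 →
              Tendsto (fun k => Metric.infDist (f.toFun^[k] x) Λ) atTop (𝓝 0)) := by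
  obtain ⟨θ', m, hθ', hN⟩ := num_exists hα hσ hβ hθ
  obtain ⟨b0, hb0⟩ := eventually_atTop.1 hN
  refine ⟨b0, fun bb hbb f h3 hS hK ω hω hI Λ hΛ => ?_⟩
  have N := hb0 bb hbb
  obtain ⟨G, p, q, hG, V⟩ := chain_all hα hσ hβ hθ' N h3 hS hK hω hI
  have hU : {x | Orb (G 0) (CS (G 0)) true x} ∪ {x | Orb (G 0) (CS (G 0)) false x} =
      (Set.range fun k => f.toFun^[k] f.cv0) ∪ (Set.range fun k => f.toFun^[k] f.cv1) := by
    rw [orb_range, hG]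
    ext x
    constructor
    · rintro ⟨s, y, k, hs, rfl⟩
      rw [CS] at hs
      subst hs
      cases s
      · exact Or.inr ⟨k, rfl⟩
      · exact Or.inl ⟨k, rfl⟩
    · rintro (⟨k, rfl⟩ | ⟨k, rfl⟩)
      · exact ⟨true, _, k, rfl, rfl⟩
      · exact ⟨false, _, k, rfl, rfl⟩
  rw [← hU] at hΛ
  obtain ⟨h1, h2, h4⟩ := (frac_of hα hσ hβ N V).main hΛ
  have h5 := attract hα N V (Λ := Λ) (by rw [hΛ]; exact subset_closure)
  rw [hG] at h5
  exact ⟨h1, h2, h4, h5⟩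

end
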